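/- Fix integers k ≥ 1 and s > k+1. For every real ε > 0 there exists n₀ such that for all integers n ≥ n₀ the following holds: if P is a finite set of n points in ℝ² and C is a k-intersecting family of n simple curves such that (P,C) does not contain a complete s-point (k+1)-configuration, then I(P,C) < ε · n^((3k+1)/(2k+1)). -/

import Mathlib

open scoped Classical

/-- A simple curve: the image of an injective continuous map from [0,1] into ℝ². -/
def IsSimpleCurve (γ : Set (ℝ × ℝ)) : Prop :=
  ∃ f : Set.Icc (0:ℝ) 1 → ℝ × ℝ, Continuous f ∧ Function.Injective f ∧ γ = Set.range f

/-- A k-intersecting family of simple curves: every member is a simple curve and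
any two distinct members intersect in at most k points. -/
def KIntersecting (C : Finset (Set (ℝ × ℝ))) (k : ℕ) : Prop :=
  (∀ γ ∈ C, IsSimpleCurve γ) ∧
  ∀ γ ∈ C, ∀ γ' ∈ C, γ ≠ γ' → (γ ∩ γ').Finite ∧ (γ ∩ γ').ncard ≤ k

/-- The number of incidences between a finite point set P and a finite family of curves C. -/
noncomputable def incidences (P : Finset (ℝ × ℝ)) (C : Finset (Set (ℝ × ℝ))) : ℕ :=
  ∑ γ ∈ C, (P.filter (fun p => p ∈ γ)).card

/-- (P,C) contains a complete s-point (k+1)-configuration: there are s points of P and an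
injective assignment of a distinct curve of C to each (k+1)-element subset, containing it. -/
def ContainsConfig (P : Finset (ℝ × ℝ)) (C : Finset (Set (ℝ × ℝ))) (s k : ℕ) : Prop :=
  ∃ S : Finset (ℝ × ℝ), S ⊆ P ∧ S.card = s ∧
    ∃ φ : Finset (ℝ × ℝ) → Set (ℝ × ℝ),
      Set.InjOn φ ↑(S.powersetCard (k+1)) ∧
      ∀ T ∈ S.powersetCard (k+1), φ T ∈ C ∧ (↑T : Set (ℝ × ℝ)) ⊆ φ T

theorem lift_exists {A : Type} [TopologicalSpace A] [SimplyConnectedSpace A]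
    [LocallyPathConnectedSpace A] (a₀ : A) (f : A → ℂ) (hf : Continuous f) (h0 : ∀ a, f a ≠ 0) :
    ∃ F : A → ℂ, Continuous F ∧ ∀ a, Complex.exp (F a) = f a := by
  obtain ⟨F, ⟨_, hF⟩, _⟩ := Complex.isCoveringMapOn_exp.existsUnique_continuousMap_lifts
    (A := A) ⟨f, hf⟩ (a₀ := a₀) (e₀ := Complex.log (f a₀)) (Complex.exp_log (h0 a₀))
    (fun a => by simpa using h0 a)
  exact ⟨F, F.continuous, fun a => congrFun hF a⟩

theorem lift_unique (F G : ℝ → ℂ) (hF : Continuous F) (hG : Continuous G) (u : ℂ)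
    (h : ∀ t, Complex.exp (F t) = u * Complex.exp (G t)) (x y : ℝ) :
    F y - F x = G y - G x := by
  obtain ⟨H, _, hu⟩ := Complex.isCoveringMapOn_exp.existsUnique_continuousMap_lifts
    (A := ℝ) ⟨fun t => Complex.exp (F t), by fun_prop⟩ (a₀ := x) (e₀ := F x) rfl
    (fun a => by simp)
  have h1 := hu ⟨F, hF⟩ ⟨rfl, rfl⟩
  have h2 := hu ⟨fun t => G t + (F x - G x), by fun_prop⟩ ⟨by simp, by
    funext t
    have e1 := h t
    have e2 := h x
    have hGx := Complex.exp_ne_zero (G x)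
    simp only [Function.comp, ContinuousMap.coe_mk]
    rw [Complex.exp_add, Complex.exp_sub, e1, e2]
    field_simp⟩
  have := congrArg (fun K : C(ℝ, ℂ) => K y) (h1.trans h2.symm)
  simp only [ContinuousMap.coe_mk] at this
  rw [this]; ring

/-- van Kampen–Flores for `K₅` in the plane: no continuous drawing without crossings of
independent edges. -/
theorem no_K5 (v : Fin 5 → ℂ) (g : Fin 5 → Fin 5 → ℝ → ℂ)
    (hc : ∀ i j, i < j → Continuous (g i j))
    (h0 : ∀ i j, i < j → g i j 0 = v i) (h1 : ∀ i j, i < j → g i j 1 = v j)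
    (hd : ∀ a b c d : Fin 5, a < b → c < d → a ≠ c → a ≠ d → b ≠ c → b ≠ d →
      ∀ s t, g a b s ≠ g c d t) : False := by
  have hvg : ∀ a c d : Fin 5, c < d → a ≠ c → a ≠ d → ∀ t, v a ≠ g c d t := by
    intro a c d hcd hac had t
    have : ∃ b : Fin 5, b ≠ a ∧ b ≠ c ∧ b ≠ d := by
      revert a c d; decide
    obtain ⟨b, hba, hbc, hbd⟩ := this
    rcases lt_or_gt_of_ne hba with h | h
    · rw [← h1 b a h]; exact hd b a c d h hcd hbc hbd hac had 1 t
    · rw [← h0 a b h]; exact hd a b c d h hcd hac had hbc hbd 0 t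
  have hvv : ∀ a b : Fin 5, a ≠ b → v a ≠ v b := by
    intro a b hab
    have : ∃ c : Fin 5, c ≠ a ∧ c ≠ b := by revert a b; decide
    obtain ⟨c, hca, hcb⟩ := this
    rcases lt_or_gt_of_ne hcb with h | h
    · rw [← h1 c b h]; exact hvg a c b h hca.symm hab 1
    · rw [← h0 b c h]; exact hvg a b c h hab hca.symm 0
  -- vertex-edge lifts
  have hl : ∀ a c d : Fin 5, ∃ F : ℝ → ℂ, (c < d ∧ a ≠ c ∧ a ≠ d) →
      Continuous F ∧ ∀ t, Complex.exp (F t) = v a - g c d t := by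
    intro a c d
    by_cases h : c < d ∧ a ≠ c ∧ a ≠ d
    · obtain ⟨F, hF⟩ := lift_exists (A := ℝ) 0 (fun t => v a - g c d t)
        (continuous_const.sub (hc c d h.1))
        (fun t => sub_ne_zero.2 (hvg a c d h.1 h.2.1 h.2.2 t))
      exact ⟨F, fun _ => hF⟩
    · exact ⟨0, fun h' => absurd h' h⟩
  choose F hF using hl
  -- square relation
  have hsq : ∀ a b c d : Fin 5, a < b → c < d → a ≠ c → a ≠ d → b ≠ c → b ≠ d →
      (F a c d 1 - F a c d 0) + (F d a b 1 - F d a b 0) - (F b c d 1 - F b c d 0)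
        - (F c a b 1 - F c a b 0) = 0 := by
    intro a b c d hab hcd hac had hbc hbd
    obtain ⟨L, hLc, hL⟩ := lift_exists (A := ℝ × ℝ) 0 (fun p => g a b p.1 - g c d p.2)
      (((hc a b hab).comp continuous_fst).sub ((hc c d hcd).comp continuous_snd))
      (fun p => sub_ne_zero.2 (hd a b c d hab hcd hac had hbc hbd _ _))
    have e1 := lift_unique (fun t => L (0, t)) (F a c d) (by fun_prop)
      (hF a c d ⟨hcd, hac, had⟩).1 1 (fun t => by
        rw [hL, (hF a c d ⟨hcd, hac, had⟩).2]; simp [h0 a b hab]) 0 1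
    have e2 := lift_unique (fun t => L (1, t)) (F b c d) (by fun_prop)
      (hF b c d ⟨hcd, hbc, hbd⟩).1 1 (fun t => by
        rw [hL, (hF b c d ⟨hcd, hbc, hbd⟩).2]; simp [h1 a b hab]) 0 1
    have e3 := lift_unique (fun t => L (t, 0)) (F c a b) (by fun_prop)
      (hF c a b ⟨hab, hac.symm, hbc.symm⟩).1 (-1) (fun t => by
        rw [hL, (hF c a b ⟨hab, hac.symm, hbc.symm⟩).2]; simp [h0 c d hcd]) 0 1
    have e4 := lift_unique (fun t => L (t, 1)) (F d a b) (by fun_prop)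
      (hF d a b ⟨hab, had.symm, hbd.symm⟩).1 (-1) (fun t => by
        rw [hL, (hF d a b ⟨hab, had.symm, hbd.symm⟩).2]; simp [h1 c d hcd]) 0 1
    rw [← e1, ← e2, ← e3, ← e4]; ring
  let Θ : Fin 5 → Fin 5 → ℂ := fun i j =>
    if i < j then Complex.log (v i - v j) else Complex.log (v j - v i) + Real.pi * Complex.I
  have hΘ : ∀ i j, i ≠ j → Complex.exp (Θ i j) = v i - v j := by
    intro i j hij
    simp only [Θ]
    split_ifs with h
    · exact Complex.exp_log (sub_ne_zero.2 (hvv _ _ hij))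
    · rw [Complex.exp_add, Complex.exp_log (sub_ne_zero.2 (hvv _ _ hij.symm)), Complex.exp_pi_mul_I]
      ring
  let σ : Fin 5 → Fin 5 → ℤ := fun i j => if i < j then -1 else 1
  have hσ : ∀ i j, i ≠ j → Θ i j - Θ j i = σ i j * (Real.pi * Complex.I) := by
    intro i j hij
    simp only [Θ, σ]
    rcases lt_or_gt_of_ne hij with h | h
    · simp [h, h.not_gt]
    · simp [h, h.not_gt]
  have hn : ∀ a c d : Fin 5, ∃ n : ℤ, (c < d ∧ a ≠ c ∧ a ≠ d) →
      F a c d 1 - F a c d 0 = Θ a d - Θ a c + n * (2 * Real.pi * Complex.I) := by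
    intro a c d
    by_cases h : c < d ∧ a ≠ c ∧ a ≠ d
    · have : Complex.exp (F a c d 1 - F a c d 0) = Complex.exp (Θ a d - Θ a c) := by
        rw [Complex.exp_sub, Complex.exp_sub, hΘ _ _ h.2.1, hΘ _ _ h.2.2, (hF a c d h).2,
          (hF a c d h).2, h0 c d h.1, h1 c d h.1]
      obtain ⟨n, hn⟩ := Complex.exp_eq_exp_iff_exists_int.1 this
      exact ⟨n, fun _ => hn⟩
    · exact ⟨0, fun h' => absurd h' h⟩
  choose n hn using hn
  have key : ∀ a b c d : Fin 5, a < b → c < d → a ≠ c → a ≠ d → b ≠ c → b ≠ d →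
      2 * (n a c d + n d a b - n b c d - n c a b) + (σ a d + σ c a + σ d b + σ b c) = 0 := by
    intro a b c d hab hcd hac had hbc hbd
    have e := hsq a b c d hab hcd hac had hbc hbd
    rw [hn a c d ⟨hcd, hac, had⟩, hn b c d ⟨hcd, hbc, hbd⟩, hn c a b ⟨hab, hac.symm, hbc.symm⟩,
      hn d a b ⟨hab, had.symm, hbd.symm⟩] at e
    have s1 := hσ a d had
    have s2 := hσ c a hac.symm
    have s3 := hσ d b hbd.symm
    have s4 := hσ b c hbc
    have hpi : (Real.pi * Complex.I : ℂ) ≠ 0 := by simp [Real.pi_ne_zero]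
    have : ((2 * (n a c d + n d a b - n b c d - n c a b) + (σ a d + σ c a + σ d b + σ b c) : ℤ) : ℂ)
        * (Real.pi * Complex.I) = 0 := by
      push_cast
      linear_combination e - s1 - s2 - s3 - s4
    have := (mul_eq_zero.1 this).resolve_right hpi
    exact_mod_cast this
  have k1 := key 0 1 2 3 (by decide) (by decide) (by decide) (by decide) (by decide) (by decide)
  have k2 := key 0 2 1 3 (by decide) (by decide) (by decide) (by decide) (by decide) (by decide)
  have k3 := key 0 3 1 2 (by decide) (by decide) (by decide) (by decide) (by decide) (by decide)
  have k4 := key 0 1 2 4 (by decide) (by decide) (by decide) (by decide) (by decide) (by decide)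
  have k5 := key 0 2 1 4 (by decide) (by decide) (by decide) (by decide) (by decide) (by decide)
  have k6 := key 0 4 1 2 (by decide) (by decide) (by decide) (by decide) (by decide) (by decide)
  have k7 := key 0 1 3 4 (by decide) (by decide) (by decide) (by decide) (by decide) (by decide)
  have k8 := key 0 3 1 4 (by decide) (by decide) (by decide) (by decide) (by decide) (by decide)
  have k9 := key 0 4 1 3 (by decide) (by decide) (by decide) (by decide) (by decide) (by decide)
  have k10 := key 0 2 3 4 (by decide) (by decide) (by decide) (by decide) (by decide) (by decide)
  have k11 := key 0 3 2 4 (by decide) (by decide) (by decide) (by decide) (by decide) (by decide)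
  have k12 := key 0 4 2 3 (by decide) (by decide) (by decide) (by decide) (by decide) (by decide)
  have k13 := key 1 2 3 4 (by decide) (by decide) (by decide) (by decide) (by decide) (by decide)
  have k14 := key 1 3 2 4 (by decide) (by decide) (by decide) (by decide) (by decide) (by decide)
  have k15 := key 1 4 2 3 (by decide) (by decide) (by decide) (by decide) (by decide) (by decide)
  simp [σ] at k1 k2 k3 k4 k5 k6 k7 k8 k9 k10 k11 k12 k13 k14 k15
  omega

section Sep
theorem sum_biUnion_le_aux {ι V : Type} (J : Finset ι) (X : ι → Finset V) (c : V → ℕ) :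
    ∑ v ∈ J.biUnion X, c v ≤ ∑ i ∈ J, ∑ v ∈ X i, c v := by
  induction J using Finset.induction_on with
  | empty => simp
  | insert a J ha ih =>
    rw [Finset.biUnion_insert, Finset.sum_insert ha]
    have := Finset.sum_union_inter (s₁ := X a) (s₂ := J.biUnion X) (f := c)
    omega

variable {V : Type} (r : V → V → Prop)

/-- combinatorial connectivity of a finite vertex set -/
def Conn (T : Finset V) : Prop :=
  T.Nonempty ∧ ∀ A : Finset V, A ⊆ T → A.Nonempty → (∀ u ∈ A, ∀ v ∈ T, r u v → v ∈ A) → A = T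

def IsComp (U Q : Finset V) : Prop :=
  Q ⊆ U ∧ Conn r Q ∧ ∀ u ∈ Q, ∀ v ∈ U, r u v → v ∈ Q

variable {r}

theorem conn_singleton (v : V) : Conn r {v} := by
  refine ⟨Finset.singleton_nonempty v, fun A hA hn _ => ?_⟩
  exact (Finset.subset_singleton_iff.1 hA).resolve_left hn.ne_empty

theorem Conn.prop {T : Finset V} (h : Conn r T) (p : V → Prop) {v : V} (hv : v ∈ T) (hp : p v)
    (hcl : ∀ u ∈ T, p u → ∀ w ∈ T, r u w → p w) : ∀ u ∈ T, p u := by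
  have := h.2 (T.filter p) (Finset.filter_subset _ _) ⟨v, by simp [hv, hp]⟩ (by
    intro u hu w hw huw
    simp only [Finset.mem_filter] at hu ⊢
    exact ⟨hw, hcl u hu.1 hu.2 w hw huw⟩)
  intro u hu
  rw [← this] at hu
  exact (Finset.mem_filter.1 hu).2

theorem Conn.of_prop {T : Finset V} {v : V} (hv : v ∈ T)
    (h : ∀ p : V → Prop, p v → (∀ u ∈ T, p u → ∀ w ∈ T, r u w → p w) → ∀ u ∈ T, p u)
    (hs : ∀ u v, r u v → r v u) : Conn r T := by
  refine ⟨⟨v, hv⟩, fun A hA hn hcl => ?_⟩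
  refine Finset.Subset.antisymm hA ?_
  by_cases hvA : v ∈ A
  · exact h (· ∈ A) hvA (fun u _ huA w hw huw => hcl u huA w hw huw)
  · have := h (· ∉ A) hvA (fun u hu huA w hw huw hwA => huA (hcl w hwA u hu (hs _ _ huw)))
    obtain ⟨x, hx⟩ := hn
    exact absurd hx (this x (hA hx))

theorem Conn.union (hs : ∀ u v, r u v → r v u) {S T : Finset V} (hS : Conn r S) (hT : Conn r T)
    {a b : V} (ha : a ∈ S) (hb : b ∈ T) (hab : a = b ∨ r a b) : Conn r (S ∪ T) := by
  refine Conn.of_prop (v := a) (Finset.mem_union_left _ ha) (fun p hp hcl => ?_) hs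
  have h1 : ∀ u ∈ S, p u := hS.prop p ha hp
    (fun u hu hpu w hw huw => hcl u (Finset.mem_union_left _ hu) hpu w (Finset.mem_union_left _ hw) huw)
  have hb' : p b := by
    rcases hab with rfl | h
    · exact hp
    · exact hcl a (Finset.mem_union_left _ ha) hp b (Finset.mem_union_right _ hb) h
  have h2 : ∀ u ∈ T, p u := hT.prop p hb hb'
    (fun u hu hpu w hw huw => hcl u (Finset.mem_union_right _ hu) hpu w (Finset.mem_union_right _ hw) huw)
  intro u hu
  rcases Finset.mem_union.1 hu with h | h
  · exact h1 u h
  · exact h2 u h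

theorem exists_comp (hs : ∀ u v, r u v → r v u) {U T : Finset V} (hT : Conn r T) (hTU : T ⊆ U) :
    ∃ Q, IsComp r U Q ∧ T ⊆ Q := by
  obtain ⟨Q, hQ, hmax⟩ := (U.powerset.filter (fun Q => Conn r Q ∧ T ⊆ Q)).exists_max_image
    Finset.card ⟨T, by simp [hTU, hT]⟩
  simp only [Finset.mem_filter, Finset.mem_powerset] at hQ hmax
  refine ⟨Q, ⟨hQ.1, hQ.2.1, fun u hu v hv huv => ?_⟩, hQ.2.2⟩
  by_contra hvQ
  have h1 := Conn.union hs hQ.2.1 (conn_singleton v) hu (Finset.mem_singleton_self v) (Or.inr huv)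
  have := hmax (Q ∪ {v}) ⟨Finset.union_subset hQ.1 (by simpa using hv), h1,
    hQ.2.2.trans Finset.subset_union_left⟩
  rw [Finset.card_union_of_disjoint (by simpa using hvQ)] at this
  simp at this

theorem IsComp.sub {U Q T : Finset V} (hQ : IsComp r U Q) (hT : Conn r T) (hTU : T ⊆ U)
    {x : V} (hx : x ∈ T) (hxQ : x ∈ Q) : T ⊆ Q :=
  hT.prop (· ∈ Q) hx hxQ (fun u _ hu w hw huw => hQ.2.2 u hu w (hTU hw) huw)

theorem IsComp.eq {U Q T : Finset V} (hQ : IsComp r U Q) (hT : IsComp r U T)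
    {x : V} (hx : x ∈ T) (hxQ : x ∈ Q) : T = Q :=
  Finset.Subset.antisymm (hQ.sub hT.2.1 hT.1 hx hxQ) (hT.sub hQ.2.1 hQ.1 hxQ hx)

/-- small Steiner connected set, or small cut -/
theorem tree_or_cut (hs : ∀ u v, r u v → r v u) (U : Finset V) (c : V → ℕ) (k R : ℕ) (hR : 0 < R)
    (A : ℕ → Finset V) :
    (∃ T ⊆ U, Conn r T ∧ (∀ i < k, ∃ x ∈ T, x ∈ A i) ∧ ∑ v ∈ T, c v ≤ R) ∨
    (∃ Z ⊆ U, R * ∑ v ∈ Z, c v ≤ (k + 1) * ∑ v ∈ U, c v ^ 2 ∧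
      ∀ Q ⊆ U \ Z, Conn r Q → ∃ i < k, ∀ x ∈ Q, x ∉ A i) := by
  let Reach : ℕ → ℕ → V → Prop := fun i t v =>
    ∃ T ⊆ U, Conn r T ∧ v ∈ T ∧ (∀ j < i, ∃ x ∈ T, x ∈ A j) ∧ ∑ v ∈ T, c v ≤ t
  let Z : ℕ → Finset V := fun τ => U.filter (fun v =>
    ∃ i ∈ Finset.range (k + 1), ¬ Reach i τ v ∧ Reach i (τ + c v) v)
  have hmono : ∀ i t t' v, t ≤ t' → Reach i t v → Reach i t' v := by
    rintro i t t' v h ⟨T, h1, h2, h3, h4, h5⟩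
    exact ⟨T, h1, h2, h3, h4, h5.trans h⟩
  have hcount : ∀ i v, ((Finset.range R).filter
      (fun τ => ¬ Reach i τ v ∧ Reach i (τ + c v) v)).card ≤ c v := by
    intro i v
    set D := (Finset.range R).filter (fun τ => ¬ Reach i τ v ∧ Reach i (τ + c v) v) with hD
    rcases D.eq_empty_or_nonempty with h | h
    · rw [h]; simp
    · have hm := D.min'_mem h
      set m := D.min' h
      have : D ⊆ Finset.Ico m (m + c v) := by
        intro τ hτ
        rw [Finset.mem_Ico]
        refine ⟨D.min'_le τ hτ, ?_⟩
        by_contra hcon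
        rw [hD, Finset.mem_filter] at hτ hm
        exact hτ.2.1 (hmono _ _ _ _ (not_lt.1 hcon) hm.2.2)
      calc D.card ≤ _ := Finset.card_le_card this
        _ = c v := by simp
  have hsum : ∑ τ ∈ Finset.range R, ∑ v ∈ Z τ, c v ≤ (k + 1) * ∑ v ∈ U, c v ^ 2 := by
    calc ∑ τ ∈ Finset.range R, ∑ v ∈ Z τ, c v
        ≤ ∑ τ ∈ Finset.range R, ∑ v ∈ U, ∑ i ∈ Finset.range (k + 1),
            if ¬ Reach i τ v ∧ Reach i (τ + c v) v then c v else 0 := by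
          refine Finset.sum_le_sum fun τ _ => ?_
          rw [Finset.sum_filter]
          refine Finset.sum_le_sum fun v _ => ?_
          split_ifs with h
          · obtain ⟨i, hi, h⟩ := h
            calc c v = if ¬ Reach i τ v ∧ Reach i (τ + c v) v then c v else 0 := by rw [if_pos h]
              _ ≤ _ := Finset.single_le_sum (f := fun i =>
                if ¬ Reach i τ v ∧ Reach i (τ + c v) v then c v else 0) (fun _ _ => Nat.zero_le _) hi
          · exact Nat.zero_le _
      _ = ∑ v ∈ U, ∑ i ∈ Finset.range (k + 1), ∑ τ ∈ Finset.range R,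
            if ¬ Reach i τ v ∧ Reach i (τ + c v) v then c v else 0 := by
          rw [Finset.sum_comm]
          refine Finset.sum_congr rfl fun v _ => ?_
          rw [Finset.sum_comm]
      _ ≤ ∑ v ∈ U, ∑ i ∈ Finset.range (k + 1), c v ^ 2 := by
          refine Finset.sum_le_sum fun v _ => Finset.sum_le_sum fun i _ => ?_
          rw [← Finset.sum_filter, Finset.sum_const, smul_eq_mul, pow_two]
          exact Nat.mul_le_mul_right _ (hcount i v)
      _ = _ := by
          rw [Finset.mul_sum]
          refine Finset.sum_congr rfl fun v _ => ?_
          simp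
  obtain ⟨τ, hτR, hτ⟩ : ∃ τ ∈ Finset.range R, R * ∑ v ∈ Z τ, c v ≤ (k + 1) * ∑ v ∈ U, c v ^ 2 := by
    by_contra hcon
    push Not at hcon
    have : ∑ τ ∈ Finset.range R, ((k + 1) * ∑ v ∈ U, c v ^ 2)
        < ∑ τ ∈ Finset.range R, (R * ∑ v ∈ Z τ, c v) :=
      Finset.sum_lt_sum_of_nonempty ⟨0, by simpa using hR⟩ hcon
    rw [Finset.sum_const, ← Finset.mul_sum, Finset.card_range, smul_eq_mul] at this
    exact absurd (Nat.mul_le_mul_left R hsum) (not_le.2 this)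
  by_cases hT : ∃ T ⊆ U, Conn r T ∧ (∀ i < k, ∃ x ∈ T, x ∈ A i) ∧ ∑ v ∈ T, c v ≤ R
  · exact Or.inl hT
  refine Or.inr ⟨Z τ, Finset.filter_subset _ _, hτ, fun Q hQ hQc => ?_⟩
  by_contra hcon
  push Not at hcon
  have hQU : ∀ v ∈ Q, v ∈ U := fun v hv => (Finset.mem_sdiff.1 (hQ hv)).1
  have hQZ : ∀ v ∈ Q, ∀ i ≤ k, Reach i (τ + c v) v → Reach i τ v := by
    intro v hv i hi h
    by_contra hn
    exact (Finset.mem_sdiff.1 (hQ hv)).2 (Finset.mem_filter.2 ⟨hQU v hv, i, by simp; omega, hn, h⟩)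
  have hstep : ∀ i ≤ k, (∃ v ∈ Q, Reach i τ v) → ∀ v ∈ Q, Reach i τ v := by
    rintro i hi ⟨v, hv, hr⟩
    refine hQc.prop (Reach i τ) hv hr ?_
    rintro u hu ⟨T, h1, h2, h3, h4, h5⟩ w hw huw
    refine hQZ w hw i hi ⟨T ∪ {w}, Finset.union_subset h1 (by simpa using hQU w hw),
      Conn.union hs h2 (conn_singleton w) h3 (Finset.mem_singleton_self w) (Or.inr huw), by simp,
      fun j hj => ?_, ?_⟩
    · obtain ⟨x, hx, hx'⟩ := h4 j hj
      exact ⟨x, Finset.mem_union_left _ hx, hx'⟩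
    · have := Finset.sum_union_inter (s₁ := T) (s₂ := {w}) (f := c)
      simp only [Finset.sum_singleton] at this
      omega
  have hall : ∀ i ≤ k, ∀ v ∈ Q, Reach i τ v := by
    intro i
    induction i with
    | zero =>
      intro _
      refine hstep 0 (Nat.zero_le _) ?_
      obtain ⟨v, hv⟩ := hQc.1
      refine ⟨v, hv, hQZ v hv 0 (Nat.zero_le _) ⟨{v}, by simpa using hQU v hv, conn_singleton v,
        by simp, by simp, by simp⟩⟩
    | succ i ih =>
      intro hi
      refine hstep (i + 1) hi ?_
      obtain ⟨x, hx, hxA⟩ := hcon i (by omega)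
      obtain ⟨T, h1, h2, h3, h4, h5⟩ := ih (by omega) x hx
      refine ⟨x, hx, T, h1, h2, h3, fun j hj => ?_, h5⟩
      rcases Nat.lt_succ_iff_lt_or_eq.1 hj with h | rfl
      · exact h4 j h
      · exact ⟨x, h3, hxA⟩
  obtain ⟨v, hv⟩ := hQc.1
  obtain ⟨T, h1, h2, h3, h4, h5⟩ := hall k le_rfl v hv
  exact hT ⟨T, h1, h2, h4, h5.trans (Finset.mem_range.1 hτR).le⟩

def NoK5Minor (r : V → V → Prop) : Prop :=
  ∀ B : Fin 5 → Finset V, (∀ i, Conn r (B i)) → (∀ i j, i ≠ j → Disjoint (B i) (B j)) →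
    (∀ i j, i ≠ j → ∃ u ∈ B i, ∃ v ∈ B j, r u v) → False

theorem separator_nat (hs : ∀ u v, r u v → r v u) (hK : NoK5Minor r) (U : Finset V) (c w : V → ℕ)
    (R : ℕ) (hR : 0 < R) (hRS : 6 * ∑ v ∈ U, c v ^ 2 ≤ R ^ 2) :
    ∃ X ⊆ U, ∑ v ∈ X, c v ≤ 5 * R ∧
      ∀ T ⊆ U \ X, Conn r T → 2 * ∑ v ∈ T, w v ≤ ∑ v ∈ U, w v := by
  by_contra hcon
  push Not at hcon
  have haven : ∀ X ⊆ U, ∑ v ∈ X, c v ≤ 5 * R →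
      ∃ Q, IsComp r (U \ X) Q ∧ ∑ v ∈ U, w v < 2 * ∑ v ∈ Q, w v := by
    intro X hX hc
    obtain ⟨T, hT, hTc, hw⟩ := hcon X hX hc
    obtain ⟨Q, hQ, hTQ⟩ := exists_comp hs hTc hT
    exact ⟨Q, hQ, hw.trans_le (Nat.mul_le_mul_left _ (Finset.sum_le_sum_of_subset hTQ))⟩
  have hmeet : ∀ Q ⊆ U, ∀ Q' ⊆ U, ∑ v ∈ U, w v < 2 * ∑ v ∈ Q, w v →
      ∑ v ∈ U, w v < 2 * ∑ v ∈ Q', w v → ∃ x ∈ Q, x ∈ Q' := by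
    intro Q hQ Q' hQ' h1 h2
    by_contra h
    push Not at h
    have hd : Disjoint Q Q' := Finset.disjoint_left.2 h
    have := Finset.sum_le_sum_of_subset (f := w) (Finset.union_subset hQ hQ')
    rw [Finset.sum_union hd] at this
    omega
  have main : ∀ q : ℕ, ∀ m : ℕ, ∀ (J : Finset (Fin 5)) (B Xs : Fin 5 → Finset V) (Q : Finset V),
      Q.card = q → J.card = m → (∀ i ∈ J, Conn r (B i) ∧ B i ⊆ U ∧ Xs i ⊆ B i ∧ Disjoint (B i) Q ∧
        ∑ v ∈ Xs i, c v ≤ R) →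
      (∀ i ∈ J, ∀ j ∈ J, i ≠ j → Disjoint (B i) (B j)) →
      (∀ i ∈ J, ∀ j ∈ J, i ≠ j → ∃ u ∈ B i, ∃ v ∈ B j, r u v) →
      IsComp r (U \ J.biUnion Xs) Q → ∑ v ∈ U, w v < 2 * ∑ v ∈ Q, w v → False := by
    intro q
    induction q using Nat.strong_induction_on with
    | _ q ihq =>
    intro m
    induction m using Nat.strong_induction_on with
    | _ m ihm =>
    intro J B Xs Q hq hm hB hdis hadj hQ hw
    have hQU : Q ⊆ U := hQ.1.trans Finset.sdiff_subset
    by_cases hJ : J = Finset.univ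
    · subst hJ
      exact hK B (fun i => (hB i (Finset.mem_univ _)).1)
        (fun i j => hdis i (Finset.mem_univ _) j (Finset.mem_univ _))
        (fun i j => hadj i (Finset.mem_univ _) j (Finset.mem_univ _))
    obtain ⟨j₀, hj₀⟩ : ∃ j, j ∉ J := by
      by_contra h; push Not at h; exact hJ (Finset.eq_univ_iff_forall.2 h)
    have hJc : J.card ≤ 4 := by
      have := Finset.card_lt_univ_of_notMem hj₀
      simp at this; omega
    have hXsU : ∀ i ∈ J, Xs i ⊆ U := fun i hi => (hB i hi).2.2.1.trans (hB i hi).2.1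
    have hbU : J.biUnion Xs ⊆ U := Finset.biUnion_subset.2 hXsU
    have hbc : ∑ v ∈ J.biUnion Xs, c v ≤ 4 * R := by
      calc _ ≤ ∑ i ∈ J, ∑ v ∈ Xs i, c v := sum_biUnion_le_aux _ _ _
        _ ≤ ∑ i ∈ J, R := Finset.sum_le_sum fun i hi => (hB i hi).2.2.2.2
        _ ≤ 4 * R := by rw [Finset.sum_const, smul_eq_mul]; exact Nat.mul_le_mul_right _ hJc
    -- neighbours
    by_cases hdrop : ∃ i ∈ J, ∀ u ∈ Q, ∀ v ∈ B i, ¬ r u v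
    · obtain ⟨i, hi, hno⟩ := hdrop
      refine ihm (m - 1) (by have := Finset.card_pos.2 ⟨i, hi⟩; omega) (J.erase i) B Xs Q hq
        (by rw [Finset.card_erase_of_mem hi, hm])
        (fun j hj => hB j (Finset.mem_of_mem_erase hj))
        (fun j hj j' hj' => hdis j (Finset.mem_of_mem_erase hj) j' (Finset.mem_of_mem_erase hj'))
        (fun j hj j' hj' => hadj j (Finset.mem_of_mem_erase hj) j' (Finset.mem_of_mem_erase hj'))
        ⟨?_, hQ.2.1, ?_⟩ hw
      · refine hQ.1.trans (Finset.sdiff_subset_sdiff (Finset.Subset.refl _) ?_)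
        exact Finset.biUnion_subset_biUnion_of_subset_left _ (Finset.erase_subset _ _)
      · intro u hu v hv huv
        refine hQ.2.2 u hu v ?_ huv
        simp only [Finset.mem_sdiff, Finset.mem_biUnion, not_exists, not_and, Finset.mem_erase] at hv ⊢
        refine ⟨hv.1, fun j hj hvj => ?_⟩
        by_cases hji : j = i
        · subst hji
          exact hno u hu v ((hB j hj).2.2.1 hvj) huv
        · exact hv.2 j ⟨hji, hj⟩ hvj
    push Not at hdrop
    let A : ℕ → Finset V := fun n => if h : n < 5 then
      (if (⟨n, h⟩ : Fin 5) ∈ J then Q.filter (fun u => ∃ v ∈ B ⟨n, h⟩, r u v) else Q) else Q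
    have hA1 : ∀ i ∈ J, ∀ u, u ∈ A i.1 ↔ u ∈ Q ∧ ∃ v ∈ B i, r u v := by
      intro i hi u
      simp only [A, i.2, dif_pos, Fin.eta, if_pos hi, Finset.mem_filter]
    have hA2 : ∀ n, (∀ i ∈ J, n ≠ i.1) → A n = Q := by
      intro n hn
      simp only [A]
      split_ifs with h1 h2
      · exact absurd rfl (hn _ h2)
      · rfl
      · rfl
    rcases tree_or_cut hs Q c 5 R hR A with ⟨T, hTQ, hTc, hTA, hTR⟩ | ⟨Z, hZQ, hZR, hZ⟩
    · -- add T
      let B' := Function.update B j₀ T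
      let Xs' := Function.update Xs j₀ T
      have hne : ∀ i ∈ J, i ≠ j₀ := fun i hi h => hj₀ (h ▸ hi)
      have hB' : ∀ i ∈ J, B' i = B i := fun i hi => Function.update_of_ne (hne i hi) _ _
      have hXs' : ∀ i ∈ J, Xs' i = Xs i := fun i hi => Function.update_of_ne (hne i hi) _ _
      have hBj : B' j₀ = T := Function.update_self _ _ _
      have hXj : Xs' j₀ = T := Function.update_self _ _ _
      have hbi : (insert j₀ J).biUnion Xs' = T ∪ J.biUnion Xs := by
        rw [Finset.biUnion_insert, hXj, Finset.biUnion_congr rfl hXs']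
      obtain ⟨Q', hQ', hw'⟩ := haven (T ∪ J.biUnion Xs) (Finset.union_subset (hTQ.trans hQU) hbU)
        (by
          have := Finset.sum_union_inter (s₁ := T) (s₂ := J.biUnion Xs) (f := c)
          omega)
      have hQ'U : Q' ⊆ U := hQ'.1.trans Finset.sdiff_subset
      obtain ⟨x, hx, hx'⟩ := hmeet Q hQU Q' hQ'U hw hw'
      have hQ'Q : Q' ⊆ Q := hQ.sub hQ'.2.1
        (hQ'.1.trans (Finset.sdiff_subset_sdiff (Finset.Subset.refl _) Finset.subset_union_right)) hx' hx
      have hQ'T : Disjoint T Q' := by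
        rw [Finset.disjoint_right]
        intro y hy hyT
        exact (Finset.mem_sdiff.1 (hQ'.1 hy)).2 (Finset.mem_union_left _ hyT)
      have hadjT : ∀ i ∈ J, ∃ u ∈ T, ∃ v ∈ B i, r u v := by
        intro i hi
        obtain ⟨y, hy, hyA⟩ := hTA i.1 i.2
        exact ⟨y, hy, ((hA1 i hi y).1 hyA).2⟩
      refine ihq Q'.card ?_ _ (insert j₀ J) B' Xs' Q' rfl rfl ?_ ?_ ?_ (by rw [hbi]; exact hQ') hw'
      · rw [← hq]
        obtain ⟨y, hy⟩ := hTc.1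
        exact Finset.card_lt_card ⟨hQ'Q, fun h => Finset.disjoint_left.1 hQ'T hy (h (hTQ hy))⟩
      · intro i hi
        rcases Finset.mem_insert.1 hi with rfl | hi
        · rw [hBj, hXj]
          exact ⟨hTc, hTQ.trans hQU, Finset.Subset.refl _, hQ'T, hTR⟩
        · rw [hB' i hi, hXs' i hi]
          obtain ⟨a1, a2, a3, a4, a5⟩ := hB i hi
          exact ⟨a1, a2, a3, a4.mono_right hQ'Q, a5⟩
      · intro i hi j hj hij
        rcases Finset.mem_insert.1 hi with rfl | hi' <;> rcases Finset.mem_insert.1 hj with rfl | hj'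
        · exact absurd rfl hij
        · rw [hBj, hB' j hj']
          exact ((hB j hj').2.2.2.1.mono_right hTQ).symm
        · rw [hBj, hB' i hi']
          exact ((hB i hi').2.2.2.1.mono_right hTQ)
        · rw [hB' i hi', hB' j hj']; exact hdis i hi' j hj' hij
      · intro i hi j hj hij
        rcases Finset.mem_insert.1 hi with rfl | hi' <;> rcases Finset.mem_insert.1 hj with rfl | hj'
        · exact absurd rfl hij
        · rw [hBj, hB' j hj']; exact hadjT j hj'
        · rw [hBj, hB' i hi']
          obtain ⟨u, hu, v, hv, huv⟩ := hadjT i hi'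
          exact ⟨v, hv, u, hu, hs _ _ huv⟩
        · rw [hB' i hi', hB' j hj']; exact hadj i hi' j hj' hij
    · -- cut Z
      have hZc : ∑ v ∈ Z, c v ≤ R := by
        have h1 : ∑ v ∈ Q, c v ^ 2 ≤ ∑ v ∈ U, c v ^ 2 := Finset.sum_le_sum_of_subset hQU
        have : R * ∑ v ∈ Z, c v ≤ R * R := by
          rw [← pow_two]
          refine hZR.trans (le_trans ?_ hRS)
          omega
        exact Nat.le_of_mul_le_mul_left this hR
      have hZU : Z ⊆ U := hZQ.trans hQU
      obtain ⟨Q', hQ', hw'⟩ := haven (Z ∪ J.biUnion Xs) (Finset.union_subset hZU hbU)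
        (by
          have := Finset.sum_union_inter (s₁ := Z) (s₂ := J.biUnion Xs) (f := c)
          omega)
      have hQ'U : Q' ⊆ U := hQ'.1.trans Finset.sdiff_subset
      obtain ⟨x, hx, hx'⟩ := hmeet Q hQU Q' hQ'U hw hw'
      have hQ'Q : Q' ⊆ Q := hQ.sub hQ'.2.1
        (hQ'.1.trans (Finset.sdiff_subset_sdiff (Finset.Subset.refl _) Finset.subset_union_right)) hx' hx
      have hQ'Z : Q' ⊆ Q \ Z := by
        intro y hy
        refine Finset.mem_sdiff.2 ⟨hQ'Q hy, fun h => ?_⟩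
        exact (Finset.mem_sdiff.1 (hQ'.1 hy)).2 (Finset.mem_union_left _ h)
      obtain ⟨n, hn, hno⟩ := hZ Q' hQ'Z hQ'.2.1
      obtain ⟨i, hi, rfl⟩ : ∃ i ∈ J, n = i.1 := by
        by_contra h
        push Not at h
        rw [hA2 n h] at hno
        exact hno x hx' hx
      have hno' : ∀ u ∈ Q', ∀ v ∈ B i, ¬ r u v := fun u hu v hv huv =>
        hno u hu ((hA1 i hi u).2 ⟨hQ'Q hu, v, hv, huv⟩)
      obtain ⟨b1, b2, b3, b4, b5⟩ := hB i hi
      obtain ⟨D, hD, hBD⟩ := exists_comp hs (U := B i ∪ (Q \ Q')) b1 Finset.subset_union_left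
      have hDQ' : Disjoint D Q' := by
        rw [Finset.disjoint_left]
        intro y hy hyQ'
        rcases Finset.mem_union.1 (hD.1 hy) with h | h
        · exact Finset.disjoint_left.1 b4 h (hQ'Q hyQ')
        · exact (Finset.mem_sdiff.1 h).2 hyQ'
      have hDj : ∀ j ∈ J, j ≠ i → Disjoint D (B j) := by
        intro j hj hji
        rw [Finset.disjoint_left]
        intro y hy hyB
        rcases Finset.mem_union.1 (hD.1 hy) with h | h
        · exact Finset.disjoint_left.1 (hdis i hi j hj hji.symm) h hyB
        · exact Finset.disjoint_left.1 (hB j hj).2.2.2.1 hyB (Finset.mem_sdiff.1 h).1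
      let B' := Function.update B i D
      let Xs' := Function.update Xs i (Z ∩ D)
      have hB' : ∀ j, j ≠ i → B' j = B j := fun j hj => Function.update_of_ne hj _ _
      have hXs' : ∀ j, j ≠ i → Xs' j = Xs j := fun j hj => Function.update_of_ne hj _ _
      have hBi : B' i = D := Function.update_self _ _ _
      have hXi : Xs' i = Z ∩ D := Function.update_self _ _ _
      have hX'sub : J.biUnion Xs' ⊆ Z ∪ J.biUnion Xs := by
        intro y hy
        obtain ⟨j, hj, hy⟩ := Finset.mem_biUnion.1 hy
        by_cases hji : j = i
        · subst hji
          rw [hXi] at hy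
          exact Finset.mem_union_left _ (Finset.mem_inter.1 hy).1
        · rw [hXs' j hji] at hy
          exact Finset.mem_union_right _ (Finset.mem_biUnion.2 ⟨j, hj, hy⟩)
      have hX'U : J.biUnion Xs' ⊆ U := hX'sub.trans (Finset.union_subset hZU hbU)
      obtain ⟨Q'', hQ'', hw''⟩ := haven (J.biUnion Xs') hX'U (by
          have h1 := Finset.sum_union_inter (s₁ := Z) (s₂ := J.biUnion Xs) (f := c)
          have h2 := Finset.sum_le_sum_of_subset (f := c) hX'sub
          omega)
      have hQ''U : Q'' ⊆ U := hQ''.1.trans Finset.sdiff_subset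
      obtain ⟨z, hz, hz''⟩ := hmeet Q' hQ'U Q'' hQ''U hw' hw''
      have hcl : ∀ u ∈ Q'', (u ∈ Q ∧ u ∉ D) → ∀ v ∈ Q'', r u v → (v ∈ Q ∧ v ∉ D) := by
        rintro u hu'' ⟨huQ, huD⟩ v hv'' huv
        have hvX : v ∉ J.biUnion Xs' := (Finset.mem_sdiff.1 (hQ''.1 hv'')).2
        have hvQ : v ∈ Q := by
          by_contra hvQ
          have hvX0 : v ∈ J.biUnion Xs := by
            by_contra h
            exact hvQ (hQ.2.2 u huQ v (Finset.mem_sdiff.2 ⟨hQ''U hv'', h⟩) huv)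
          obtain ⟨j, hj, hvj⟩ := Finset.mem_biUnion.1 hvX0
          have hji : j = i := by
            by_contra hji
            exact hvX (Finset.mem_biUnion.2 ⟨j, hj, by rw [hXs' j hji]; exact hvj⟩)
          subst hji
          have hvB := b3 hvj
          have huQ' : u ∉ Q' := fun h => hno' u h v hvB huv
          exact huD (hD.2.2 v (hBD hvB) u (Finset.mem_union_right _ (Finset.mem_sdiff.2 ⟨huQ, huQ'⟩))
            (hs _ _ huv))
        refine ⟨hvQ, fun hvD => ?_⟩
        have huQ' : u ∈ Q' := by
          by_contra h
          exact huD (hD.2.2 v hvD u (Finset.mem_union_right _ (Finset.mem_sdiff.2 ⟨huQ, h⟩))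
            (hs _ _ huv))
        have hvQ' : v ∉ Q' := Finset.disjoint_left.1 hDQ' hvD
        have hvZ : v ∈ Z ∪ J.biUnion Xs := by
          by_contra h
          exact hvQ' (hQ'.2.2 u huQ' v (Finset.mem_sdiff.2 ⟨hQU hvQ, h⟩) huv)
        rcases Finset.mem_union.1 hvZ with h | h
        · exact hvX (Finset.mem_biUnion.2 ⟨i, hi, by rw [hXi]; exact Finset.mem_inter.2 ⟨h, hvD⟩⟩)
        · exact (Finset.mem_sdiff.1 (hQ.1 hvQ)).2 h
      have hQ''QD : ∀ u ∈ Q'', u ∈ Q ∧ u ∉ D :=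
        hQ''.2.1.prop (fun u => u ∈ Q ∧ u ∉ D) hz''
          ⟨hQ'Q hz, fun h => Finset.disjoint_left.1 hDQ' h hz⟩ hcl
      have hQ''Q : Q'' ⊆ Q := fun u hu => (hQ''QD u hu).1
      refine ihq Q''.card ?_ _ J B' Xs' Q'' rfl rfl ?_ ?_ ?_ hQ'' hw''
      · rw [← hq]
        obtain ⟨u, hu, v, hv, huv⟩ := hdrop i hi
        have huQ' : u ∉ Q' := fun h => hno' u h v hv huv
        have huD : u ∈ D := hD.2.2 v (hBD hv) u
          (Finset.mem_union_right _ (Finset.mem_sdiff.2 ⟨hu, huQ'⟩)) (hs _ _ huv)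
        exact Finset.card_lt_card ⟨hQ''Q, fun h => (hQ''QD u (h hu)).2 huD⟩
      · intro j hj
        by_cases hji : j = i
        · subst hji
          rw [hBi, hXi]
          refine ⟨hD.2.1, hD.1.trans (Finset.union_subset b2 (Finset.sdiff_subset.trans hQU)),
            Finset.inter_subset_right, ?_, ?_⟩
          · rw [Finset.disjoint_right]; exact fun u hu => (hQ''QD u hu).2
          · exact (Finset.sum_le_sum_of_subset Finset.inter_subset_left).trans hZc
        · rw [hB' j hji, hXs' j hji]
          obtain ⟨a1, a2, a3, a4, a5⟩ := hB j hj
          exact ⟨a1, a2, a3, a4.mono_right hQ''Q, a5⟩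
      · intro j hj j' hj' hjj'
        by_cases hji : j = i
        · subst hji
          rw [hBi, hB' j' hjj'.symm]
          exact hDj j' hj' hjj'.symm
        · by_cases hji' : j' = i
          · subst hji'
            rw [hBi, hB' j hji]
            exact (hDj j hj hji).symm
          · rw [hB' j hji, hB' j' hji']; exact hdis j hj j' hj' hjj'
      · intro j hj j' hj' hjj'
        obtain ⟨u, hu, v, hv, huv⟩ := hadj j hj j' hj' hjj'
        refine ⟨u, ?_, v, ?_, huv⟩
        · by_cases hji : j = i
          · subst hji; rw [hBi]; exact hBD hu
          · rw [hB' j hji]; exact hu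
        · by_cases hji : j' = i
          · subst hji; rw [hBi]; exact hBD hv
          · rw [hB' j' hji]; exact hv
  obtain ⟨Q, hQ, hw⟩ := haven ∅ (Finset.empty_subset _) (by simp)
  exact main Q.card 0 ∅ (fun _ => ∅) (fun _ => ∅) Q rfl rfl (by simp) (by simp) (by simp)
    (by simpa using hQ) hw

theorem separator_real (hs : ∀ u v, r u v → r v u) (hK : NoK5Minor r) (U : Finset V) (c w : V → ℕ) :
    ∃ X ⊆ U, ((∑ v ∈ X, c v : ℕ) : ℝ) ≤ 20 * √((∑ v ∈ U, c v ^ 2 : ℕ) : ℝ) ∧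
      ∀ T ⊆ U \ X, Conn r T → 2 * ∑ v ∈ T, w v ≤ ∑ v ∈ U, w v := by
  set S := ∑ v ∈ U, c v ^ 2 with hS
  rcases Nat.eq_zero_or_pos S with h0 | hpos
  · obtain ⟨X, hX, _, h⟩ := separator_nat hs hK U c w 1 one_pos (by rw [← hS, h0]; simp)
    refine ⟨X, hX, ?_, h⟩
    have : ∑ v ∈ X, c v = 0 := by
      rw [Finset.sum_eq_zero_iff]
      intro v hv
      have := (Finset.sum_eq_zero_iff.1 (hS ▸ h0)) v (hX hv)
      simpa using this
    rw [this]; simp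
  · obtain ⟨X, hX, h1, h⟩ := separator_nat hs hK U c w ⌈√(6 * (S : ℝ))⌉₊
      (Nat.ceil_pos.2 (by positivity)) (by
        rw [← hS]
        have h1 : √(6 * (S : ℝ)) ≤ ⌈√(6 * (S : ℝ))⌉₊ := Nat.le_ceil _
        have h2 : 6 * (S : ℝ) ≤ (⌈√(6 * (S : ℝ))⌉₊ : ℝ) ^ 2 := by
          rw [← Real.sqrt_le_left (by positivity)]; exact h1
        exact_mod_cast h2)
    refine ⟨X, hX, ?_, h⟩
    have h2 : (⌈√(6 * (S : ℝ))⌉₊ : ℝ) < √(6 * (S : ℝ)) + 1 := Nat.ceil_lt_add_one (Real.sqrt_nonneg _)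
    have h3 : (1 : ℝ) ≤ √(S : ℝ) := by
      rw [Real.one_le_sqrt]; exact_mod_cast hpos
    have h4 : √(6 * (S : ℝ)) ≤ 3 * √(S : ℝ) := by
      rw [Real.sqrt_mul (by norm_num)]
      refine mul_le_mul_of_nonneg_right ?_ (Real.sqrt_nonneg _)
      rw [Real.sqrt_le_left (by norm_num)]; norm_num
    have h5 : ((∑ v ∈ X, c v : ℕ) : ℝ) ≤ 5 * ⌈√(6 * (S : ℝ))⌉₊ := by exact_mod_cast h1
    linarith

theorem division (hs : ∀ u v, r u v → r v u) (hK : NoK5Minor r) (U : Finset V) (c w : V → ℕ) (i : ℕ) :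
    ∃ X ⊆ U, ((∑ v ∈ X, c v : ℕ) : ℝ) ≤ 80 * √((∑ v ∈ U, c v ^ 2 : ℕ) : ℝ) * √2 ^ i ∧
      ∀ T ⊆ U \ X, Conn r T → 2 ^ i * ∑ v ∈ T, w v ≤ ∑ v ∈ U, w v := by
  induction i with
  | zero =>
    refine ⟨∅, by simp, by simp, fun T hT _ => ?_⟩
    simpa using Finset.sum_le_sum_of_subset (by simpa using hT)
  | succ i ih =>
    obtain ⟨X, hX, hXc, hXl⟩ := ih
    let W := ∑ v ∈ U, w v
    let QQ := (U \ X).powerset.filter (fun Q => IsComp r (U \ X) Q ∧ W < 2 ^ (i + 1) * ∑ v ∈ Q, w v)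
    have hQQ : ∀ Q ∈ QQ, IsComp r (U \ X) Q ∧ W < 2 ^ (i + 1) * ∑ v ∈ Q, w v :=
      fun Q hQ => (Finset.mem_filter.1 hQ).2
    have hdisj : (QQ : Set (Finset V)).PairwiseDisjoint id := by
      intro Q hQ Q' hQ' hne
      rw [Function.onFun, id, id, Finset.disjoint_left]
      intro x hx hx'
      exact hne ((hQQ Q' hQ').1.eq (hQQ Q hQ).1 hx hx')
    have hsubU : QQ.biUnion id ⊆ U := by
      intro x hx
      obtain ⟨Q, hQ, hx⟩ := Finset.mem_biUnion.1 hx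
      exact (Finset.mem_sdiff.1 ((hQQ Q hQ).1.1 hx)).1
    have hsumle : ∀ f : V → ℕ, ∑ Q ∈ QQ, ∑ v ∈ Q, f v ≤ ∑ v ∈ U, f v := by
      intro f
      have := Finset.sum_biUnion (f := f) hdisj
      simp only [id] at this
      rw [← this]
      exact Finset.sum_le_sum_of_subset hsubU
    have hcard : QQ.card ≤ 2 ^ (i + 1) := by
      by_contra hcon
      push Not at hcon
      have h1 : ∑ Q ∈ QQ, (W + 1) ≤ ∑ Q ∈ QQ, 2 ^ (i + 1) * ∑ v ∈ Q, w v :=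
        Finset.sum_le_sum fun Q hQ => (hQQ Q hQ).2
      rw [← Finset.mul_sum, Finset.sum_const, smul_eq_mul] at h1
      have h2 := Nat.mul_le_mul_left (2 ^ (i + 1)) (hsumle w)
      have h3 : 2 ^ (i + 1) * (W + 1) ≤ QQ.card * (W + 1) := Nat.mul_le_mul_right _ hcon.le
      have h4 : 0 < 2 ^ (i + 1) := by positivity
      have h5 : 2 ^ (i + 1) * (W + 1) ≤ 2 ^ (i + 1) * W := h3.trans (h1.trans h2)
      have := Nat.le_of_mul_le_mul_left h5 h4
      omega
    choose Y hY1 hY2 hY3 using fun Q => separator_real hs hK Q c w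
    refine ⟨X ∪ QQ.biUnion Y, ?_, ?_, ?_⟩
    · refine Finset.union_subset hX (Finset.biUnion_subset.2 fun Q hQ => (hY1 Q).trans ?_)
      exact (hQQ Q hQ).1.1.trans Finset.sdiff_subset
    · have h1 : ∑ v ∈ X ∪ QQ.biUnion Y, c v ≤ ∑ v ∈ X, c v + ∑ Q ∈ QQ, ∑ v ∈ Y Q, c v := by
        have := Finset.sum_union_inter (s₁ := X) (s₂ := QQ.biUnion Y) (f := c)
        have h2 := sum_biUnion_le_aux QQ Y c
        omega
      have h2 : ((∑ Q ∈ QQ, ∑ v ∈ Y Q, c v : ℕ) : ℝ) ≤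
          20 * (√((∑ v ∈ U, c v ^ 2 : ℕ) : ℝ) * √2 ^ (i + 1)) := by
        calc ((∑ Q ∈ QQ, ∑ v ∈ Y Q, c v : ℕ) : ℝ) = ∑ Q ∈ QQ, ((∑ v ∈ Y Q, c v : ℕ) : ℝ) := by
              push_cast; rfl
          _ ≤ ∑ Q ∈ QQ, 20 * √((∑ v ∈ Q, c v ^ 2 : ℕ) : ℝ) := Finset.sum_le_sum fun Q _ => hY2 Q
          _ = 20 * ∑ Q ∈ QQ, √((∑ v ∈ Q, c v ^ 2 : ℕ) : ℝ) * √1 := by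
              rw [Finset.mul_sum]; simp
          _ ≤ 20 * (√(∑ Q ∈ QQ, ((∑ v ∈ Q, c v ^ 2 : ℕ) : ℝ)) * √(∑ Q ∈ QQ, (1 : ℝ))) := by
              refine mul_le_mul_of_nonneg_left ?_ (by norm_num)
              exact Real.sum_sqrt_mul_sqrt_le _ (fun _ => by positivity) (fun _ => by positivity)
          _ ≤ _ := by
              refine mul_le_mul_of_nonneg_left ?_ (by norm_num)
              refine mul_le_mul ?_ ?_ (Real.sqrt_nonneg _) (Real.sqrt_nonneg _)
              · refine Real.sqrt_le_sqrt ?_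
                have := hsumle (fun v => c v ^ 2)
                exact_mod_cast this
              · rw [← Real.sqrt_eq_iff_mul_self_eq_of_pos (by positivity) |>.2 (by
                  rw [← pow_two, ← pow_mul, mul_comm, pow_mul, Real.sq_sqrt (by norm_num)] :
                  √2 ^ (i+1) * √2 ^ (i+1) = (2:ℝ) ^ (i+1))]
                refine Real.sqrt_le_sqrt ?_
                simp only [Finset.sum_const, nsmul_eq_mul, mul_one]
                exact_mod_cast hcard
      have h3 : ((∑ v ∈ X ∪ QQ.biUnion Y, c v : ℕ) : ℝ) ≤
          ((∑ v ∈ X, c v : ℕ) : ℝ) + ((∑ Q ∈ QQ, ∑ v ∈ Y Q, c v : ℕ) : ℝ) := by exact_mod_cast h1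
      have hq : (1.4 : ℝ) ≤ √2 := by rw [Real.le_sqrt' (by norm_num)]; norm_num
      set a := √((∑ v ∈ U, c v ^ 2 : ℕ) : ℝ)
      have ha : 0 ≤ a * √2 ^ i := by positivity
      rw [pow_succ] at h2 ⊢
      nlinarith
    · intro T hT hTc
      by_contra hcon
      push Not at hcon
      have hTX : T ⊆ U \ X := hT.trans (Finset.sdiff_subset_sdiff (Finset.Subset.refl _) Finset.subset_union_left)
      obtain ⟨Q, hQ, hTQ⟩ := exists_comp hs hTc hTX
      have hTQw : ∑ v ∈ T, w v ≤ ∑ v ∈ Q, w v := Finset.sum_le_sum_of_subset hTQ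
      have hQin : Q ∈ QQ := Finset.mem_filter.2 ⟨Finset.mem_powerset.2 hQ.1, hQ,
        lt_of_lt_of_le hcon (Nat.mul_le_mul_left _ hTQw)⟩
      have h1 := hY3 Q T (fun x hx => Finset.mem_sdiff.2 ⟨hTQ hx, fun h =>
        (Finset.mem_sdiff.1 (hT hx)).2 (Finset.mem_union_right _ (Finset.mem_biUnion.2 ⟨Q, hQin, h⟩))⟩) hTc
      have h2 := hXl Q hQ.1 hQ.2.1
      have h3 : 2 ^ (i + 1) * ∑ v ∈ T, w v ≤ 2 ^ i * ∑ v ∈ Q, w v := by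
        rw [pow_succ, mul_assoc]; exact Nat.mul_le_mul_left _ h1
      exact absurd (h3.trans h2) (not_le.2 hcon)

end Sep

section Core
open MeasureTheory Filter Topology

theorem int_pull {Ω : Type} {m m0 : MeasurableSpace Ω} (P : @Measure Ω m0) [IsProbabilityMeasure P]
    (hm : m ≤ m0) {f g : Ω → ℝ} (hf : StronglyMeasurable[m] f) (hg : Integrable g P) (c : ℝ)
    (hb : ∀ᵐ ω ∂P, ‖f ω‖ ≤ c) : ∫ ω, f ω * g ω ∂P = ∫ ω, f ω * (P[g | m]) ω ∂P := by
  rw [← integral_condExp hm]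
  exact integral_congr_ae (condExp_stronglyMeasurable_mul_of_bound hm hf hg c hb)

theorem condExp_eq_of_map {Ω : Type} {m1 m2 m0 : MeasurableSpace Ω} (P : @Measure Ω m0)
    [IsProbabilityMeasure P] (h21 : m2 ≤ m1) (h1 : m1 ≤ m0) (θ : Ω → Ω)
    (hθ : MeasurePreserving θ P P) (hm : @Measurable _ _ m2 m1 θ) (X : Ω → ℝ)
    (hXm : AEStronglyMeasurable X P) (C : NNReal) (hXb : ∀ᵐ ω ∂P, |X ω| ≤ C) (hX : X ∘ θ = X) :
    P[X | m1] =ᵐ[P] P[X | m2] := by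
  set Z := P[X | m1] with hZ
  set Y := P[X | m2] with hY
  have hXi : Integrable X P := Integrable.of_bound hXm C hXb
  have hZs : StronglyMeasurable[m1] Z := stronglyMeasurable_condExp
  have hYs : StronglyMeasurable[m2] Y := stronglyMeasurable_condExp
  have hZθs : StronglyMeasurable[m2] (Z ∘ θ) := hZs.comp_measurable hm
  have hZb : ∀ᵐ ω ∂P, ‖Z ω‖ ≤ C := ae_bdd_abs_condExp_of_ae_bdd_abs hXb
  have hYb : ∀ᵐ ω ∂P, ‖Y ω‖ ≤ C := ae_bdd_abs_condExp_of_ae_bdd_abs hXb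
  have hZθb : ∀ᵐ ω ∂P, ‖(Z ∘ θ) ω‖ ≤ C := hθ.quasiMeasurePreserving.ae hZb
  have hZi : Integrable Z P := integrable_condExp
  have hYi : Integrable Y P := integrable_condExp
  have hZθi : Integrable (Z ∘ θ) P := (hθ.integrable_comp hZi.1).2 hZi
  have ZZ : Integrable (fun ω => Z ω * Z ω) P := hZi.bdd_mul hZi.1 hZb
  have YY : Integrable (fun ω => Y ω * Y ω) P := hYi.bdd_mul hYi.1 hYb
  have ZY : Integrable (fun ω => Y ω * Z ω) P := hZi.bdd_mul hYi.1 hYb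
  have ZθY : Integrable (fun ω => (Z ∘ θ) ω * Y ω) P := hYi.bdd_mul hZθi.1 hZθb
  have ZθZθ : Integrable (fun ω => (Z ∘ θ) ω * (Z ∘ θ) ω) P := hZθi.bdd_mul hZθi.1 hZθb
  have hcomp : ∀ φ : Ω → ℝ, AEStronglyMeasurable φ P → ∫ ω, φ (θ ω) ∂P = ∫ ω, φ ω ∂P := by
    intro φ hφ
    rw [← integral_map hθ.aemeasurable (by rw [hθ.map_eq]; exact hφ), hθ.map_eq]
  have hquad : ∀ a b : Ω → ℝ, Integrable (fun ω => a ω * a ω) P → Integrable (fun ω => b ω * a ω) P →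
      Integrable (fun ω => b ω * b ω) P → ∫ ω, (a ω - b ω) ^ 2 ∂P =
      ∫ ω, a ω * a ω ∂P - 2 * ∫ ω, b ω * a ω ∂P + ∫ ω, b ω * b ω ∂P := by
    intro a b h1 h2 h3
    have : (fun ω => (a ω - b ω) ^ 2) = fun ω => (a ω * a ω - 2 * (b ω * a ω)) + b ω * b ω := by
      funext ω; ring
    rw [this, integral_add (f := fun ω => a ω * a ω - 2 * (b ω * a ω)) (h1.sub (h2.const_mul 2)) h3,
      integral_sub h1 (h2.const_mul 2), integral_const_mul]
  have e1 : ∫ ω, Z ω * X ω ∂P = ∫ ω, Z ω * Z ω ∂P := int_pull P h1 hZs hXi C hZb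
  have e2 : ∫ ω, (Z ∘ θ) ω * X ω ∂P = ∫ ω, (Z ∘ θ) ω * Y ω ∂P :=
    int_pull P (h21.trans h1) hZθs hXi C hZθb
  have e3 : ∫ ω, (Z ∘ θ) ω * X ω ∂P = ∫ ω, Z ω * X ω ∂P := by
    have := hcomp (fun ω => Z ω * X ω) (hZi.1.mul hXm)
    rw [← this]
    refine integral_congr_ae (.of_forall fun ω => ?_)
    have := congrFun hX ω
    simp only [Function.comp] at this ⊢
    rw [this]
  have e4 : ∫ ω, (Z ∘ θ) ω * (Z ∘ θ) ω ∂P = ∫ ω, Z ω * Z ω ∂P :=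
    hcomp (fun ω => Z ω * Z ω) (hZi.1.mul hZi.1)
  have e5 : ∫ ω, Y ω * X ω ∂P = ∫ ω, Y ω * Y ω ∂P := int_pull P (h21.trans h1) hYs hXi C hYb
  have e6 : ∫ ω, Y ω * X ω ∂P = ∫ ω, Y ω * Z ω ∂P := int_pull P h1 (hYs.mono h21) hXi C hYb
  have p1 : 0 ≤ ∫ ω, (Y ω - (Z ∘ θ) ω) ^ 2 ∂P := integral_nonneg fun _ => sq_nonneg _
  have p2 : ∫ ω, (Y ω - (Z ∘ θ) ω) ^ 2 ∂P =
      ∫ ω, Y ω * Y ω ∂P - 2 * ∫ ω, (Z ∘ θ) ω * Y ω ∂P + ∫ ω, (Z ∘ θ) ω * (Z ∘ θ) ω ∂P :=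
    hquad Y (Z ∘ θ) YY ZθY ZθZθ
  have p3 : ∫ ω, (Z ω - Y ω) ^ 2 ∂P =
      ∫ ω, Z ω * Z ω ∂P - 2 * ∫ ω, Y ω * Z ω ∂P + ∫ ω, Y ω * Y ω ∂P := hquad Z Y ZZ ZY YY
  have p4 : ∫ ω, (Z ω - Y ω) ^ 2 ∂P = 0 :=
    le_antisymm (by linarith) (integral_nonneg fun _ => sq_nonneg _)
  have hintg : Integrable (fun ω => (Z ω - Y ω) ^ 2) P := by
    refine ((ZZ.sub (ZY.const_mul 2)).add YY).congr (.of_forall fun ω => by simp; ring)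
  have := (integral_eq_zero_iff_of_nonneg (fun _ => sq_nonneg _) hintg).1 p4
  filter_upwards [this] with ω h
  simpa [sub_eq_zero] using h


end Core

section Core
open MeasureTheory Filter Topology
variable {I : Type}

/-- sigma algebra generated by the coordinates in `S` -/
def BS (S : Set I) : MeasurableSpace (I → Bool) :=
  ⨆ b ∈ S, MeasurableSpace.comap (fun ω : I → Bool => ω b) ⊤

theorem BS_mono {S T : Set I} (h : S ⊆ T) : BS S ≤ BS T := biSup_mono h

theorem BS_le (S : Set I) : BS S ≤ MeasurableSpace.pi :=
  iSup₂_le fun b _ => (measurable_pi_apply (X := fun _ : I => Bool) b).comap_le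

theorem BS_bit {S : Set I} {b : I} (hb : b ∈ S) (c : Bool) :
    MeasurableSet[BS S] {ω : I → Bool | ω b = c} := by
  have h : MeasurableSpace.comap (fun ω : I → Bool => ω b) ⊤ ≤ BS S :=
    le_iSup₂_of_le (f := fun b (_ : b ∈ S) => MeasurableSpace.comap (fun ω : I → Bool => ω b) ⊤)
      b hb le_rfl
  exact h _ ⟨{c}, trivial, rfl⟩

theorem BS_map {S T : Set I} {θ : I → I} (h : ∀ b ∈ S, θ b ∈ T) :
    @Measurable _ _ (BS T) (BS S) (fun (ω : I → Bool) b => ω (θ b)) := by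
  rw [measurable_iff_comap_le, BS, MeasurableSpace.comap_iSup]
  refine iSup_le fun b => ?_
  rw [MeasurableSpace.comap_iSup]
  refine iSup_le fun hb => ?_
  rw [MeasurableSpace.comap_comp]
  exact le_iSup₂_of_le (f := fun b (_ : b ∈ T) => MeasurableSpace.comap (fun ω : I → Bool => ω b) ⊤)
    (θ b) (h b hb) le_rfl

theorem BS_iUnion_le {S : Set I} {T : ℕ → Set I} (h : ∀ b ∈ S, ∃ n, b ∈ T n) :
    BS S ≤ ⨆ n, BS (T n) := by
  refine iSup₂_le fun b hb => ?_
  obtain ⟨n, hn⟩ := h b hb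
  refine le_trans ?_ (le_iSup _ n)
  exact le_iSup₂_of_le (f := fun b (_ : b ∈ T n) =>
    MeasurableSpace.comap (fun ω : I → Bool => ω b) ⊤) b hn le_rfl

theorem BS_dep {S : Set I} {A : Set (I → Bool)} (hA : MeasurableSet[BS S] A) {ω ω' : I → Bool}
    (h : ∀ b ∈ S, ω b = ω' b) : ω ∈ A ↔ ω' ∈ A := by
  have h1 : BS S ≤ MeasurableSpace.comap (fun (ω : I → Bool) (b : S) => ω b) ⊤ := by
    refine iSup₂_le fun b hb => ?_
    rintro _ ⟨t, _, rfl⟩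
    exact ⟨(fun f => f ⟨b, hb⟩) ⁻¹' t, trivial, rfl⟩
  obtain ⟨t, _, rfl⟩ := h1 _ hA
  have : (fun b : S => ω b) = fun b : S => ω' b := funext fun b => h b b.2
  simp only [Set.mem_preimage, this]

theorem BS_trace {S F : Set I} (a : I → Bool) {T : Set (I → Bool)}
    (hT : MeasurableSet[BS (S ∪ F)] T) :
    ∃ D, MeasurableSet[BS S] D ∧ T ∩ {ω | ∀ b ∈ F, ω b = a b} = D ∩ {ω | ∀ b ∈ F, ω b = a b} := by
  set A : Set (I → Bool) := {ω | ∀ b ∈ F, ω b = a b}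
  have h1 : MeasurableSpace.comap (Subtype.val : A → I → Bool) (BS (S ∪ F)) ≤
      MeasurableSpace.comap (Subtype.val : A → I → Bool) (BS S) := by
    rw [BS, MeasurableSpace.comap_iSup]
    refine iSup_le fun b => ?_
    rw [MeasurableSpace.comap_iSup]
    refine iSup_le fun hb => ?_
    rcases hb with hb | hb
    · refine MeasurableSpace.comap_mono ?_
      exact le_iSup₂_of_le (f := fun b (_ : b ∈ S) =>
        MeasurableSpace.comap (fun ω : I → Bool => ω b) ⊤) b hb le_rfl
    · rw [MeasurableSpace.comap_comp]
      have : ((fun ω : I → Bool => ω b) ∘ (Subtype.val : A → I → Bool)) = fun _ => a b := by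
        funext ω; exact ω.2 b hb
      rw [this, MeasurableSpace.comap_const]
      exact bot_le
  obtain ⟨D, hD, hDT⟩ := h1 _ ⟨T, hT, rfl⟩
  refine ⟨D, hD, ?_⟩
  rw [Set.inter_comm T, Set.inter_comm D]
  exact (Subtype.preimage_val_eq_preimage_val_iff _ _ _).1 hDT.symm

theorem CI [Countable I] (P : Measure (I → Bool)) [IsProbabilityMeasure P] (S1 S2 Se : Set I)
    (h21 : S2 ⊆ S1)
    (hθ : ∀ F : Finset I, ↑F ⊆ Se → ∃ θ : I → I, (∀ b ∈ F, θ b = b) ∧ (∀ b ∈ S1, θ b ∈ S2) ∧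
      MeasurePreserving (fun (ω : I → Bool) b => ω (θ b)) P P)
    (X : (I → Bool) → ℝ) (hX : StronglyMeasurable[BS Se] X) (C : NNReal)
    (hXb : ∀ ω, |X ω| ≤ C) : P[X | BS S1] =ᵐ[P] P[X | BS S2] := by
  haveI := Encodable.ofCountable I
  have hXi : Integrable X P := Integrable.of_bound (hX.mono (BS_le _)).aestronglyMeasurable C
    (.of_forall hXb)
  let T : ℕ → Set I := fun n => Se ∩ {b | Encodable.encode b < n}
  have hTfin : ∀ n, (T n).Finite := by
    intro n
    refine Set.Finite.subset ?_ Set.inter_subset_right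
    exact Set.Finite.preimage (Encodable.encode_injective.injOn) (Set.finite_lt_nat n)
  let ℱ : Filtration ℕ (MeasurableSpace.pi : MeasurableSpace (I → Bool)) :=
    ⟨fun n => BS (T n), fun i j hij => BS_mono fun b hb => ⟨hb.1, lt_of_lt_of_le hb.2 hij⟩,
      fun n => BS_le _⟩
  have hsup : BS Se ≤ ⨆ n, ℱ n := BS_iUnion_le fun b hb => ⟨Encodable.encode b + 1, hb, Nat.lt_succ_self _⟩
  have hconv := hXi.tendsto_eLpNorm_condExp (ℱ := ℱ) (hX.mono hsup)
  have hn : ∀ n, P[P[X | ℱ n] | BS S1] =ᵐ[P] P[P[X | ℱ n] | BS S2] := by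
    intro n
    obtain ⟨θ, h1, h2, h3⟩ := hθ (hTfin n).toFinset (by simp [T])
    have hs : StronglyMeasurable[BS (T n)] (P[X | ℱ n]) := stronglyMeasurable_condExp
    refine condExp_eq_of_map P (BS_mono h21) (BS_le _) _ h3 (BS_map h2) _
      (hs.mono (BS_le _)).aestronglyMeasurable C
      (ae_bdd_abs_condExp_of_ae_bdd_abs (.of_forall hXb)) ?_
    funext ω
    have hm : MeasurableSet[BS (T n)] ((P[X | ℱ n]) ⁻¹' {(P[X | ℱ n]) ω}) :=
      hs.measurable (measurableSet_singleton _)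
    exact (BS_dep hm (ω' := fun b => ω (θ b)) (ω := ω) (fun b hb => by
      rw [h1 b ((hTfin n).mem_toFinset.2 hb)])).1 rfl
  have hle : ∀ n, eLpNorm (P[X | BS S1] - P[X | BS S2]) 1 P ≤
      eLpNorm (P[X | ℱ n] - X) 1 P + eLpNorm (P[X | ℱ n] - X) 1 P := by
    intro n
    have e1 : P[X | BS S1] - P[X | BS S2] =ᵐ[P]
        P[P[X | ℱ n] - X | BS S2] - P[P[X | ℱ n] - X | BS S1] := by
      filter_upwards [hn n, condExp_sub (m := BS S1) (integrable_condExp (μ := P) (m := ℱ n) (f := X)) hXi,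
        condExp_sub (m := BS S2) (integrable_condExp (μ := P) (m := ℱ n) (f := X)) hXi] with ω a1 a2 a3
      simp only [Pi.sub_apply] at *
      rw [a2, a3, a1]; ring
    rw [eLpNorm_congr_ae e1]
    refine (eLpNorm_sub_le integrable_condExp.1 integrable_condExp.1 le_rfl).trans ?_
    exact add_le_add (eLpNorm_one_condExp_le_eLpNorm _) (eLpNorm_one_condExp_le_eLpNorm _)
  have h0 : eLpNorm (P[X | BS S1] - P[X | BS S2]) 1 P = 0 := by
    refine le_antisymm ?_ (zero_le)
    have := hconv.add hconv
    rw [add_zero] at this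
    exact ge_of_tendsto' this hle
  rw [eLpNorm_eq_zero_iff (integrable_condExp.1.sub integrable_condExp.1) one_ne_zero] at h0
  filter_upwards [h0] with ω h
  simpa [sub_eq_zero] using h
end Core

section Core
open MeasureTheory Filter Topology
variable {I : Type}
/-- real-valued indicator -/
noncomputable def ind {Ω : Type} (A : Set Ω) : Ω → ℝ := A.indicator (fun _ => 1)

theorem ind_of_mem {Ω : Type} {A : Set Ω} {ω : Ω} (h : ω ∈ A) : ind A ω = 1 := by simp [ind, h]
theorem ind_of_notMem {Ω : Type} {A : Set Ω} {ω : Ω} (h : ω ∉ A) : ind A ω = 0 := by simp [ind, h]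
theorem ind_nonneg {Ω : Type} (A : Set Ω) (ω : Ω) : 0 ≤ ind A ω := by
  by_cases h : ω ∈ A
  · simp [ind_of_mem h]
  · simp [ind_of_notMem h]
theorem ind_le_one {Ω : Type} (A : Set Ω) (ω : Ω) : ind A ω ≤ 1 := by
  by_cases h : ω ∈ A
  · simp [ind_of_mem h]
  · simp [ind_of_notMem h]
theorem ind_abs {Ω : Type} (A : Set Ω) (ω : Ω) : |ind A ω| ≤ 1 := by
  rw [abs_of_nonneg (ind_nonneg A ω)]; exact ind_le_one A ω
theorem ind_inter {Ω : Type} (A B : Set Ω) (ω : Ω) : ind (A ∩ B) ω = ind A ω * ind B ω := by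
  by_cases h : ω ∈ A <;> by_cases h' : ω ∈ B <;> simp [ind, h, h']
theorem ind_prod {Ω κ : Type} (S : Finset κ) (A : κ → Set Ω) (ω : Ω) :
    ∏ f ∈ S, ind (A f) ω = ind (⋂ f ∈ S, A f) ω := by
  by_cases h : ω ∈ ⋂ f ∈ S, A f
  · rw [ind_of_mem h]
    simp only [Set.mem_iInter] at h
    exact Finset.prod_eq_one fun f hf => ind_of_mem (h f hf)
  · rw [ind_of_notMem h]
    simp only [Set.mem_iInter, not_forall] at h
    obtain ⟨f, hf, hh⟩ := h
    exact Finset.prod_eq_zero hf (ind_of_notMem hh)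
theorem ind_sm {Ω : Type} {m : MeasurableSpace Ω} {A : Set Ω} (h : MeasurableSet[m] A) :
    StronglyMeasurable[m] (ind A) := stronglyMeasurable_const.indicator h
theorem ind_int {Ω : Type} {m : MeasurableSpace Ω} (P : Measure Ω) [IsProbabilityMeasure P]
    {A : Set Ω} (h : MeasurableSet[m] A) : Integrable (ind A) P :=
  (integrable_const 1).indicator h
theorem integral_ind {Ω : Type} {m : MeasurableSpace Ω} (P : Measure Ω) [IsProbabilityMeasure P]
    {A : Set Ω} (h : MeasurableSet[m] A) : ∫ ω, ind A ω ∂P = P.real A := by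
  rw [ind, integral_indicator h]; simp

variable {ι : Type}

/-- invariance under injections of labels -/
def RInv (z : I → Finset ι) (P : Measure (I → Bool)) : Prop :=
  ∀ (e : Finset ι) (F : Finset I), (∀ b ∈ F, z b ⊆ e) → ∃ θ : I → I, (∀ b ∈ F, θ b = b) ∧
    (∀ b, z (θ b) ⊆ z b ∩ e) ∧ MeasurePreserving (fun (ω : I → Bool) b => ω (θ b)) P P

theorem prod_abs_le_one {κ : Type} (S : Finset κ) (x : κ → ℝ) (h : ∀ f ∈ S, |x f| ≤ 1) :
    |∏ f ∈ S, x f| ≤ 1 := by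
  rw [Finset.abs_prod]
  exact Finset.prod_le_one (fun _ _ => abs_nonneg _) h

theorem star [Countable I] (z : I → Finset ι) (P : Measure (I → Bool)) [IsProbabilityMeasure P]
    (hInv : RInv z P) (j : ℕ) (A : Finset ι → Set (I → Bool))
    (hA : ∀ f, MeasurableSet[BS {b | z b = f}] (A f)) (S0 : Finset (Finset ι))
    (hS0 : ∀ f ∈ S0, f.card = j) (S : Finset (Finset ι)) :
    ∀ (v : (I → Bool) → ℝ), (∀ f ∈ S, f.card = j) → Disjoint S0 S →
    StronglyMeasurable[BS {b | (z b).card < j ∨ z b ∈ S0}] v → (∀ᵐ ω ∂P, |v ω| ≤ 1) →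
    ∫ ω, v ω * ∏ f ∈ S, ind (A f) ω ∂P =
      ∫ ω, v ω * ∏ f ∈ S, (P[ind (A f) | BS {b | z b ⊆ f ∧ (z b).card < j}]) ω ∂P := by
  induction S using Finset.induction_on with
  | empty => intro v _ _ _ _; simp
  | insert f S hf ih =>
    intro v hS hd hv hvb
    set p := fun f => P[ind (A f) | BS {b | z b ⊆ f ∧ (z b).card < j}] with hp
    have hAm : ∀ f, Measurable[MeasurableSpace.pi] (ind (A f)) := fun f =>
      ((ind_sm (hA f)).mono (BS_le _)).measurable
    have hpb : ∀ᵐ ω ∂P, |p f ω| ≤ 1 := ae_bdd_abs_condExp_of_ae_bdd_abs (.of_forall (ind_abs _))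
    have hci : P[ind (A f) | BS {b | (z b).card < j ∨ z b ∈ S0 ∪ S}] =ᵐ[P] p f := by
      refine CI P _ _ {b | z b = f} (fun b hb => Or.inl hb.2) ?_ _ (ind_sm (hA f)) 1 (ind_abs _)
      intro F hF
      obtain ⟨θ, h1, h2, h3⟩ := hInv f F (fun b hb => by rw [show z b = f from hF hb])
      refine ⟨θ, h1, fun b hb => ⟨(h2 b).trans Finset.inter_subset_right, ?_⟩, h3⟩
      refine lt_of_le_of_lt (Finset.card_le_card (h2 b)) ?_
      rcases hb with hb | hb
      · exact lt_of_le_of_lt (Finset.card_le_card Finset.inter_subset_left) hb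
      · have hne : z b ≠ f := by
          rintro rfl
          rcases Finset.mem_union.1 hb with h | h
          · exact Finset.disjoint_left.1 hd h (Finset.mem_insert_self _ _)
          · exact hf h
        have hzj : (z b).card = j := by
          rcases Finset.mem_union.1 hb with h | h
          · exact hS0 _ h
          · exact hS _ (Finset.mem_insert_of_mem h)
        have hfj := hS f (Finset.mem_insert_self _ _)
        refine lt_of_lt_of_eq (Finset.card_lt_card ?_) hzj
        refine Finset.ssubset_iff_subset_ne.2 ⟨Finset.inter_subset_left, fun h => hne ?_⟩
        exact Finset.eq_of_subset_of_card_le (Finset.inter_eq_left.1 h) (by omega)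
    have hsub : BS {b | (z b).card < j ∨ z b ∈ S0} ≤ BS {b | (z b).card < j ∨ z b ∈ S0 ∪ S} :=
      BS_mono fun b hb => hb.imp_right (Finset.mem_union_left _)
    have hu : StronglyMeasurable[BS {b | (z b).card < j ∨ z b ∈ S0 ∪ S}]
        (fun ω => v ω * ∏ f ∈ S, ind (A f) ω) := by
      refine (hv.mono hsub).mul ?_
      refine Finset.stronglyMeasurable_fun_prod _ fun g hg => ?_
      refine (ind_sm (hA g)).mono (BS_mono fun b hb => Or.inr ?_)
      rw [show z b = g from hb]; exact Finset.mem_union_right _ hg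
    have e1 := int_pull P (BS_le _) hu (ind_int P (BS_le _ _ (hA f))) 1 (by
      filter_upwards [hvb] with ω h
      rw [norm_mul]
      exact mul_le_one₀ h (norm_nonneg _) (prod_abs_le_one _ _ fun f _ => ind_abs _ _))
    have e2 := ih (fun ω => v ω * p f ω) (fun g hg => hS g (Finset.mem_insert_of_mem hg))
      (hd.mono_right (Finset.subset_insert _ _))
      (hv.mul ((stronglyMeasurable_condExp (m := BS {b | z b ⊆ f ∧ (z b).card < j})).mono
        (BS_mono fun b hb => Or.inl hb.2))) (by
      filter_upwards [hvb, hpb] with ω h h'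
      rw [abs_mul]
      exact mul_le_one₀ h (abs_nonneg _) h')
    calc _ = ∫ ω, (v ω * ∏ f ∈ S, ind (A f) ω) * ind (A f) ω ∂P := by
          refine integral_congr_ae (.of_forall fun ω => ?_)
          simp only [Finset.prod_insert hf]; ring
      _ = _ := e1
      _ = ∫ ω, (v ω * p f ω) * ∏ f ∈ S, ind (A f) ω ∂P := by
          refine integral_congr_ae ?_
          filter_upwards [hci] with ω h
          simp only [h]; ring
      _ = _ := e2
      _ = _ := by
          refine integral_congr_ae (.of_forall fun ω => ?_)
          simp only [Finset.prod_insert hf]; ring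
end Core

section Core
open MeasureTheory Filter Topology
variable {I : Type} {ι : Type}
theorem trace_lt (P : Measure (I → Bool)) [IsProbabilityMeasure P] (S Fe : Set I) (a : I → Bool)
    (hAe : MeasurableSet[BS Fe] {ω : I → Bool | ∀ b ∈ Fe, ω b = a b})
    (E : Set (I → Bool)) (hE : MeasurableSet E) (q : (I → Bool) → ℝ)
    (hq : StronglyMeasurable[BS S] q) (hqi : Integrable q P)
    (hqD : ∀ D, MeasurableSet[BS S] D →
      P.real (D ∩ {ω : I → Bool | ∀ b ∈ Fe, ω b = a b}) = ∫ ω in D, q ω ∂P) (η : ℝ) :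
    ∀ᵐ ω ∂P, (∀ b ∈ Fe, ω b = a b) → (P[ind E | BS (S ∪ Fe)]) ω < η →
      (P[ind (E ∩ {ω : I → Bool | ∀ b ∈ Fe, ω b = a b}) | BS S]) ω < η * q ω := by
  set Ae : Set (I → Bool) := {ω | ∀ b ∈ Fe, ω b = a b} with hAedef
  set w := P[ind E | BS (S ∪ Fe)] with hw
  set r := P[ind (E ∩ Ae) | BS S] with hr
  have hws : StronglyMeasurable[BS (S ∪ Fe)] w := stronglyMeasurable_condExp
  have hrs : StronglyMeasurable[BS S] r := stronglyMeasurable_condExp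
  have hwi : Integrable w P := integrable_condExp
  have hri : Integrable r P := integrable_condExp
  have hSm : BS S ≤ BS (S ∪ Fe) := BS_mono Set.subset_union_left
  have hAem : MeasurableSet[BS (S ∪ Fe)] Ae := BS_mono Set.subset_union_right _ hAe
  set R : Set (I → Bool) := {ω | η * q ω ≤ r ω} with hR
  have hRm : MeasurableSet[BS S] R :=
    (hq.const_mul η).measurableSet_le hrs
  have hWm : MeasurableSet[BS (S ∪ Fe)] {ω | w ω < η} :=
    hws.measurableSet_lt stronglyMeasurable_const
  obtain ⟨D, hD, hDeq⟩ := BS_trace a (F := Fe) hWm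
  set D' := D ∩ R with hD'
  have hD'm : MeasurableSet[BS S] D' := hD.inter hRm
  set B := D' ∩ Ae with hB
  have hBm : MeasurableSet[BS (S ∪ Fe)] B := (hSm _ hD'm).inter hAem
  have hBw : ∀ ω ∈ B, w ω < η := by
    intro ω hω
    have : ω ∈ D ∩ Ae := ⟨hω.1.1, hω.2⟩
    rw [← hDeq] at this
    exact this.1
  have hBB : MeasurableSet B := BS_le _ _ hBm
  have hAeM : MeasurableSet Ae := BS_le _ _ hAem
  have i1 : ∫ ω in B, w ω ∂P = P.real (E ∩ B) := by
    rw [hw, setIntegral_condExp (BS_le _) (ind_int P hE) hBm, ind, setIntegral_indicator hE,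
      Set.inter_comm]
    simp
  have i2 : ∫ ω in D', r ω ∂P = P.real (E ∩ B) := by
    rw [hr, setIntegral_condExp (BS_le _) (ind_int P (hE.inter hAeM)) hD'm, ind,
      setIntegral_indicator (hE.inter hAeM)]
    have : D' ∩ (E ∩ Ae) = E ∩ B := by rw [hB, Set.inter_left_comm]
    rw [this]; simp
  have i3 : η * P.real B ≤ ∫ ω in D', r ω ∂P := by
    rw [hB, hqD D' hD'm, ← integral_const_mul]
    refine setIntegral_mono_on (hqi.const_mul η).integrableOn hri.integrableOn
      (BS_le _ _ hD'm) fun ω hω => hω.2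
  have i4 : ∫ ω in B, (η - w ω) ∂P ≤ 0 := by
    rw [integral_sub (integrable_const _) hwi.integrableOn, i1, ← i2]
    simp only [integral_const, smul_eq_mul, measureReal_restrict_apply_univ]
    linarith
  have i5 : 0 ≤ᵐ[P.restrict B] fun ω => η - w ω :=
    (ae_restrict_iff' hBB).2 (.of_forall fun ω hω => by simpa using (hBw ω hω).le)
  have i6 := (integral_eq_zero_iff_of_nonneg_ae i5
    ((integrable_const _).sub hwi.integrableOn)).1 (le_antisymm i4 (integral_nonneg_of_ae i5))
  have i7 := (ae_restrict_iff' hBB).1 i6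
  filter_upwards [i7] with ω h hωA hωw
  by_contra hcon
  push Not at hcon
  have : ω ∈ D ∩ Ae := by rw [← hDeq]; exact ⟨hωw, hωA⟩
  have hωB : ω ∈ B := ⟨⟨this.1, hcon⟩, hωA⟩
  have := h hωB
  simp only [Pi.zero_apply] at this
  linarith

/-- counting transfer at level `j` -/
def TT (z : I → Finset ι) (P Q : Measure (I → Bool)) (CC : Finset (Finset ι)) (j : ℕ) : Prop :=
  ∀ E : Finset ι → Set (I → Bool),
    (∀ e ∈ CC, MeasurableSet[BS {b | z b ⊆ e ∧ (z b).card < j}] (E e)) →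
    P (⋂ e ∈ CC, E e) = 0 → Q (⋂ e ∈ CC, E e) = 0

theorem TT_zero (z : I → Finset ι) (P Q : Measure (I → Bool)) [IsProbabilityMeasure P]
    (CC : Finset (Finset ι)) : TT z P Q CC 0 := by
  intro E hE h0
  have hS : ∀ e, {b | z b ⊆ e ∧ (z b).card < 0} = (∅ : Set I) := by intro e; simp
  rcases Set.eq_empty_or_nonempty (⋂ e ∈ CC, E e) with h | ⟨ω, hω⟩
  · rw [h]; simp
  · exfalso
    have : (⋂ e ∈ CC, E e) = Set.univ := by
      refine Set.eq_univ_of_forall fun ω' => ?_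
      simp only [Set.mem_iInter] at hω ⊢
      intro e he
      refine (BS_dep (hE e he) (fun b hb => ?_)).1 (hω e he)
      rw [hS] at hb; exact absurd hb (Set.notMem_empty _)
    rw [this] at h0
    simp at h0

theorem step_final [Countable I] (z : I → Finset ι) (P Q : Measure (I → Bool))
    [IsProbabilityMeasure P] (hInv : RInv z P)
    (CC : Finset (Finset ι)) (j : ℕ) (hT : TT z P Q CC j) (E : Finset ι → Set (I → Bool))
    (hE : ∀ e ∈ CC, MeasurableSet[BS {b | z b ⊆ e ∧ (z b).card < j + 1}] (E e))
    (A : Finset ι → Set (I → Bool)) (hA : ∀ f, MeasurableSet[BS {b | z b = f}] (A f))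
    (η : ℝ) (hη : η * CC.card < 1) (hη0 : 0 < η)
    (hQ : Q (⋂ e ∈ CC, {ω | (P[ind ((E e)ᶜ ∩ ⋂ f ∈ e.powersetCard j, A f) |
        BS {b | z b ⊆ e ∧ (z b).card < j}]) ω < η * ∏ f ∈ e.powersetCard j,
        (P[ind (A f) | BS {b | z b ⊆ f ∧ (z b).card < j}]) ω}) ≠ 0) :
    P (⋂ e ∈ CC, E e) ≠ 0 := by
  set r : Finset ι → (I → Bool) → ℝ := fun e => P[ind ((E e)ᶜ ∩ ⋂ f ∈ e.powersetCard j, A f) |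
        BS {b | z b ⊆ e ∧ (z b).card < j}] with hr
  set p : Finset ι → (I → Bool) → ℝ := fun f =>
    P[ind (A f) | BS {b | z b ⊆ f ∧ (z b).card < j}] with hp
  set Ge : Finset ι → Set (I → Bool) := fun e => {ω | r e ω < η * ∏ f ∈ e.powersetCard j, p f ω}
    with hGe
  set G := ⋂ e ∈ CC, Ge e with hG
  have hpm : ∀ f, StronglyMeasurable[BS {b | z b ⊆ f ∧ (z b).card < j}] (p f) :=
    fun f => stronglyMeasurable_condExp
  have hrm : ∀ e, StronglyMeasurable[BS {b | z b ⊆ e ∧ (z b).card < j}] (r e) :=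
    fun f => stronglyMeasurable_condExp
  have hGm : ∀ e, MeasurableSet[BS {b | z b ⊆ e ∧ (z b).card < j}] (Ge e) := by
    intro e
    refine (hrm e).measurableSet_lt ?_
    refine StronglyMeasurable.const_mul ?_ η
    refine Finset.stronglyMeasurable_fun_prod _ fun f hf => (hpm f).mono (BS_mono fun b hb => ?_)
    exact ⟨hb.1.trans (Finset.mem_powersetCard.1 hf).1, hb.2⟩
  have hPG : P G ≠ 0 := fun h => hQ (hT Ge (fun e _ => hGm e) h)
  have hGL : MeasurableSet[BS {b | (z b).card < j}] G :=
    Finset.measurableSet_biInter _ fun e _ => BS_mono (fun b hb => hb.2) _ (hGm e)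
  have hGM : MeasurableSet G := BS_le _ _ hGL
  set JJ : Finset (Finset ι) := CC.biUnion fun e => e.powersetCard j with hJJ
  have hJc : ∀ f ∈ JJ, f.card = j := by
    intro f hf
    obtain ⟨e, _, he⟩ := Finset.mem_biUnion.1 hf
    exact (Finset.mem_powersetCard.1 he).2
  have hpm' : ∀ f, StronglyMeasurable[BS {b | (z b).card < j}] (p f) :=
    fun f => (hpm f).mono (BS_mono fun b hb => hb.2)
  have hAM : ∀ f, MeasurableSet (A f) := fun f => BS_le _ _ (hA f)
  have hEM : ∀ e ∈ CC, MeasurableSet (E e) := fun e he => BS_le _ _ (hE e he)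
  have hpb : ∀ᵐ ω ∂P, ∀ f ∈ JJ, |p f ω| ≤ 1 :=
    (Filter.eventually_all_finset JJ).2 fun f _ =>
      ae_bdd_abs_condExp_of_ae_bdd_abs (.of_forall (ind_abs _))
  have hp0 : ∀ᵐ ω ∂P, ∀ f ∈ JJ, 0 ≤ p f ω :=
    (Filter.eventually_all_finset JJ).2 fun f _ => condExp_nonneg (.of_forall (ind_nonneg _))
  have hr0 : ∀ᵐ ω ∂P, ∀ e ∈ CC, 0 ≤ r e ω :=
    (Filter.eventually_all_finset CC).2 fun f _ => condExp_nonneg (.of_forall (ind_nonneg _))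
  have hrb : ∀ᵐ ω ∂P, ∀ e ∈ CC, |r e ω| ≤ 1 :=
    (Filter.eventually_all_finset CC).2 fun f _ =>
      ae_bdd_abs_condExp_of_ae_bdd_abs (.of_forall (ind_abs _))
  set AA := ⋂ f ∈ JJ, A f with hAA
  have hAAM : MeasurableSet AA := Finset.measurableSet_biInter _ fun f _ => hAM f
  set Φ : (I → Bool) → ℝ := fun ω => ind G ω * ∏ f ∈ JJ, p f ω with hΦ
  have hprodm : ∀ S : Finset (Finset ι), StronglyMeasurable[BS {b | (z b).card < j}]
      (fun ω => ∏ f ∈ S, p f ω) := fun S =>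
    Finset.stronglyMeasurable_fun_prod _ fun f _ => hpm' f
  have hΦi : Integrable Φ P := by
    refine Integrable.of_bound (C := 1) (((ind_sm hGL).mul (hprodm JJ)).mono
      (BS_le _)).aestronglyMeasurable ?_
    filter_upwards [hpb] with ω h
    rw [hΦ, norm_mul]
    exact mul_le_one₀ (ind_abs _ _) (norm_nonneg _) (prod_abs_le_one _ _ h)
  have k1 : P.real (G ∩ AA) = ∫ ω, Φ ω ∂P := by
    rw [← integral_ind P (hGM.inter hAAM)]
    rw [← star z P hInv j A hA ∅ (by simp) JJ (ind G) hJc (by simp)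
      ((ind_sm hGL).mono (BS_mono fun b hb => Or.inl hb)) (.of_forall (ind_abs _))]
    refine integral_congr_ae (.of_forall fun ω => ?_)
    simp only [ind_prod, ind_inter, hAA]
  have k2 : ∀ e ∈ CC, P.real ((G ∩ AA) ∩ (E e)ᶜ) ≤ η * P.real (G ∩ AA) := by
    intro e he
    have hsub : e.powersetCard j ⊆ JJ := fun f hf => Finset.mem_biUnion.2 ⟨e, he, hf⟩
    set Ae := ⋂ f ∈ e.powersetCard j, A f with hAe
    have hAem : MeasurableSet[BS {b | z b ⊆ e ∧ (z b).card < j + 1}] Ae := by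
      refine Finset.measurableSet_biInter _ fun f hf => BS_mono (fun b hb => ?_) _ (hA f)
      have := Finset.mem_powersetCard.1 hf
      rw [← show z b = f from hb] at this
      exact ⟨this.1, by omega⟩
    have hX : MeasurableSet[BS {b | z b ⊆ e ∧ (z b).card < j + 1}] ((E e)ᶜ ∩ Ae) :=
      (hE e he).compl.inter hAem
    have hle : BS {b | z b ⊆ e ∧ (z b).card < j + 1} ≤
        BS {b | (z b).card < j ∨ z b ∈ e.powersetCard j} := by
      refine BS_mono fun b hb => ?_
      rcases Nat.lt_succ_iff_lt_or_eq.1 hb.2 with h | h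
      · exact Or.inl h
      · exact Or.inr (Finset.mem_powersetCard.2 ⟨hb.1, h⟩)
    have hGL' : MeasurableSet[BS {b | (z b).card < j ∨ z b ∈ e.powersetCard j}] G :=
      BS_mono (fun b hb => Or.inl hb) _ hGL
    have hci : P[ind ((E e)ᶜ ∩ Ae) | BS {b | (z b).card < j}] =ᵐ[P] r e := by
      refine CI P _ _ {b | z b ⊆ e} (fun b hb => hb.2) ?_ _
        ((ind_sm hX).mono (BS_mono fun b hb => hb.1)) 1 (ind_abs _)
      intro F hF
      obtain ⟨θ, h1, h2, h3⟩ := hInv e F (fun b hb => hF hb)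
      refine ⟨θ, h1, fun b hb => ⟨(h2 b).trans Finset.inter_subset_right, ?_⟩, h3⟩
      exact lt_of_le_of_lt (Finset.card_le_card ((h2 b).trans Finset.inter_subset_left)) hb
    set JE := JJ \ e.powersetCard j with hJE
    have hJEsub : JE ⊆ JJ := Finset.sdiff_subset
    have s1 := star z P hInv j A hA (e.powersetCard j)
      (fun f hf => (Finset.mem_powersetCard.1 hf).2) JE (ind (G ∩ ((E e)ᶜ ∩ Ae)))
      (fun f hf => hJc f (hJEsub hf)) Finset.disjoint_sdiff
      (ind_sm (hGL'.inter (hle _ hX))) (.of_forall (ind_abs _))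
    have s2 := int_pull P (BS_le {b | (z b).card < j}) ((ind_sm hGL).mul (hprodm JE))
      (ind_int P (BS_le _ _ hX)) 1 (by
        filter_upwards [hpb] with ω h
        rw [Pi.mul_apply, norm_mul]
        exact mul_le_one₀ (ind_abs _ _) (norm_nonneg _)
          (prod_abs_le_one _ _ fun f hf => h f (hJEsub hf)))
    have s3 : P.real ((G ∩ AA) ∩ (E e)ᶜ) =
        ∫ ω, ind G ω * (∏ f ∈ JE, p f ω) * r e ω ∂P := by
      rw [← integral_ind P ((hGM.inter hAAM).inter (hEM e he).compl)]
      calc _ = ∫ ω, ind (G ∩ ((E e)ᶜ ∩ Ae)) ω * ∏ f ∈ JE, ind (A f) ω ∂P := by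
            refine integral_congr_ae (.of_forall fun ω => ?_)
            simp only [ind_inter, hAA, hAe, ← ind_prod]
            rw [← Finset.prod_sdiff hsub]; ring
        _ = _ := s1
        _ = ∫ ω, ((ind G) * (fun ω => ∏ f ∈ JE, p f ω)) ω * ind ((E e)ᶜ ∩ Ae) ω ∂P := by
            refine integral_congr_ae (.of_forall fun ω => ?_)
            simp only [ind_inter, Pi.mul_apply, hp]; ring
        _ = _ := s2
        _ = _ := by
            refine integral_congr_ae ?_
            filter_upwards [hci] with ω h
            simp only [h, Pi.mul_apply]
    rw [s3, k1, ← integral_const_mul]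
    refine integral_mono_ae ?_ (hΦi.const_mul η) ?_
    · refine Integrable.of_bound (C := 1) ((((ind_sm hGL).mul (hprodm JE)).mono
        (BS_le _)).mul ((hrm e).mono (BS_le _))).aestronglyMeasurable ?_
      filter_upwards [hpb, hrb] with ω h h'
      rw [norm_mul, norm_mul]
      exact mul_le_one₀ (mul_le_one₀ (ind_abs _ _) (norm_nonneg _)
        (prod_abs_le_one _ _ fun f hf => h f (hJEsub hf))) (norm_nonneg _) (h' e he)
    · filter_upwards [hp0] with ω h0
      by_cases hω : ω ∈ G
      · simp only [hΦ, ind_of_mem hω, one_mul]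
        have h1 : r e ω < η * ∏ f ∈ e.powersetCard j, p f ω := by
          have := hω; rw [hG] at this
          simp only [Set.mem_iInter] at this
          exact this e he
        have h2 : 0 ≤ ∏ f ∈ JE, p f ω := Finset.prod_nonneg fun f hf => h0 f (hJEsub hf)
        rw [← Finset.prod_sdiff hsub]
        nlinarith
      · simp only [hΦ, ind_of_notMem hω]; simp
  have k3 : 0 < P.real (G ∩ AA) := by
    rw [k1]
    have hnn : 0 ≤ᵐ[P] Φ := by
      filter_upwards [hp0] with ω h0
      exact mul_nonneg (ind_nonneg _ _) (Finset.prod_nonneg h0)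
    refine lt_of_le_of_ne (integral_nonneg_of_ae hnn) fun h => hPG ?_
    have hz := (integral_eq_zero_iff_of_nonneg_ae hnn hΦi).1 h.symm
    rw [measure_eq_zero_iff_ae_notMem]
    filter_upwards [hz, hp0, hr0] with ω h1 h2 h3 hω
    simp only [hΦ, ind_of_mem hω, one_mul, Pi.zero_apply] at h1
    obtain ⟨f, hf, hf0⟩ := Finset.prod_eq_zero_iff.1 h1
    obtain ⟨e, he, hfe⟩ := Finset.mem_biUnion.1 hf
    have h4 : r e ω < η * ∏ f ∈ e.powersetCard j, p f ω := by
      have := hω; rw [hG] at this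
      simp only [Set.mem_iInter] at this
      exact this e he
    rw [Finset.prod_eq_zero hfe hf0, mul_zero] at h4
    exact absurd (h3 e he) (not_le.2 h4)
  intro hzero
  have k4 : P.real (G ∩ AA) ≤ ∑ e ∈ CC, P.real ((G ∩ AA) ∩ (E e)ᶜ) := by
    have h1 : G ∩ AA ⊆ (⋂ e ∈ CC, E e) ∪ ⋃ e ∈ CC, ((G ∩ AA) ∩ (E e)ᶜ) := by
      intro ω hω
      by_cases h : ω ∈ ⋂ e ∈ CC, E e
      · exact Or.inl h
      · right
        simp only [Set.mem_iInter, not_forall] at h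
        obtain ⟨e, he, hh⟩ := h
        exact Set.mem_biUnion he ⟨hω, hh⟩
    have h2 : P.real (⋂ e ∈ CC, E e) = 0 := by simp [Measure.real, hzero]
    have h3 := measureReal_mono (μ := P) h1
    have h4 := measureReal_union_le (μ := P) (⋂ e ∈ CC, E e) (⋃ e ∈ CC, ((G ∩ AA) ∩ (E e)ᶜ))
    have h5 := measureReal_biUnion_finset_le (μ := P) CC (fun e => (G ∩ AA) ∩ (E e)ᶜ)
    linarith
  have k5 := Finset.sum_le_sum k2
  rw [Finset.sum_const, nsmul_eq_mul] at k5
  nlinarith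
end Core

section Core
open MeasureTheory Filter Topology
variable {I : Type} {ι : Type}
theorem TT_succ [Countable I] (z : I → Finset ι) (P Q : Measure (I → Bool))
    [IsProbabilityMeasure P] (hInv : RInv z P) (CC : Finset (Finset ι))
    (hAC : ∀ e ∈ CC, ∀ A : Set (I → Bool), MeasurableSet[BS {b | z b ⊆ e}] A → P A = 0 → Q A = 0)
    (j : ℕ) (hT : TT z P Q CC j) : TT z P Q CC (j + 1) := by
  intro E hE
  contrapose
  intro hQ
  have := Encodable.ofCountable I
  set η : ℝ := 1 / (CC.card + 1) with hη
  have hη0 : 0 < η := by positivity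
  have hη1 : η * CC.card < 1 := by
    rw [hη, div_mul_eq_mul_div, one_mul, div_lt_one (by positivity)]; linarith
  have hACae : ∀ e ∈ CC, ∀ p : (I → Bool) → Prop, MeasurableSet[BS {b | z b ⊆ e}] {ω | p ω} →
      (∀ᵐ ω ∂P, p ω) → ∀ᵐ ω ∂Q, p ω := by
    intro e he p hp h
    exact hAC e he _ hp.compl h
  -- martingale
  let FN : ℕ → Set I := fun N => {b | Encodable.encode b < N}
  have hFN : ∀ N, (FN N).Finite := fun N =>
    Set.Finite.preimage (Encodable.encode_injective.injOn) (Set.finite_lt_nat N)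
  let Fe : Finset ι → ℕ → Set I := fun e N => {b | (z b ⊆ e ∧ (z b).card = j) ∧ b ∈ FN N}
  let Lo : Finset ι → Set I := fun e => {b | z b ⊆ e ∧ (z b).card < j}
  let ℱ : Finset ι → Filtration ℕ (MeasurableSpace.pi : MeasurableSpace (I → Bool)) := fun e =>
    ⟨fun n => BS (Lo e ∪ Fe e n), fun i j hij => BS_mono (Set.union_subset_union_right _
      fun b hb => ⟨hb.1, lt_of_lt_of_le hb.2 hij⟩), fun n => BS_le _⟩
  have hsup : ∀ e, BS {b | z b ⊆ e ∧ (z b).card < j + 1} ≤ ⨆ n, ℱ e n := by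
    intro e
    refine BS_iUnion_le fun b hb => ⟨Encodable.encode b + 1, ?_⟩
    rcases Nat.lt_succ_iff_lt_or_eq.1 hb.2 with h | h
    · exact Or.inl ⟨hb.1, h⟩
    · exact Or.inr ⟨⟨hb.1, h⟩, Nat.lt_succ_self _⟩
  let w : Finset ι → ℕ → (I → Bool) → ℝ := fun e N => P[ind (E e)ᶜ | BS (Lo e ∪ Fe e N)]
  have hwm : ∀ e N, StronglyMeasurable[BS {b | z b ⊆ e}] (w e N) := by
    intro e N
    have : StronglyMeasurable[BS (Lo e ∪ Fe e N)] (w e N) := stronglyMeasurable_condExp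
    refine this.mono (BS_mono fun b hb => ?_)
    rcases hb with hb | hb
    · exact hb.1
    · exact hb.1.1
  have hconvP : ∀ e ∈ CC, ∀ᵐ ω ∂P, Tendsto (fun N => w e N ω - ind (E e)ᶜ ω) atTop (𝓝 0) := by
    intro e he
    have hs := (ind_sm (hE e he).compl).mono (hsup e)
    have := (ind_int P (BS_le _ _ (hE e he).compl)).tendsto_ae_condExp (ℱ := ℱ e) hs
    filter_upwards [this] with ω h
    have := h.sub_const (ind (E e)ᶜ ω)
    rw [sub_self] at this
    exact this
  have hconvQ : ∀ e ∈ CC, ∀ᵐ ω ∂Q, Tendsto (fun N => w e N ω - ind (E e)ᶜ ω) atTop (𝓝 0) := by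
    intro e he
    refine hACae e he _ ?_ (hconvP e he)
    refine @measurableSet_tendsto _ _ _ (BS {b | z b ⊆ e}) _ _ _ _ _ _ _ _ ?_
    intro N
    refine StronglyMeasurable.measurable ((hwm e N).sub ?_)
    exact (ind_sm (hE e he).compl).mono (BS_mono fun b hb => hb.1)
  have hconvQ' : ∀ᵐ ω ∂Q, ∀ e ∈ CC, Tendsto (fun N => w e N ω - ind (E e)ᶜ ω) atTop (𝓝 0) :=
    (Filter.eventually_all_finset CC).2 hconvQ
  -- choose N
  have hN : ∃ N, Q {ω | ∀ e ∈ CC, w e N ω < η} ≠ 0 := by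
    by_contra hcon
    push Not at hcon
    apply hQ
    have h1 : ∀ᵐ ω ∂Q, ∀ N, ¬ ∀ e ∈ CC, w e N ω < η := by
      rw [ae_all_iff]
      intro N
      exact measure_eq_zero_iff_ae_notMem.1 (hcon N)
    rw [measure_eq_zero_iff_ae_notMem]
    filter_upwards [h1, hconvQ'] with ω h2 h3 hω
    simp only [Set.mem_iInter] at hω
    have h4 : ∀ᶠ N in atTop, ∀ e ∈ CC, w e N ω < η := by
      rw [Filter.eventually_all_finset]
      intro e he
      have := h3 e he
      rw [ind_of_notMem (by simpa using hω e he)] at this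
      simp only [sub_zero] at this
      exact this.eventually_lt_const hη0
    obtain ⟨N, hN⟩ := h4.exists
    exact h2 N hN
  obtain ⟨N, hN⟩ := hN
  let F : Finset I := (hFN N).toFinset
  -- choose cell
  have ha : ∃ a : I → Bool, Q ({ω | ∀ e ∈ CC, w e N ω < η} ∩ {ω | ∀ b ∈ F, ω b = a b}) ≠ 0 := by
    by_contra hcon
    push Not at hcon
    apply hN
    let ext : (F → Bool) → I → Bool := fun p b => if h : b ∈ F then p ⟨b, h⟩ else false
    have hsub : {ω | ∀ e ∈ CC, w e N ω < η} ⊆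
        ⋃ p : F → Bool, ({ω | ∀ e ∈ CC, w e N ω < η} ∩ {ω | ∀ b ∈ F, ω b = ext p b}) := by
      intro ω hω
      refine Set.mem_iUnion.2 ⟨fun b => ω b, hω, fun b hb => ?_⟩
      simp [ext, hb]
    exact measure_mono_null hsub (measure_iUnion_null fun p => hcon (ext p))
  obtain ⟨a, ha⟩ := ha
  let A : Finset ι → Set (I → Bool) := fun f => {ω | ∀ b ∈ F, z b = f → ω b = a b}
  have hA : ∀ f, MeasurableSet[BS {b | z b = f}] (A f) := by
    intro f
    have : A f = ⋂ b ∈ F.filter (fun b => z b = f), {ω | ω b = a b} := by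
      ext ω; simp [A, and_imp]
    rw [this]
    refine Finset.measurableSet_biInter _ fun b hb => BS_bit ?_ _
    exact (Finset.mem_filter.1 hb).2
  have hAe : ∀ e, (⋂ f ∈ e.powersetCard j, A f) = {ω | ∀ b ∈ Fe e N, ω b = a b} := by
    intro e
    ext ω
    simp only [Set.mem_iInter, Finset.mem_powersetCard, A, Set.mem_setOf_eq, Fe]
    constructor
    · intro h b hb
      exact h (z b) hb.1 b ((hFN N).mem_toFinset.2 hb.2) rfl
    · rintro h f hf b hb rfl
      exact h b ⟨hf, (hFN N).mem_toFinset.1 hb⟩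
  refine step_final z P Q hInv CC j hT E hE A hA η hη1 hη0 ?_
  -- trace
  have htr : ∀ e ∈ CC, ∀ᵐ ω ∂P, (∀ b ∈ Fe e N, ω b = a b) → w e N ω < η →
      (P[ind ((E e)ᶜ ∩ ⋂ f ∈ e.powersetCard j, A f) |
        BS {b | z b ⊆ e ∧ (z b).card < j}]) ω < η * ∏ f ∈ e.powersetCard j,
        (P[ind (A f) | BS {b | z b ⊆ f ∧ (z b).card < j}]) ω := by
    intro e he
    rw [hAe]
    have hqm : StronglyMeasurable[BS (Lo e)] (fun ω => ∏ f ∈ e.powersetCard j,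
        (P[ind (A f) | BS {b | z b ⊆ f ∧ (z b).card < j}]) ω) := by
      refine Finset.stronglyMeasurable_fun_prod _ fun f hf => ?_
      refine (stronglyMeasurable_condExp (m := BS {b | z b ⊆ f ∧ (z b).card < j})).mono
        (BS_mono fun b hb => ?_)
      exact ⟨hb.1.trans (Finset.mem_powersetCard.1 hf).1, hb.2⟩
    have hAeM : MeasurableSet[BS (Fe e N)] {ω : I → Bool | ∀ b ∈ Fe e N, ω b = a b} := by
      have hfin : (Fe e N).Finite := (hFN N).subset fun b hb => hb.2
      have : {ω : I → Bool | ∀ b ∈ Fe e N, ω b = a b} = ⋂ b ∈ hfin.toFinset, {ω | ω b = a b} := by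
        ext ω; simp
      rw [this]
      exact Finset.measurableSet_biInter _ fun b hb => BS_bit (hfin.mem_toFinset.1 hb) _
    refine trace_lt P (Lo e) (Fe e N) a hAeM (E e)ᶜ (BS_le _ _ (hE e he).compl) _ hqm ?_ ?_ η
    · refine Integrable.of_bound (C := 1) (hqm.mono (BS_le _)).aestronglyMeasurable ?_
      have : ∀ᵐ ω ∂P, ∀ f ∈ e.powersetCard j,
          |(P[ind (A f) | BS {b | z b ⊆ f ∧ (z b).card < j}]) ω| ≤ 1 :=
        (Filter.eventually_all_finset _).2 fun f _ =>
          ae_bdd_abs_condExp_of_ae_bdd_abs (.of_forall (ind_abs _))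
      filter_upwards [this] with ω h
      exact prod_abs_le_one _ _ h
    · intro D hD
      have hDM : MeasurableSet D := BS_le _ _ hD
      have hD' : MeasurableSet[BS {b | (z b).card < j ∨ z b ∈ (∅ : Finset (Finset ι))}] D :=
        BS_mono (fun b hb => Or.inl hb.2) _ hD
      have := star z P hInv j A hA ∅ (by simp) (e.powersetCard j) (ind D)
        (fun f hf => (Finset.mem_powersetCard.1 hf).2) (by simp) (ind_sm hD')
        (.of_forall (ind_abs _))
      rw [← integral_ind P (hDM.inter (BS_le _ _ hAeM)), ← integral_indicator hDM, ← hAe]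
      calc _ = _ := integral_congr_ae (.of_forall fun ω => by simp only [ind_inter, ← ind_prod])
        _ = _ := this
        _ = _ := by
          refine integral_congr_ae (.of_forall fun ω => ?_)
          by_cases h : ω ∈ D
          · simp [ind_of_mem h, h]
          · simp [ind_of_notMem h, h]
  have htrQ : ∀ᵐ ω ∂Q, ∀ e ∈ CC, (∀ b ∈ Fe e N, ω b = a b) → w e N ω < η →
      (P[ind ((E e)ᶜ ∩ ⋂ f ∈ e.powersetCard j, A f) |
        BS {b | z b ⊆ e ∧ (z b).card < j}]) ω < η * ∏ f ∈ e.powersetCard j,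
        (P[ind (A f) | BS {b | z b ⊆ f ∧ (z b).card < j}]) ω := by
    refine (Filter.eventually_all_finset CC).2 fun e he => hACae e he _ ?_ (htr e he)
    have m1 : MeasurableSet[BS {b | z b ⊆ e}] {ω : I → Bool | ∀ b ∈ Fe e N, ω b = a b} := by
      rw [← hAe]
      refine Finset.measurableSet_biInter _ fun f hf => BS_mono (fun b hb => ?_) _ (hA f)
      rw [Set.mem_setOf_eq, show z b = f from hb]
      exact (Finset.mem_powersetCard.1 hf).1
    have m2 : MeasurableSet[BS {b | z b ⊆ e}] {ω | w e N ω < η} :=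
      (hwm e N).measurableSet_lt stronglyMeasurable_const
    have m3 : MeasurableSet[BS {b | z b ⊆ e}] {ω |
      (P[ind ((E e)ᶜ ∩ ⋂ f ∈ e.powersetCard j, A f) |
        BS {b | z b ⊆ e ∧ (z b).card < j}]) ω < η * ∏ f ∈ e.powersetCard j,
        (P[ind (A f) | BS {b | z b ⊆ f ∧ (z b).card < j}]) ω} := by
      refine StronglyMeasurable.measurableSet_lt ?_ (StronglyMeasurable.const_mul ?_ η)
      · exact (stronglyMeasurable_condExp (m := BS {b | z b ⊆ e ∧ (z b).card < j})).mono
          (BS_mono fun b hb => hb.1)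
      · refine Finset.stronglyMeasurable_fun_prod _ fun f hf => ?_
        refine (stronglyMeasurable_condExp (m := BS {b | z b ⊆ f ∧ (z b).card < j})).mono
          (BS_mono fun b hb => ?_)
        exact hb.1.trans (Finset.mem_powersetCard.1 hf).1
    exact @MeasurableSet.imp _ (BS {b | z b ⊆ e}) _ _ m1 (@MeasurableSet.imp _ (BS {b | z b ⊆ e}) _ _ m2 m3)
  intro hzero
  apply ha
  rw [measure_eq_zero_iff_ae_notMem] at hzero ⊢
  filter_upwards [hzero, htrQ] with ω h1 h2 hω
  apply h1
  simp only [Set.mem_iInter]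
  intro e he
  refine h2 e he (fun b hb => hω.2 b ((hFN N).mem_toFinset.2 hb.2)) (hω.1 e he)

theorem TT_all [Countable I] (z : I → Finset ι) (P Q : Measure (I → Bool))
    [IsProbabilityMeasure P] (hInv : RInv z P) (CC : Finset (Finset ι))
    (hAC : ∀ e ∈ CC, ∀ A : Set (I → Bool), MeasurableSet[BS {b | z b ⊆ e}] A → P A = 0 → Q A = 0)
    (j : ℕ) : TT z P Q CC j := by
  induction j with
  | zero => exact TT_zero z P Q CC
  | succ j ih => exact TT_succ z P Q hInv CC hAC j ih
end Core

section Core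
open MeasureTheory Filter Topology
variable {I : Type} {ι : Type}
theorem AC_limit [Countable I] (P Q : Measure (I → Bool)) [IsProbabilityMeasure P]
    [IsProbabilityMeasure Q] (S : Set I) (K : ENNReal) (hK : K ≠ ⊤)
    (h : ∀ U : Set (I → Bool), MeasurableSet[BS S] U → IsClopen U → Q U ≤ K * P U)
    (A : Set (I → Bool)) (hA : MeasurableSet[BS S] A) (h0 : P A = 0) : Q A = 0 := by
  let π : (I → Bool) → (S → Bool) := fun ω b => ω b
  have hπ : Continuous π := by fun_prop
  have hm : Measurable π := hπ.measurable
  have hle : BS S ≤ MeasurableSpace.comap π MeasurableSpace.pi := by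
    refine iSup₂_le fun b hb => ?_
    have : (fun ω : I → Bool => ω b) = (fun x : S → Bool => x ⟨b, hb⟩) ∘ π := rfl
    rw [this, ← MeasurableSpace.comap_comp]
    exact MeasurableSpace.comap_mono (measurable_pi_apply (X := fun _ : S => Bool) ⟨b, hb⟩).comap_le
  have hge : MeasurableSpace.comap π MeasurableSpace.pi ≤ BS S := by
    rw [MeasurableSpace.pi, MeasurableSpace.comap_iSup]
    refine iSup_le fun b => ?_
    rw [MeasurableSpace.comap_comp]
    exact le_iSup₂_of_le b.1 b.2 le_rfl
  obtain ⟨B, hB, rfl⟩ := hle A hA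
  have : IsProbabilityMeasure (P.map π) := Measure.isProbabilityMeasure_map hm.aemeasurable
  have : IsProbabilityMeasure (Q.map π) := Measure.isProbabilityMeasure_map hm.aemeasurable
  rw [← Measure.map_apply hm hB] at h0 ⊢
  by_contra hne
  obtain ⟨F, hFB, hF, hpos⟩ := hB.exists_isClosed_lt_add (μ := Q.map π) (measure_ne_top _ _) hne
  have hF0 : (P.map π) F = 0 := measure_mono_null hFB h0
  have hQF : (Q.map π) F ≠ 0 := by
    intro h1
    rw [h1, zero_add] at hpos
    exact lt_irrefl _ hpos
  apply hQF
  refine le_antisymm (ENNReal.le_of_forall_pos_le_add ?_) bot_le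
  intro δ hδ _
  obtain ⟨G, hFG, hG, hGδ⟩ := F.exists_isOpen_lt_of_lt (μ := P.map π) ((δ : ENNReal) / (K + 1)) (by
    rw [hF0]; refine ENNReal.div_pos (by simpa using hδ.ne') (by simp [hK]))
  obtain ⟨C, hC, hFC, hCG⟩ := exists_clopen_of_closed_subset_open hF hG hFG
  have h1 := h (π ⁻¹' C) (hge _ ⟨C, hC.isOpen.measurableSet, rfl⟩) (hC.preimage hπ)
  rw [← Measure.map_apply hm hC.isOpen.measurableSet, ← Measure.map_apply hm hC.isOpen.measurableSet] at h1
  calc (Q.map π) F ≤ (Q.map π) C := measure_mono hFC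
    _ ≤ K * (P.map π) C := h1
    _ ≤ (K + 1) * ((δ : ENNReal) / (K + 1)) := by
        gcongr
        · exact le_self_add
        · exact (measure_mono hCG).trans hGδ.le
    _ ≤ 0 + δ := by rw [zero_add]; exact ENNReal.mul_div_le

theorem limit_contra [Countable I] (z : I → Finset ι) (CC : Finset (Finset ι)) (K : ENNReal)
    (hK : K ≠ ⊤) (P Q : ℕ → ProbabilityMeasure (I → Bool))
    (hInv : ∀ (e : Finset ι) (F : Finset I), (∀ b ∈ F, z b ⊆ e) → ∃ θ : I → I,
      (∀ b ∈ F, θ b = b) ∧ (∀ b, z (θ b) ⊆ z b ∩ e) ∧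
      ∀ n, MeasurePreserving (fun (ω : I → Bool) b => ω (θ b)) (P n : Measure (I → Bool)) (P n))
    (hAC : ∀ n, ∀ e ∈ CC, ∀ A : Set (I → Bool), MeasurableSet[BS {b | z b ⊆ e}] A →
      (Q n : Measure (I → Bool)) A ≤ K * (P n : Measure (I → Bool)) A)
    (b : Finset ι → I) (hb : ∀ e ∈ CC, z (b e) ⊆ e)
    (hQ : ∀ n, (Q n : Measure (I → Bool)) (⋂ e ∈ CC, {ω | ω (b e) = true}) = 1)
    (hP : Tendsto (fun n => (P n : Measure (I → Bool)) (⋂ e ∈ CC, {ω | ω (b e) = true})) atTop (𝓝 0)) :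
    False := by
  obtain ⟨R, -, hR⟩ := (isCompact_univ (X := ProbabilityMeasure (I → Bool) × ProbabilityMeasure (I → Bool))).ultrafilter_le_nhds
    ((hyperfilter ℕ).map (fun n => (P n, Q n))) (by simp)
  have hle : (hyperfilter ℕ : Filter ℕ) ≤ atTop := by
    rw [← Nat.cofinite_eq_atTop]; exact hyperfilter_le_cofinite
  obtain ⟨P', Q'⟩ := R
  have hT : Tendsto (fun n => (P n, Q n)) (hyperfilter ℕ : Filter ℕ) (𝓝 (P', Q')) := hR
  have hTP : Tendsto P (hyperfilter ℕ : Filter ℕ) (𝓝 P') := (continuous_fst.tendsto (P', Q')).comp hT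
  have hTQ : Tendsto Q (hyperfilter ℕ : Filter ℕ) (𝓝 Q') := (continuous_snd.tendsto (P', Q')).comp hT
  have cl : ∀ {R : ℕ → ProbabilityMeasure (I → Bool)} {R' : ProbabilityMeasure (I → Bool)},
      Tendsto R (hyperfilter ℕ : Filter ℕ) (𝓝 R') → ∀ U : Set (I → Bool), IsClopen U →
      Tendsto (fun n => (R n : Measure (I → Bool)) U) (hyperfilter ℕ : Filter ℕ) (𝓝 ((R' : Measure (I → Bool)) U)) := by
    intro R R' h U hU
    exact ProbabilityMeasure.tendsto_measure_of_null_frontier_of_tendsto' h (by simp [hU.frontier_eq])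
  have hE : IsClopen (⋂ e ∈ CC, {ω : I → Bool | ω (b e) = true}) := by
    refine isClopen_biInter_finset fun e _ => ?_
    exact (isClopen_discrete ({true} : Set Bool)).preimage (continuous_apply (b e))
  have hQ1 : (Q' : Measure (I → Bool)) (⋂ e ∈ CC, {ω | ω (b e) = true}) = 1 := by
    refine tendsto_nhds_unique (cl hTQ _ hE) ?_
    simp only [hQ]; exact tendsto_const_nhds
  have hP0 : (P' : Measure (I → Bool)) (⋂ e ∈ CC, {ω | ω (b e) = true}) = 0 :=
    tendsto_nhds_unique (cl hTP _ hE) (hP.mono_left hle)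
  have hRI : RInv z (P' : Measure (I → Bool)) := by
    intro e F hF
    obtain ⟨θ, h1, h2, h3⟩ := hInv e F hF
    refine ⟨θ, h1, h2, ?_⟩
    have hc : Continuous (fun (ω : I → Bool) b => ω (θ b)) := by fun_prop
    refine ⟨hc.measurable, ?_⟩
    have h4 : ProbabilityMeasure.map P' hc.measurable.aemeasurable = P' := by
      refine tendsto_nhds_unique (((ProbabilityMeasure.continuous_map hc).tendsto P').comp hTP) ?_
      refine hTP.congr fun n => ?_
      apply Subtype.ext
      exact (h3 n).map_eq.symm
    exact congrArg (fun x : ProbabilityMeasure (I → Bool) => (x : Measure (I → Bool))) h4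
  have hAC' : ∀ e ∈ CC, ∀ A : Set (I → Bool), MeasurableSet[BS {b | z b ⊆ e}] A →
      (P' : Measure (I → Bool)) A = 0 → (Q' : Measure (I → Bool)) A = 0 := by
    intro e he A hA
    refine AC_limit _ _ _ K hK ?_ A hA
    intro U hU hUc
    refine le_of_tendsto_of_tendsto' (cl hTQ U hUc) (ENNReal.Tendsto.const_mul (cl hTP U hUc) (Or.inr hK)) ?_
    intro n
    exact hAC n e he U hU
  have := TT_all z (P' : Measure (I → Bool)) Q' hRI CC hAC' (CC.sup (fun e => (z (b e)).card) + 1)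
    (fun e => {ω | ω (b e) = true}) (fun e he => BS_bit (b := b e) (show _ ∧ _ from
      ⟨hb e he, Nat.lt_succ_of_le (Finset.le_sup (f := fun e => (z (b e)).card) he)⟩) true) hP0
  rw [hQ1] at this
  exact one_ne_zero this
end Core

section Core
open MeasureTheory Filter Topology
section Fin

variable {ι V : Type}

noncomputable def zz (b : Finset ι × (ι → ℕ)) : Finset ι := b.1.filter (fun i => b.2 i = 0)

noncomputable def bits (F : Finset (ι → V)) (X : ι × ℕ → V) (b : Finset ι × (ι → ℕ)) : Bool :=
  decide (∃ y ∈ F, ∀ i ∈ b.1, y i = X (i, b.2 i))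

def rho (N j : ℕ) : ℕ := if j = 0 then N + 1 else if j ≤ N then j else j + 1

theorem rho_inj (N : ℕ) : Function.Injective (rho N) := by
  intro a b h
  unfold rho at h
  split_ifs at h <;> omega

noncomputable def rl (e : Finset ι) (N : ℕ) (b : Finset ι × (ι → ℕ)) : Finset ι × (ι → ℕ) :=
  (b.1, fun i => if i ∈ b.1 then (if i ∈ e then b.2 i else rho N (b.2 i)) else b.2 i)

noncomputable def rp (e : Finset ι) (N : ℕ) (p : ι × ℕ) : ι × ℕ :=
  (p.1, if p.1 ∈ e then p.2 else rho N p.2)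

theorem rp_inj (e : Finset ι) (N : ℕ) : Function.Injective (rp e N) := by
  rintro ⟨i, a⟩ ⟨j, b⟩ h
  simp only [rp, Prod.mk.injEq] at h
  obtain ⟨rfl, h⟩ := h
  by_cases hi : i ∈ e
  · simp only [hi, if_true] at h; rw [h]
  · simp only [hi, if_false] at h; rw [rho_inj N h]

theorem bits_rl (F : Finset (ι → V)) (X : ι × ℕ → V) (e : Finset ι) (N : ℕ) (b : Finset ι × (ι → ℕ)) :
    bits F X (rl e N b) = bits F (fun p => X (rp e N p)) b := by
  unfold bits rl rp
  congr 1
  refine propext (exists_congr fun y => and_congr_right fun _ => forall₂_congr fun i hi => ?_)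
  simp only [hi, if_true]

theorem rl_props (e : Finset ι) [Fintype ι] (Fb : Finset (Finset ι × (ι → ℕ))) (hF : ∀ b ∈ Fb, zz b ⊆ e) :
    ∃ N, (∀ b ∈ Fb, rl e N b = b) ∧ ∀ b, zz (rl e N b) ⊆ zz b ∩ e := by
  refine ⟨Fb.sup (fun b => Finset.univ.sup b.2), ?_, ?_⟩
  · rintro ⟨f, j⟩ hb
    simp only [rl, Prod.mk.injEq, true_and]
    have h1 := hF _ hb
    have hle : ∀ i, j i ≤ Fb.sup (fun b => Finset.univ.sup b.2) := fun i =>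
      (Finset.le_sup (f := j) (Finset.mem_univ i)).trans
        (Finset.le_sup (f := fun b : Finset ι × (ι → ℕ) => Finset.univ.sup b.2) hb)
    funext i
    by_cases hi : i ∈ f
    · by_cases hie : i ∈ e
      · simp [hi, hie]
      · have h0 : j i ≠ 0 := fun h0 => hie (h1 (Finset.mem_filter.2 ⟨hi, h0⟩))
        simp only [hi, hie, if_true, if_false, rho, h0, hle i]
    · simp [hi]
  · intro b i hi
    have hi' := Finset.mem_filter.1 hi
    obtain ⟨h1, hi⟩ := hi'
    have h1' : i ∈ b.1 := h1
    simp only [rl, h1', if_true] at hi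
    by_cases h : i ∈ e
    · simp only [h, if_true] at hi; exact Finset.mem_inter.2 ⟨Finset.mem_filter.2 ⟨h1', hi⟩, h⟩
    · simp only [h, if_false, rho] at hi
      exfalso
      split_ifs at hi; omega

theorem bits_meas_aux [MeasurableSpace V] [MeasurableSingletonClass V] (F : Finset (ι → V))
    (T : Set (ι × ℕ)) (b : Finset ι × (ι → ℕ)) (hb : ∀ i ∈ b.1, (i, b.2 i) ∈ T) :
    MeasurableSpace.comap (fun X : ι × ℕ → V => bits F X b) ⊤ ≤
      ⨆ p ∈ T, MeasurableSpace.comap (fun X : ι × ℕ → V => X p) inferInstance := by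
  rw [← measurable_iff_comap_le]
  refine @measurable_to_bool _ (⨆ p ∈ T, MeasurableSpace.comap (fun X : ι × ℕ → V => X p) inferInstance) _ ?_
  have : (fun X : ι × ℕ → V => bits F X b) ⁻¹' {true} =
      ⋃ y ∈ F, ⋂ i ∈ b.1, {X | X (i, b.2 i) = y i} := by
    ext X
    simp [bits, eq_comm]
  rw [this]
  refine @Finset.measurableSet_biUnion _ _ (⨆ p ∈ T, MeasurableSpace.comap (fun X : ι × ℕ → V => X p) inferInstance) _ F ?_
  intro y _
  refine @Finset.measurableSet_biInter _ _ (⨆ p ∈ T, MeasurableSpace.comap (fun X : ι × ℕ → V => X p) inferInstance) _ b.1 ?_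
  intro i hi
  refine le_iSup₂_of_le (f := fun p (_ : p ∈ T) => MeasurableSpace.comap (fun X : ι × ℕ → V => X p) inferInstance)
    (i, b.2 i) (hb i hi) le_rfl _ ?_
  exact ⟨{y i}, measurableSet_singleton _, rfl⟩

theorem bits_meas [MeasurableSpace V] [MeasurableSingletonClass V] (F : Finset (ι → V)) :
    Measurable (bits F : (ι × ℕ → V) → _) := by
  rw [measurable_pi_iff]
  intro b
  rw [measurable_iff_comap_le]
  refine (bits_meas_aux F Set.univ b (fun _ _ => trivial)).trans ?_
  exact iSup₂_le fun p _ => (measurable_pi_apply p).comap_le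

theorem bits_BS [MeasurableSpace V] [MeasurableSingletonClass V] (F : Finset (ι → V)) (e : Finset ι)
    (A : Set (Finset ι × (ι → ℕ) → Bool)) (hA : MeasurableSet[BS {b | zz b ⊆ e}] A) :
    MeasurableSet[⨆ p ∈ {p : ι × ℕ | p.1 ∈ e ∨ p.2 ≠ 0}, MeasurableSpace.comap (fun X : ι × ℕ → V => X p) inferInstance]
      ((bits F : (ι × ℕ → V) → _) ⁻¹' A) := by
  have : MeasurableSpace.comap (bits F : (ι × ℕ → V) → _) (BS {b | zz b ⊆ e}) ≤
      ⨆ p ∈ {p : ι × ℕ | p.1 ∈ e ∨ p.2 ≠ 0}, MeasurableSpace.comap (fun X : ι × ℕ → V => X p) inferInstance := by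
    rw [BS, MeasurableSpace.comap_iSup]
    refine iSup_le fun b => ?_
    rw [MeasurableSpace.comap_iSup]
    refine iSup_le fun hb => ?_
    rw [MeasurableSpace.comap_comp]
    refine bits_meas_aux F _ b ?_
    intro i hi
    by_cases h0 : b.2 i = 0
    · left; exact hb (Finset.mem_filter.2 ⟨hi, h0⟩)
    · right; exact h0
  exact this _ ⟨A, hA, rfl⟩

theorem finite_step [Fintype ι] [Fintype V] [Nonempty V] (F : Finset (ι → V)) (hF : F.Nonempty) :
    ∃ P Q : ProbabilityMeasure (Finset ι × (ι → ℕ) → Bool),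
      (∀ e N, MeasurePreserving (fun (ω : Finset ι × (ι → ℕ) → Bool) b => ω (rl e N b))
        (P : Measure (Finset ι × (ι → ℕ) → Bool)) P) ∧
      (∀ e : Finset ι, (∀ y ∈ F, ∀ y' ∈ F, (∀ i ∈ e, y i = y' i) → y = y') →
        ∀ A, MeasurableSet[BS {b | zz b ⊆ e}] A → (Q : Measure (Finset ι × (ι → ℕ) → Bool)) A ≤
          ((Fintype.card V : ENNReal) ^ e.card / (F.card : ENNReal)) * (P : Measure (Finset ι × (ι → ℕ) → Bool)) A) ∧
      (∀ CC : Finset (Finset ι), (Q : Measure (Finset ι × (ι → ℕ) → Bool))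
        (⋂ e ∈ CC, {ω | ω (e, fun _ => 0) = true}) = 1) ∧
      ∀ (CC : Finset (Finset ι)) (B : Finset (ι → V)),
        (∀ x : ι → V, (∀ e ∈ CC, ∃ y ∈ F, ∀ i ∈ e, y i = x i) → x ∈ B) →
        (P : Measure (Finset ι × (ι → ℕ) → Bool)) (⋂ e ∈ CC, {ω | ω (e, fun _ => 0) = true}) ≤
          (B.card : ENNReal) * ((Fintype.card V : ENNReal)⁻¹) ^ (Fintype.card ι) := by
  let _ : MeasurableSpace V := ⊤
  let m : ENNReal := (Fintype.card V : ENNReal)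
  have hm0 : m ≠ 0 := by simp [m]
  have hmt : m ≠ ⊤ := by simp [m]
  let ν : Measure V := (PMF.uniformOfFintype V).toMeasure
  have hν : ∀ v, ν {v} = m⁻¹ := by
    intro v
    simp only [ν]
    rw [PMF.toMeasure_apply_singleton _ _ (measurableSet_singleton v)]
    simp [m]
  let U : Measure (ι × ℕ → V) := Measure.infinitePi (fun _ => ν)
  -- boxes
  have hbox : ∀ (e : Finset ι) (y : ι → V), U {X | ∀ i ∈ e, X (i, 0) = y i} = m⁻¹ ^ e.card := by
    intro e y
    have h1 : {X : ι × ℕ → V | ∀ i ∈ e, X (i, 0) = y i} =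
        ((e.map ⟨fun i => (i, 0), fun a b h => (Prod.mk.inj h).1⟩ : Finset (ι × ℕ)) : Set (ι × ℕ)).pi
          (fun p => {y p.1}) := by
      ext X
      simp [Set.mem_pi]
      rfl
    rw [h1, Measure.infinitePi_pi _ (fun _ _ => measurableSet_singleton _)]
    simp [hν]
  have hev : ∀ p : ι × ℕ, Measurable (fun X : ι × ℕ → V => X p) := fun p => measurable_pi_apply p
  have hboxm : ∀ (e : Finset ι) (y : ι → V), MeasurableSet {X : ι × ℕ → V | ∀ i ∈ e, X (i, 0) = y i} := by
    intro e y
    have : {X : ι × ℕ → V | ∀ i ∈ e, X (i, 0) = y i} = ⋂ i ∈ e, {X | X (i, 0) = y i} := by ext; simp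
    rw [this]
    exact Finset.measurableSet_biInter _ fun i _ => hev _ (measurableSet_singleton (y i))
  have hunion : ∀ B : Finset (ι → V), {X : ι × ℕ → V | (fun i => X (i, 0)) ∈ B} =
      ⋃ y ∈ B, {X | ∀ i ∈ (Finset.univ : Finset ι), X (i, 0) = y i} := by
    intro B
    ext X
    simp only [Set.mem_ofPred_eq, Set.mem_iUnion, Finset.mem_univ, true_imp_iff]
    constructor
    · intro h; exact ⟨_, h, fun i => rfl⟩
    · rintro ⟨y, hy, h⟩
      rwa [show (fun i => X (i, 0)) = y from funext h]
  have hdisj : ∀ e : Finset ι, ∀ B : Finset (ι → V), (∀ y ∈ B, ∀ y' ∈ B, (∀ i ∈ e, y i = y' i) → y = y') →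
      (B : Set (ι → V)).PairwiseDisjoint (fun y => {X : ι × ℕ → V | ∀ i ∈ e, X (i, 0) = y i}) := by
    intro e B hB y hy y' hy' hne
    refine Set.disjoint_left.2 fun X h1 h2 => hne (hB y hy y' hy' fun i hi => ?_)
    exact (h1 i hi).symm.trans (h2 i hi)
  have hset : ∀ B : Finset (ι → V), U {X : ι × ℕ → V | (fun i => X (i, 0)) ∈ B} =
      (B.card : ENNReal) * m⁻¹ ^ Fintype.card ι := by
    intro B
    rw [hunion, measure_biUnion_finset (hdisj _ _ (fun y _ y' _ h => funext fun i => h i (Finset.mem_univ i)))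
      (fun y _ => hboxm _ y)]
    simp only [hbox]
    simp
  let G : Set (ι × ℕ → V) := {X | (fun i => X (i, 0)) ∈ F}
  have hGm : MeasurableSet G := by
    simp only [G]; rw [hunion]; exact Finset.measurableSet_biUnion _ fun y _ => hboxm _ y
  have hG : U G = (F.card : ENNReal) * m⁻¹ ^ Fintype.card ι := hset F
  have hG0 : U G ≠ 0 := by
    rw [hG]
    refine mul_ne_zero (by simpa using hF.ne_empty) (pow_ne_zero _ (by simp [hmt]))
  have hbm := bits_meas F
  let U' : Measure (ι × ℕ → V) := ProbabilityTheory.cond U G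
  have hU' : IsProbabilityMeasure U' := ProbabilityTheory.cond_isProbabilityMeasure hG0
  have hIP : IsProbabilityMeasure (U.map (bits F)) := Measure.isProbabilityMeasure_map hbm.aemeasurable
  have hIQ : IsProbabilityMeasure (U'.map (bits F)) := Measure.isProbabilityMeasure_map hbm.aemeasurable
  refine ⟨⟨U.map (bits F), hIP⟩, ⟨U'.map (bits F), hIQ⟩, ?_, ?_, ?_, ?_⟩
  · intro e N
    have hrm : Measurable (fun (ω : Finset ι × (ι → ℕ) → Bool) b => ω (rl e N b)) := by fun_prop
    refine ⟨hrm, ?_⟩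
    show (U.map (bits F)).map _ = U.map (bits F)
    rw [Measure.map_map hrm hbm]
    have h1 : (fun (ω : Finset ι × (ι → ℕ) → Bool) b => ω (rl e N b)) ∘ (bits F) =
        (bits F) ∘ (fun (X : ι × ℕ → V) p => X (rp e N p)) := by
      funext X b
      exact bits_rl F X e N b
    rw [h1, ← Measure.map_map hbm (by fun_prop)]
    congr 1
    exact Measure.map_infinitePi_infinitePi_of_inj (rp_inj e N)
  · intro e hinj A hA
    have hAm : MeasurableSet A := BS_le _ _ hA
    show (U'.map (bits F)) A ≤ _ * (U.map (bits F)) A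
    rw [Measure.map_apply hbm hAm, Measure.map_apply hbm hAm]
    set D := (bits F : (ι × ℕ → V) → _) ⁻¹' A with hD
    have hDm : MeasurableSet D := hbm hAm
    simp only [U']
    rw [ProbabilityTheory.cond_apply hGm]
    let ms : ι × ℕ → MeasurableSpace (ι × ℕ → V) := fun p => MeasurableSpace.comap (fun X => X p) inferInstance
    let T : Set (ι × ℕ) := {p : ι × ℕ | p.1 ∈ e ∨ p.2 ≠ 0}
    have hind : ProbabilityTheory.Indep (⨆ p ∈ T, ms p) (⨆ p ∈ Tᶜ, ms p) U := by
      refine ProbabilityTheory.indep_iSup_of_disjoint (fun p => (hev p).comap_le) ?_ disjoint_compl_right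
      exact ProbabilityTheory.iIndepFun_infinitePi (X := fun _ v => v) (fun _ => measurable_id)
    have hD' : MeasurableSet[⨆ p ∈ T, ms p] D := bits_BS F e A hA
    have hsub : ∀ (S : Set (ι × ℕ)) (f : Finset ι) (y : ι → V), (∀ i ∈ f, (i, 0) ∈ S) →
        MeasurableSet[⨆ p ∈ S, ms p] {X : ι × ℕ → V | ∀ i ∈ f, X (i, 0) = y i} := by
      intro S f y hf
      have : {X : ι × ℕ → V | ∀ i ∈ f, X (i, 0) = y i} = ⋂ i ∈ f, {X | X (i, 0) = y i} := by ext; simp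
      rw [this]
      refine @Finset.measurableSet_biInter _ _ (⨆ p ∈ S, ms p) _ f ?_
      intro i hi
      refine le_iSup₂_of_le (f := fun p (_ : p ∈ S) => ms p) (i, 0) (hf i hi) le_rfl _ ?_
      exact ⟨{y i}, measurableSet_singleton _, rfl⟩
    have hfac : ∀ y : ι → V, U ({X | ∀ i ∈ (Finset.univ : Finset ι), X (i, 0) = y i} ∩ D) =
        U ({X | ∀ i ∈ e, X (i, 0) = y i} ∩ D) * m⁻¹ ^ eᶜ.card := by
      intro y
      rw [← hbox eᶜ y, ← (ProbabilityTheory.Indep_iff _ _ _).1 hind _ _ (MeasurableSet.inter (hsub T e y (fun i hi => Or.inl hi)) hD')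
        (hsub Tᶜ eᶜ y (fun i hi => by simpa [T] using hi))]
      congr 1
      ext X
      simp only [Set.mem_inter_iff, Set.mem_ofPred_eq, Finset.mem_univ, true_imp_iff, Finset.mem_compl]
      constructor
      · rintro ⟨h1, h2⟩; exact ⟨⟨fun i _ => h1 i, h2⟩, fun i _ => h1 i⟩
      · rintro ⟨⟨h1, h2⟩, h3⟩
        exact ⟨fun i => (em (i ∈ e)).elim (h1 i) (h3 i), h2⟩
    have hGD : U (G ∩ D) ≤ m⁻¹ ^ eᶜ.card * U D := by
      calc U (G ∩ D) = U (⋃ y ∈ F, ({X | ∀ i ∈ (Finset.univ : Finset ι), X (i, 0) = y i} ∩ D)) := by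
            simp only [G]; rw [hunion, Set.iUnion₂_inter]
        _ ≤ ∑ y ∈ F, U ({X | ∀ i ∈ (Finset.univ : Finset ι), X (i, 0) = y i} ∩ D) := measure_biUnion_finset_le _ _
        _ = m⁻¹ ^ eᶜ.card * ∑ y ∈ F, U ({X | ∀ i ∈ e, X (i, 0) = y i} ∩ D) := by
            rw [Finset.mul_sum]
            exact Finset.sum_congr rfl fun y _ => by rw [hfac, mul_comm]
        _ = m⁻¹ ^ eᶜ.card * U (⋃ y ∈ F, ({X | ∀ i ∈ e, X (i, 0) = y i} ∩ D)) := by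
            rw [measure_biUnion_finset ((hdisj e F hinj).mono fun y => Set.inter_subset_left)
              (fun y _ => (hboxm e y).inter hDm)]
        _ ≤ m⁻¹ ^ eᶜ.card * U D := by
            gcongr
            exact Set.iUnion₂_subset fun y _ => Set.inter_subset_right
    have hcard : Fintype.card ι = eᶜ.card + e.card := by
      rw [Finset.card_compl]; have := Finset.card_le_univ e; omega
    calc (U G)⁻¹ * U (G ∩ D) ≤ (U G)⁻¹ * (m⁻¹ ^ eᶜ.card * U D) := by gcongr
      _ = (m ^ e.card / (F.card : ENNReal)) * U D := by
        rw [hG, hcard, ← mul_assoc]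
        congr 1
        have hF0 : (F.card : ENNReal) ≠ 0 := by simpa using hF.ne_empty
        have ha : m⁻¹ ^ eᶜ.card ≠ 0 := pow_ne_zero _ (by simp [hmt])
        have hat : m⁻¹ ^ eᶜ.card ≠ ⊤ := ENNReal.pow_ne_top (by simp [hm0])
        have hbt : m⁻¹ ^ e.card ≠ ⊤ := ENNReal.pow_ne_top (by simp [hm0])
        rw [pow_add, ENNReal.mul_inv (Or.inl hF0) (Or.inl (by simp)), ENNReal.mul_inv (Or.inl ha) (Or.inl hat),
          ENNReal.inv_pow (a := m⁻¹) (n := e.card), inv_inv, div_eq_mul_inv, mul_assoc, mul_right_comm _ (m ^ e.card),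
          ENNReal.inv_mul_cancel ha hat, one_mul, mul_comm]
  · intro CC
    have hEm : MeasurableSet (⋂ e ∈ CC, {ω : Finset ι × (ι → ℕ) → Bool | ω (e, fun _ => 0) = true}) :=
      Finset.measurableSet_biInter _ fun e _ => measurable_pi_apply (X := fun _ => Bool) _ (measurableSet_singleton true)
    show (U'.map (bits F)) _ = 1
    rw [Measure.map_apply hbm hEm]
    simp only [U']
    rw [ProbabilityTheory.cond_apply hGm, Set.inter_eq_left.2, ENNReal.inv_mul_cancel hG0 (measure_ne_top _ _)]
    intro X hX
    simp only [Set.mem_preimage, Set.mem_iInter, Set.mem_ofPred_eq, bits, decide_eq_true_eq]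
    intro e _
    exact ⟨_, hX, fun i _ => rfl⟩
  · intro CC B hB
    have hEm : MeasurableSet (⋂ e ∈ CC, {ω : Finset ι × (ι → ℕ) → Bool | ω (e, fun _ => 0) = true}) :=
      Finset.measurableSet_biInter _ fun e _ => measurable_pi_apply (X := fun _ => Bool) _ (measurableSet_singleton true)
    show (U.map (bits F)) _ ≤ _
    rw [Measure.map_apply hbm hEm, ← hset B]
    refine measure_mono ?_
    intro X hX
    simp only [Set.mem_preimage, Set.mem_iInter, Set.mem_ofPred_eq, bits, decide_eq_true_eq] at hX
    exact hB _ hX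

end Fin
end Core

section Core
open MeasureTheory Filter Topology
theorem stepD (d s : ℕ) (hd : 2 ≤ d) (hs : d < s) (c : ℝ) (hc : 0 < c) (V : Type) [Fintype V] [Nonempty V]
    (SS : Finset (Finset V)) (hcard : ∀ S ∈ SS, S.card = s)
    (hintg : ∀ S ∈ SS, ∀ S' ∈ SS, S ≠ S' → (S ∩ S').card < d)
    (hbig : c * (Fintype.card V : ℝ) ^ d ≤ SS.card)
    (hno : ¬ ∃ S : Finset V, S.card = s ∧ ∃ φ : Finset V → Finset V,
      Set.InjOn φ ↑(S.powersetCard d) ∧ ∀ T ∈ S.powersetCard d, φ T ∈ SS ∧ T ⊆ φ T) :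
    ∃ P Q : ProbabilityMeasure (Finset (Fin s) × (Fin s → ℕ) → Bool),
      (∀ e N, MeasurePreserving (fun (ω : Finset (Fin s) × (Fin s → ℕ) → Bool) b => ω (rl e N b))
        (P : Measure (Finset (Fin s) × (Fin s → ℕ) → Bool)) P) ∧
      (∀ e ∈ (Finset.univ : Finset (Fin s)).powersetCard d,
        ∀ A, MeasurableSet[BS {b | zz b ⊆ e}] A → (Q : Measure (Finset (Fin s) × (Fin s → ℕ) → Bool)) A ≤
          ENNReal.ofReal (1 / c) * (P : Measure (Finset (Fin s) × (Fin s → ℕ) → Bool)) A) ∧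
      ((Q : Measure (Finset (Fin s) × (Fin s → ℕ) → Bool))
        (⋂ e ∈ (Finset.univ : Finset (Fin s)).powersetCard d, {ω | ω (e, fun _ => 0) = true}) = 1) ∧
      (P : Measure (Finset (Fin s) × (Fin s → ℕ) → Bool))
        (⋂ e ∈ (Finset.univ : Finset (Fin s)).powersetCard d, {ω | ω (e, fun _ => 0) = true}) ≤
          ENNReal.ofReal ((s * 2 ^ s : ℝ) / Fintype.card V) := by
  have hm : 0 < Fintype.card V := Fintype.card_pos
  have hmR : (0 : ℝ) < Fintype.card V := by exact_mod_cast hm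
  have hSpos : 0 < SS.card := by
    have : (0 : ℝ) < SS.card := lt_of_lt_of_le (by positivity) hbig
    exact_mod_cast this
  have hy : ∀ S : Finset V, ∃ y : Fin s → V, S ∈ SS → Function.Injective y ∧ Finset.univ.image y = S := by
    intro S
    by_cases hS : S ∈ SS
    · let q := S.equivFinOfCardEq (hcard S hS)
      refine ⟨fun i => (q.symm i : V), fun _ => ⟨fun a b h => q.symm.injective (Subtype.ext h), ?_⟩⟩
      ext v
      simp only [Finset.mem_image, Finset.mem_univ, true_and]
      constructor
      · rintro ⟨i, rfl⟩; exact (q.symm i).2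
      · intro hv; exact ⟨q ⟨v, hv⟩, by simp⟩
    · exact ⟨fun _ => Classical.arbitrary V, fun h => absurd h hS⟩
  choose y hy using hy
  have hmem : ∀ S ∈ SS, ∀ i, y S i ∈ S := by
    intro S hS i
    have h1 : y S i ∈ Finset.univ.image (y S) := Finset.mem_image_of_mem _ (Finset.mem_univ i)
    rwa [(hy S hS).2] at h1
  have hyinj : Set.InjOn y SS := by
    intro S hS S' hS' h
    rw [← (hy S hS).2, ← (hy S' hS').2, h]
  let F : Finset (Fin s → V) := SS.image y
  have hFc : F.card = SS.card := Finset.card_image_of_injOn hyinj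
  have hFinj : ∀ e : Finset (Fin s), e.card = d → ∀ a ∈ F, ∀ a' ∈ F, (∀ i ∈ e, a i = a' i) → a = a' := by
    intro e he a ha a' ha' h
    obtain ⟨S, hS, rfl⟩ := Finset.mem_image.1 ha
    obtain ⟨S', hS', rfl⟩ := Finset.mem_image.1 ha'
    by_contra hne
    have h1 := hintg S hS S' hS' (fun h => hne (by rw [h]))
    have h2 : e.image (y S) ⊆ S ∩ S' := by
      intro v hv
      obtain ⟨i, hi, rfl⟩ := Finset.mem_image.1 hv
      refine Finset.mem_inter.2 ⟨?_, ?_⟩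
      · exact hmem S hS i
      · rw [h i hi]
        exact hmem S' hS' i
    have h3 := Finset.card_le_card h2
    rw [Finset.card_image_of_injective _ (hy S hS).1] at h3
    omega
  let CC := (Finset.univ : Finset (Fin s)).powersetCard d
  let Bi : Fin s × Finset (Fin s) → Finset (Fin s → V) := fun q =>
    Finset.univ.filter (fun x => q.1 ∉ q.2 ∧ q.2.card = d ∧ ∃ a ∈ F, ∀ j ∈ insert q.1 q.2, a j = x j)
  let B : Finset (Fin s → V) := Finset.univ.biUnion Bi
  have hBi : ∀ q, (Bi q).card ≤ Fintype.card V ^ (s - 1) := by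
    rintro ⟨i, e⟩
    have h1 : Fintype.card ({j : Fin s // j ≠ i} → V) = Fintype.card V ^ (s - 1) := by
      rw [Fintype.card_fun]; congr 1; simp [Fintype.card_subtype_compl]
    rw [← h1, ← Finset.card_univ]
    refine Finset.card_le_card_of_injOn (fun x j => x j) (fun _ _ => Finset.mem_coe.2 (Finset.mem_univ _)) ?_
    intro x hx x' hx' h
    obtain ⟨-, hie, hec, a, ha, hax⟩ := Finset.mem_filter.1 (Finset.mem_coe.1 hx)
    obtain ⟨-, -, -, a', ha', hax'⟩ := Finset.mem_filter.1 (Finset.mem_coe.1 hx')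
    have hoff : ∀ j, j ≠ i → x j = x' j := fun j hj => congrFun h ⟨j, hj⟩
    have haa : a = a' := by
      refine hFinj e hec a ha a' ha' fun j hj => ?_
      have hji : j ≠ i := fun h => hie (h ▸ hj)
      rw [hax j (Finset.mem_insert_of_mem hj), hax' j (Finset.mem_insert_of_mem hj), hoff j hji]
    funext j
    by_cases hj : j = i
    · subst hj
      rw [← hax j (Finset.mem_insert_self _ _), ← hax' j (Finset.mem_insert_self _ _), haa]
    · exact hoff j hj
  have hB : B.card ≤ s * 2 ^ s * Fintype.card V ^ (s - 1) := by
    refine Finset.card_biUnion_le.trans ((Finset.sum_le_card_nsmul _ _ _ fun q _ => hBi q).trans ?_)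
    simp
  have hcov : ∀ x : Fin s → V, (∀ e ∈ CC, ∃ a ∈ F, ∀ i ∈ e, a i = x i) → x ∈ B := by
    intro x hx
    by_contra hxB
    apply hno
    have hx' : ∀ e : Finset (Fin s), ∃ S, e.card = d → S ∈ SS ∧ ∀ i ∈ e, y S i = x i := by
      intro e
      by_cases he : e.card = d
      · obtain ⟨a, ha, h⟩ := hx e (Finset.mem_powersetCard.2 ⟨Finset.subset_univ _, he⟩)
        obtain ⟨S, hS, rfl⟩ := Finset.mem_image.1 ha
        exact ⟨S, fun _ => ⟨hS, h⟩⟩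
      · exact ⟨∅, fun h => absurd h he⟩
    choose g hg using hx'
    have hxinj : Function.Injective x := by
      intro i j hij
      by_contra hne
      obtain ⟨e, he1, -, he2⟩ := Finset.exists_subsuperset_card_eq (s := {i, j}) (t := Finset.univ) (n := d)
        (Finset.subset_univ _) (Finset.card_le_two.trans hd) (by simpa using hs.le)
      obtain ⟨h1, h2⟩ := hg e he2
      apply hne
      apply (hy _ h1).1
      rw [h2 i (he1 (by simp)), h2 j (he1 (by simp)), hij]
    let pe : Finset V → Finset (Fin s) := fun T => Finset.univ.filter (fun i => x i ∈ T)
    have hpe : ∀ T ∈ (Finset.univ.image x).powersetCard d, (pe T).image x = T ∧ (pe T).card = d := by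
      intro T hT
      obtain ⟨hT1, hT2⟩ := Finset.mem_powersetCard.1 hT
      have h1 : (pe T).image x = T := by
        ext v
        simp only [pe, Finset.mem_image, Finset.mem_filter, Finset.mem_univ, true_and]
        constructor
        · rintro ⟨i, hi, rfl⟩; exact hi
        · intro hv
          obtain ⟨i, -, rfl⟩ := Finset.mem_image.1 (hT1 hv)
          exact ⟨i, hv, rfl⟩
      refine ⟨h1, ?_⟩
      rw [← Finset.card_image_of_injective _ hxinj, h1, hT2]
    refine ⟨Finset.univ.image x, ?_, fun T => g (pe T), ?_, ?_⟩
    · rw [Finset.card_image_of_injective _ hxinj]; simp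
    · intro T hT T' hT' hTT
      have hT := hpe T hT
      have hT' := hpe T' hT'
      by_contra hne
      have hpne : pe T ≠ pe T' := fun h => hne (by rw [← hT.1, ← hT'.1, h])
      obtain ⟨i, hi1, hi2⟩ : ∃ i ∈ pe T', i ∉ pe T := by
        by_contra hcon
        push Not at hcon
        exact hpne (Finset.eq_of_subset_of_card_le hcon (by rw [hT.2, hT'.2])).symm
      apply hxB
      refine Finset.mem_biUnion.2 ⟨(i, pe T), Finset.mem_univ _, Finset.mem_filter.2 ⟨Finset.mem_univ _, hi2, hT.2,
        y (g (pe T)), Finset.mem_image_of_mem _ (hg _ hT.2).1, ?_⟩⟩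
      intro j hj
      rcases Finset.mem_insert.1 hj with rfl | hj
      · have : g (pe T) = g (pe T') := hTT
        rw [this]
        exact (hg _ hT'.2).2 _ hi1
      · exact (hg _ hT.2).2 _ hj
    · intro T hT
      have hT := hpe T hT
      obtain ⟨h1, h2⟩ := hg _ hT.2
      refine ⟨h1, ?_⟩
      intro v hv
      rw [← hT.1] at hv
      obtain ⟨i, hi, rfl⟩ := Finset.mem_image.1 hv
      rw [← h2 i hi]
      exact hmem _ h1 i
  have hFne : F.Nonempty := Finset.card_pos.1 (by omega)
  obtain ⟨P, Q, h1, h2, h3, h4⟩ := finite_step F hFne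
  refine ⟨P, Q, h1, ?_, h3 _, (h4 CC B hcov).trans ?_⟩
  · intro e he A hA
    have he' := (Finset.mem_powersetCard.1 he).2
    refine (h2 e (hFinj e he') A hA).trans ?_
    gcongr
    rw [he', hFc]
    have : (Fintype.card V : ENNReal) ^ d / (SS.card : ENNReal) =
        ENNReal.ofReal ((Fintype.card V : ℝ) ^ d / SS.card) := by
      rw [ENNReal.ofReal_div_of_pos (by exact_mod_cast hSpos), ENNReal.ofReal_pow (by positivity)]
      simp
    rw [this]
    apply ENNReal.ofReal_le_ofReal
    rw [div_le_div_iff₀ (by exact_mod_cast hSpos) hc]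
    linarith
  · have : (B.card : ENNReal) * ((Fintype.card V : ENNReal)⁻¹) ^ (Fintype.card (Fin s)) =
        ENNReal.ofReal ((B.card : ℝ) / (Fintype.card V : ℝ) ^ s) := by
      rw [ENNReal.ofReal_div_of_pos (by positivity), ENNReal.ofReal_pow (by positivity), div_eq_mul_inv]
      simp [ENNReal.inv_pow]
    rw [this]
    apply ENNReal.ofReal_le_ofReal
    rw [div_le_div_iff₀ (by positivity) hmR]
    have h5 : (B.card : ℝ) ≤ s * 2 ^ s * (Fintype.card V : ℝ) ^ (s - 1) := by exact_mod_cast hB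
    have h6 : (Fintype.card V : ℝ) ^ s = (Fintype.card V : ℝ) ^ (s - 1) * Fintype.card V := by
      rw [← pow_succ]; congr 1; omega
    rw [h6]
    nlinarith

theorem lemD (d s : ℕ) (hd : 2 ≤ d) (hs : d < s) (c : ℝ) (hc : 0 < c) :
    ∃ m0 : ℕ, ∀ (V : Type) [Fintype V], m0 ≤ Fintype.card V →
    ∀ SS : Finset (Finset V), (∀ S ∈ SS, S.card = s) →
    (∀ S ∈ SS, ∀ S' ∈ SS, S ≠ S' → (S ∩ S').card < d) →
    c * (Fintype.card V : ℝ) ^ d ≤ SS.card →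
    ∃ S : Finset V, S.card = s ∧ ∃ φ : Finset V → Finset V,
      Set.InjOn φ ↑(S.powersetCard d) ∧ ∀ T ∈ S.powersetCard d, φ T ∈ SS ∧ T ⊆ φ T := by
  by_contra hcon
  push Not at hcon
  have key : ∀ n : ℕ, ∃ P Q : ProbabilityMeasure (Finset (Fin s) × (Fin s → ℕ) → Bool),
      (∀ e N, MeasurePreserving (fun (ω : Finset (Fin s) × (Fin s → ℕ) → Bool) b => ω (rl e N b))
        (P : Measure (Finset (Fin s) × (Fin s → ℕ) → Bool)) P) ∧
      (∀ e ∈ (Finset.univ : Finset (Fin s)).powersetCard d,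
        ∀ A, MeasurableSet[BS {b | zz b ⊆ e}] A → (Q : Measure (Finset (Fin s) × (Fin s → ℕ) → Bool)) A ≤
          ENNReal.ofReal (1 / c) * (P : Measure (Finset (Fin s) × (Fin s → ℕ) → Bool)) A) ∧
      ((Q : Measure (Finset (Fin s) × (Fin s → ℕ) → Bool))
        (⋂ e ∈ (Finset.univ : Finset (Fin s)).powersetCard d, {ω | ω (e, fun _ => 0) = true}) = 1) ∧
      (P : Measure (Finset (Fin s) × (Fin s → ℕ) → Bool))
        (⋂ e ∈ (Finset.univ : Finset (Fin s)).powersetCard d, {ω | ω (e, fun _ => 0) = true}) ≤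
          ENNReal.ofReal ((s * 2 ^ s : ℝ) / ((n : ℝ) + 1)) := by
    intro n
    obtain ⟨V, iV, hn, SS, h1, h2, h3, h4⟩ := hcon (n + 1)
    have : Nonempty V := Fintype.card_pos_iff.1 (by omega)
    obtain ⟨P, Q, g1, g2, g3, g4⟩ := stepD d s hd hs c hc V SS h1 h2 h3 (by
      rintro ⟨S, a, φ, b, e⟩
      obtain ⟨T, hT, hT'⟩ := h4 S a φ b
      exact hT' (e T hT).1 (e T hT).2)
    refine ⟨P, Q, g1, g2, g3, g4.trans (ENNReal.ofReal_le_ofReal ?_)⟩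
    have : ((n : ℝ) + 1) ≤ Fintype.card V := by exact_mod_cast hn
    gcongr
  choose P Q h1 h2 h3 h4 using key
  refine limit_contra zz ((Finset.univ : Finset (Fin s)).powersetCard d) (ENNReal.ofReal (1 / c)) (by simp) P Q ?_ h2
    (fun e => (e, fun _ => 0)) (fun e _ => by simp [zz]) h3 ?_
  · intro e F hF
    obtain ⟨N, hN1, hN2⟩ := rl_props e F hF
    exact ⟨rl e N, hN1, hN2, fun n => h1 n e N⟩
  · refine tendsto_of_tendsto_of_tendsto_of_le_of_le tendsto_const_nhds ?_ (fun _ => bot_le) h4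
    rw [← ENNReal.ofReal_zero]
    apply ENNReal.tendsto_ofReal
    have := (tendsto_one_div_add_atTop_nhds_zero_nat (𝕜 := ℝ)).const_mul (s * 2 ^ s : ℝ)
    simpa [div_eq_mul_inv] using this
end Core

section Loc

noncomputable def tt (P : Finset (ℝ × ℝ)) (γ : Set (ℝ × ℝ)) : ℕ := (P.filter (fun p => p ∈ γ)).card

theorem choose_big (d L t : ℕ) (hd : 2 ≤ d) (hL : d ≤ L) (ht : 2 * L ≤ t) :
    t * L ≤ 2 * d.factorial * t.choose d := by
  have h1 : (t + 1 - d) ^ d ≤ d.factorial * t.choose d := by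
    rw [← Nat.descFactorial_eq_factorial_mul_choose]
    exact Nat.pow_sub_le_descFactorial t d
  have h2 : t * L ≤ 2 * (t + 1 - d) ^ d := by
    have h3 : (t + 1 - d) ^ 2 ≤ (t + 1 - d) ^ d := Nat.pow_le_pow_right (by omega) hd
    have h4 : t ≤ 2 * (t + 1 - d) := by omega
    have h5 : L ≤ t + 1 - d := by omega
    calc t * L ≤ (2 * (t + 1 - d)) * (t + 1 - d) := Nat.mul_le_mul h4 h5
      _ = 2 * (t + 1 - d) ^ 2 := by ring
      _ ≤ _ := by omega
  nlinarith

theorem sum_choose_le (k : ℕ) (P : Finset (ℝ × ℝ)) (C : Finset (Set (ℝ × ℝ)))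
    (hC : ∀ γ ∈ C, ∀ γ' ∈ C, γ ≠ γ' → (P.filter (fun p => p ∈ γ ∧ p ∈ γ')).card ≤ k) :
    ∑ γ ∈ C, (tt P γ).choose (k + 1) ≤ P.card ^ (k + 1) := by
  have h1 : ∀ γ ∈ C, (tt P γ).choose (k + 1) = ((P.filter (fun p => p ∈ γ)).powersetCard (k + 1)).card :=
    fun γ _ => (Finset.card_powersetCard _ _).symm
  rw [Finset.sum_congr rfl h1, ← Finset.card_biUnion]
  · refine (Finset.card_le_card (t := P.powersetCard (k + 1)) ?_).trans ?_
    · intro T hT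
      obtain ⟨γ, -, hT⟩ := Finset.mem_biUnion.1 hT
      exact Finset.powersetCard_mono (Finset.filter_subset _ _) hT
    · rw [Finset.card_powersetCard]; exact Nat.choose_le_pow _ _
  · intro γ hγ γ' hγ' hne
    refine Finset.disjoint_left.2 fun T hT hT' => ?_
    obtain ⟨a, b⟩ := Finset.mem_powersetCard.1 hT
    obtain ⟨a', -⟩ := Finset.mem_powersetCard.1 hT'
    have : T ⊆ P.filter (fun p => p ∈ γ ∧ p ∈ γ') := fun p hp =>
      Finset.mem_filter.2 ⟨(Finset.mem_filter.1 (a hp)).1, (Finset.mem_filter.1 (a hp)).2, (Finset.mem_filter.1 (a' hp)).2⟩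
    have h2 := Finset.card_le_card this
    have := hC γ hγ γ' hγ' hne
    omega

theorem config_of (k s : ℕ) (hk : 1 ≤ k) (hs : k + 1 < s) (c : ℝ) (hc : 0 < c) :
    ∃ m0 : ℕ, ∀ (P : Finset (ℝ × ℝ)) (C : Finset (Set (ℝ × ℝ))),
      (∀ γ ∈ C, ∀ γ' ∈ C, γ ≠ γ' → (P.filter (fun p => p ∈ γ ∧ p ∈ γ')).card ≤ k) →
      ¬ ContainsConfig P C s k → m0 ≤ P.card → (∀ γ ∈ C, s ≤ tt P γ) →
      (C.card : ℝ) < c * (P.card : ℝ) ^ (k + 1) := by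
  obtain ⟨m0, hm0⟩ := lemD (k + 1) s (by omega) hs c hc
  refine ⟨m0, fun P C hC hno hm hrich => ?_⟩
  by_contra hcon
  push Not at hcon
  apply hno
  have hch : ∀ γ, ∃ S : Finset (ℝ × ℝ), γ ∈ C → S ⊆ P.filter (fun p => p ∈ γ) ∧ S.card = s := by
    intro γ
    by_cases hγ : γ ∈ C
    · obtain ⟨S, h⟩ := Finset.exists_subset_card_eq (hrich γ hγ)
      exact ⟨S, fun _ => h⟩
    · exact ⟨∅, fun h => absurd h hγ⟩
  choose S hS using hch
  let f : Set (ℝ × ℝ) → Finset {p // p ∈ P} := fun γ => (S γ).subtype (· ∈ P)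
  have hfm : ∀ γ ∈ C, (f γ).map (Function.Embedding.subtype _) = S γ := by
    intro γ hγ
    rw [Finset.subtype_map_of_mem]
    exact fun p hp => (Finset.mem_filter.1 ((hS γ hγ).1 hp)).1
  have hfc : ∀ γ ∈ C, (f γ).card = s := by
    intro γ hγ
    rw [← Finset.card_map (Function.Embedding.subtype _), hfm γ hγ, (hS γ hγ).2]
  have hfi : ∀ γ ∈ C, ∀ γ' ∈ C, γ ≠ γ' → (f γ ∩ f γ').card ≤ k := by
    intro γ hγ γ' hγ' hne
    rw [← Finset.card_map (Function.Embedding.subtype _), Finset.map_inter, hfm γ hγ, hfm γ' hγ']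
    refine (Finset.card_le_card ?_).trans (hC γ hγ γ' hγ' hne)
    intro p hp
    obtain ⟨h1, h2⟩ := Finset.mem_inter.1 hp
    have h1 := Finset.mem_filter.1 ((hS γ hγ).1 h1)
    have h2 := Finset.mem_filter.1 ((hS γ' hγ').1 h2)
    exact Finset.mem_filter.2 ⟨h1.1, h1.2, h2.2⟩
  have hfinj : Set.InjOn f C := by
    intro γ hγ γ' hγ' h
    by_contra hne
    have := hfi γ hγ γ' hγ' hne
    rw [← h, Finset.inter_self, hfc γ hγ] at this
    omega
  obtain ⟨S0, hS0, φ, hφ1, hφ2⟩ := hm0 {p // p ∈ P} (by simpa using hm) (C.image f) (by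
    intro T hT
    obtain ⟨γ, hγ, rfl⟩ := Finset.mem_image.1 hT
    exact hfc γ hγ) (by
    intro T hT T' hT' hne
    obtain ⟨γ, hγ, rfl⟩ := Finset.mem_image.1 hT
    obtain ⟨γ', hγ', rfl⟩ := Finset.mem_image.1 hT'
    have := hfi γ hγ γ' hγ' (fun h => hne (by rw [h]))
    convert Nat.lt_succ_of_le this) (by
    rw [Finset.card_image_of_injOn hfinj]
    simpa using hcon)
  have hg : ∀ T, ∃ γ, T ∈ S0.powersetCard (k + 1) → γ ∈ C ∧ f γ = φ T := by
    intro T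
    by_cases hT : T ∈ S0.powersetCard (k + 1)
    · obtain ⟨γ, h⟩ := Finset.mem_image.1 (hφ2 T hT).1
      exact ⟨γ, fun _ => h⟩
    · exact ⟨∅, fun h => absurd h hT⟩
  choose g hg using hg
  have hback : ∀ T ∈ (S0.map (Function.Embedding.subtype _)).powersetCard (k + 1),
      ∃ T0 ∈ S0.powersetCard (k + 1), T = T0.map (Function.Embedding.subtype _) := by
    intro T hT
    obtain ⟨h1, h2⟩ := Finset.mem_powersetCard.1 hT
    obtain ⟨T0, h3, rfl⟩ := Finset.subset_map_iff.1 h1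
    exact ⟨T0, Finset.mem_powersetCard.2 ⟨h3, by simpa using h2⟩, rfl⟩
  have hsub : ∀ T0 : Finset {p // p ∈ P}, (T0.map (Function.Embedding.subtype _)).subtype (· ∈ P) = T0 := by
    intro T0
    ext x
    simp
  refine ⟨S0.map (Function.Embedding.subtype _), ?_, by simpa using hS0, fun T => g (T.subtype (· ∈ P)), ?_, ?_⟩
  · intro p hp
    obtain ⟨q, -, rfl⟩ := Finset.mem_map.1 hp
    exact q.2
  · intro T hT T' hT' h
    obtain ⟨T0, h0, rfl⟩ := hback T hT
    obtain ⟨T1, h1, rfl⟩ := hback T' hT'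
    simp only [hsub] at h
    rw [hφ1 h0 h1 (by rw [← (hg T0 h0).2, ← (hg T1 h1).2, h])]
  · intro T hT
    obtain ⟨T0, h0, rfl⟩ := hback T hT
    simp only [hsub]
    refine ⟨(hg T0 h0).1, ?_⟩
    intro p hp
    obtain ⟨q, hq, rfl⟩ := Finset.mem_map.1 (Finset.mem_coe.1 hp)
    have h1 := (hφ2 T0 h0).2 hq
    rw [← (hg T0 h0).2] at h1
    have h2 : (q : ℝ × ℝ) ∈ S (g T0) := by simpa [f] using h1
    exact (Finset.mem_filter.1 ((hS _ (hg T0 h0).1).1 h2)).2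

theorem ContainsConfig.mono {P P' : Finset (ℝ × ℝ)} {C C' : Finset (Set (ℝ × ℝ))} {s k : ℕ}
    (hP : P ⊆ P') (hC : C ⊆ C') (h : ContainsConfig P C s k) : ContainsConfig P' C' s k := by
  obtain ⟨S, h1, h2, φ, h3, h4⟩ := h
  exact ⟨S, h1.trans hP, h2, φ, h3, fun T hT => ⟨hC (h4 T hT).1, (h4 T hT).2⟩⟩

theorem local_lemma (k s : ℕ) (hk : 1 ≤ k) (hs : k + 1 < s) (c : ℝ) (hc : 0 < c) :
    ∃ K : ℝ, 0 ≤ K ∧ ∀ (P : Finset (ℝ × ℝ)) (C : Finset (Set (ℝ × ℝ))),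
      (∀ γ ∈ C, ∀ γ' ∈ C, γ ≠ γ' → (P.filter (fun p => p ∈ γ ∧ p ∈ γ')).card ≤ k) →
      ¬ ContainsConfig P C s k →
      ((∑ γ ∈ C.filter (fun γ => s ≤ tt P γ), tt P γ : ℕ) : ℝ) ≤ c * (P.card : ℝ) ^ (k + 1) + K * P.card := by
  obtain ⟨L0, hL0⟩ := exists_nat_gt (4 * ((k + 1).factorial : ℝ) / c)
  let L := max L0 (k + 1)
  have hL : 4 * ((k + 1).factorial : ℝ) ≤ c * L := by
    rw [div_lt_iff₀ hc] at hL0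
    have : (L0 : ℝ) ≤ L := by exact_mod_cast le_max_left _ _
    nlinarith
  have hLpos : (0 : ℝ) < L := by
    have : (k + 1 : ℕ) ≤ L := le_max_right _ _
    exact_mod_cast (by omega : 0 < L)
  obtain ⟨m0, hm0⟩ := config_of k s hk hs (c / (4 * L)) (by positivity)
  refine ⟨(m0 : ℝ) ^ (k + 1), by positivity, fun P C hC hno => ?_⟩
  have hm : (0 : ℝ) ≤ P.card := by positivity
  have hsum := sum_choose_le k P C hC
  by_cases hmm : m0 ≤ P.card
  · have hsplit : ∑ γ ∈ C.filter (fun γ => s ≤ tt P γ), tt P γ ≤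
        ∑ γ ∈ C.filter (fun γ => 2 * L ≤ tt P γ), tt P γ +
        ∑ γ ∈ C.filter (fun γ => s ≤ tt P γ ∧ tt P γ < 2 * L), tt P γ := by
      simp only [Finset.sum_filter]
      rw [← Finset.sum_add_distrib]
      refine Finset.sum_le_sum fun γ _ => ?_
      by_cases h1 : s ≤ tt P γ <;> by_cases h2 : 2 * L ≤ tt P γ
      · simp [h1, h2]
      · have h3 : tt P γ < 2 * L := by omega
        simp [h1, h2, h3]
      · simp [h1]
      · simp [h1]
    have hA : ((∑ γ ∈ C.filter (fun γ => 2 * L ≤ tt P γ), tt P γ : ℕ) : ℝ) ≤ c / 2 * (P.card : ℝ) ^ (k + 1) := by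
      have h1 : (∑ γ ∈ C.filter (fun γ => 2 * L ≤ tt P γ), tt P γ) * L ≤
          2 * (k + 1).factorial * P.card ^ (k + 1) := by
        rw [Finset.sum_mul]
        refine (Finset.sum_le_sum fun γ hγ => choose_big (k + 1) L (tt P γ) (by omega) (le_max_right _ _)
          (Finset.mem_filter.1 hγ).2).trans ?_
        rw [← Finset.mul_sum]
        refine Nat.mul_le_mul_left _ ((Finset.sum_le_sum_of_subset (Finset.filter_subset _ _)).trans hsum)
      have h2 : ((∑ γ ∈ C.filter (fun γ => 2 * L ≤ tt P γ), tt P γ : ℕ) : ℝ) * L ≤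
          2 * ((k + 1).factorial : ℝ) * (P.card : ℝ) ^ (k + 1) := by exact_mod_cast h1
      refine le_of_mul_le_mul_right (h2.trans ?_) hLpos
      have h3 : (0 : ℝ) ≤ (P.card : ℝ) ^ (k + 1) := by positivity
      nlinarith
    have hB : ((∑ γ ∈ C.filter (fun γ => s ≤ tt P γ ∧ tt P γ < 2 * L), tt P γ : ℕ) : ℝ) ≤ c / 2 * (P.card : ℝ) ^ (k + 1) := by
      have h1 := hm0 P (C.filter (fun γ => s ≤ tt P γ ∧ tt P γ < 2 * L))
        (fun γ hγ γ' hγ' => hC γ (Finset.mem_filter.1 hγ).1 γ' (Finset.mem_filter.1 hγ').1)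
        (fun h => hno (h.mono subset_rfl (Finset.filter_subset _ _))) hmm
        (fun γ hγ => (Finset.mem_filter.1 hγ).2.1)
      have h2 : ∑ γ ∈ C.filter (fun γ => s ≤ tt P γ ∧ tt P γ < 2 * L), tt P γ ≤
          (C.filter (fun γ => s ≤ tt P γ ∧ tt P γ < 2 * L)).card * (2 * L) := by
        refine (Finset.sum_le_card_nsmul _ _ (2 * L) fun γ hγ => (Finset.mem_filter.1 hγ).2.2.le).trans ?_
        simp
      have h3 : ((∑ γ ∈ C.filter (fun γ => s ≤ tt P γ ∧ tt P γ < 2 * L), tt P γ : ℕ) : ℝ) ≤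
          ((C.filter (fun γ => s ≤ tt P γ ∧ tt P γ < 2 * L)).card : ℝ) * (2 * L) := by exact_mod_cast h2
      refine h3.trans ((mul_le_mul_of_nonneg_right h1.le (by positivity)).trans (le_of_eq ?_))
      field_simp
      ring
    have h4 : ((∑ γ ∈ C.filter (fun γ => s ≤ tt P γ), tt P γ : ℕ) : ℝ) ≤
        ((∑ γ ∈ C.filter (fun γ => 2 * L ≤ tt P γ), tt P γ : ℕ) : ℝ) +
        ((∑ γ ∈ C.filter (fun γ => s ≤ tt P γ ∧ tt P γ < 2 * L), tt P γ : ℕ) : ℝ) := by exact_mod_cast hsplit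
    have h5 : (0 : ℝ) ≤ (m0 : ℝ) ^ (k + 1) * P.card := by positivity
    linarith
  · have h1 : ∑ γ ∈ C.filter (fun γ => s ≤ tt P γ), tt P γ ≤ m0 ^ (k + 1) * P.card := by
      have h2 : ∀ γ ∈ C.filter (fun γ => s ≤ tt P γ), tt P γ ≤ (tt P γ).choose (k + 1) * P.card := by
        intro γ hγ
        have h3 : 1 ≤ (tt P γ).choose (k + 1) := Nat.choose_pos (by have := (Finset.mem_filter.1 hγ).2; omega)
        have h4 : tt P γ ≤ P.card := Finset.card_le_card (Finset.filter_subset _ _)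
        nlinarith
      refine (Finset.sum_le_sum h2).trans ?_
      rw [← Finset.sum_mul]
      refine Nat.mul_le_mul_right _ ?_
      refine ((Finset.sum_le_sum_of_subset (Finset.filter_subset _ _)).trans hsum).trans ?_
      exact Nat.pow_le_pow_left (by omega) _
    have h2 : ((∑ γ ∈ C.filter (fun γ => s ≤ tt P γ), tt P γ : ℕ) : ℝ) ≤ (m0 : ℝ) ^ (k + 1) * P.card := by
      exact_mod_cast h1
    have h3 : 0 ≤ c * (P.card : ℝ) ^ (k + 1) := by positivity
    linarith

end Loc

section Gen
variable {V : Type} {r : V → V → Prop}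

theorem Conn.union_ex (hs : ∀ u v, r u v → r v u) {S T : Finset V} (hS : Conn r S) (hT : Conn r T)
    {a b : V} (ha : a ∈ S) (hb : b ∈ T) (hab : r a b) :
    ∃ R : Finset V, Conn r R ∧ ∀ x, x ∈ R ↔ x ∈ S ∨ x ∈ T :=
  ⟨S ∪ T, Conn.union hs hS hT ha hb (Or.inr hab), fun _ => Finset.mem_union⟩

/-- the division theorem, phrased through labels of the vertices outside `X` -/
theorem division_label (hs : ∀ u v, r u v → r v u) (hK : NoK5Minor r) (U : Finset V) (c w : V → ℕ)
    (i : ℕ) :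
    ∃ X ⊆ U, ∃ q : V → Finset V,
      ((∑ v ∈ X, c v : ℕ) : ℝ) ≤ 80 * √((∑ v ∈ U, c v ^ 2 : ℕ) : ℝ) * √2 ^ i ∧
      (∀ u ∈ U, u ∉ X → ∀ v ∈ U, v ∉ X → r u v → q u = q v) ∧
      (∀ v ∈ U, v ∉ X → ∀ T ⊆ U, (∀ u ∈ T, u ∉ X ∧ q u = q v) →
        2 ^ i * ∑ u ∈ T, w u ≤ ∑ u ∈ U, w u) := by
  obtain ⟨X, hXU, hc, hw⟩ := division hs hK U c w i
  have hq : ∀ v, ∃ Q : Finset V, v ∈ U \ X → IsComp r (U \ X) Q ∧ v ∈ Q := by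
    intro v
    by_cases h : v ∈ U \ X
    · obtain ⟨Q, hQ, hT⟩ := exists_comp hs (conn_singleton (r := r) v) (Finset.singleton_subset_iff.2 h)
      exact ⟨Q, fun _ => ⟨hQ, hT (Finset.mem_singleton_self v)⟩⟩
    · exact ⟨∅, fun h' => absurd h' h⟩
  choose q hq using hq
  refine ⟨X, hXU, q, hc, ?_, ?_⟩
  · intro u hu huX v hv hvX huv
    have h1 := hq u (Finset.mem_sdiff.2 ⟨hu, huX⟩)
    have h2 := hq v (Finset.mem_sdiff.2 ⟨hv, hvX⟩)
    have h3 : v ∈ q u := h1.1.2.2 u h1.2 v (Finset.mem_sdiff.2 ⟨hv, hvX⟩) huv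
    exact (IsComp.eq h1.1 h2.1 h2.2 h3).symm
  · intro v hv hvX T hT hTq
    have h2 := hq v (Finset.mem_sdiff.2 ⟨hv, hvX⟩)
    refine le_trans (Nat.mul_le_mul_left _ (Finset.sum_le_sum_of_subset (t := q v) ?_)) (hw (q v) h2.1.1 h2.1.2.1)
    intro u hu
    have h1 := hq u (Finset.mem_sdiff.2 ⟨hT hu, (hTq u hu).1⟩)
    rw [(hTq u hu).2] at h1
    exact h1.2

theorem labels_le {L : Type} (ℓ : V → L) (p : V → Prop) (τ : V → ℝ) (A : Finset V)
    (hτ : Set.InjOn τ A)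
    (h : ∀ u ∈ A, ∀ v ∈ A, τ u < τ v → (∀ x ∈ A, ¬ (τ u < τ x ∧ τ x < τ v)) → ¬ p u → ¬ p v → ℓ u = ℓ v) :
    ((A.filter (fun v => ¬ p v)).image ℓ).card ≤ (A.filter p).card + 1 := by
  suffices H : ((A.filter (fun v => ¬ p v)).image ℓ).card ≤ (A.filter p).card + 1 ∧
      ∀ x ∈ A, (∀ y ∈ A, τ y ≤ τ x) → p x → ((A.filter (fun v => ¬ p v)).image ℓ).card ≤ (A.filter p).card from H.1
  induction A using Finset.induction_on_max_value τ with
  | empty => simp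
  | insert b A hb hmax ih =>
    have hlt : ∀ x ∈ A, τ x < τ b := fun x hx => lt_of_le_of_ne (hmax x hx) (fun e => hb (by
      have := hτ (Finset.mem_coe.2 (Finset.mem_insert_of_mem hx)) (Finset.mem_coe.2 (Finset.mem_insert_self b A)) e
      rwa [← this]))
    obtain ⟨i1, i2⟩ := ih (hτ.mono (by simp)) (by
      intro u hu v hv huv hx hpu hpv
      refine h u (Finset.mem_insert_of_mem hu) v (Finset.mem_insert_of_mem hv) huv ?_ hpu hpv
      intro x hxA
      rcases Finset.mem_insert.1 hxA with rfl | hxA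
      · intro hh; exact absurd hh.2 (not_lt.2 (hmax v hv))
      · exact hx x hxA)
    by_cases hpb : p b
    · have e1 : (insert b A).filter (fun v => ¬ p v) = A.filter (fun v => ¬ p v) := by
        rw [Finset.filter_insert, if_neg (by simpa using hpb)]
      have e2 : ((insert b A).filter p).card = (A.filter p).card + 1 := by
        rw [Finset.filter_insert, if_pos hpb, Finset.card_insert_of_notMem (by simp [hb])]
      rw [e1, e2]
      exact ⟨by omega, fun _ _ _ _ => i1⟩
    · have e1 : (insert b A).filter (fun v => ¬ p v) = insert b (A.filter (fun v => ¬ p v)) := by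
        rw [Finset.filter_insert, if_pos hpb]
      have e2 : (insert b A).filter p = A.filter p := by
        rw [Finset.filter_insert, if_neg hpb]
      rw [e1, e2, Finset.image_insert]
      refine ⟨?_, ?_⟩
      · rcases A.eq_empty_or_nonempty with rfl | hA
        · simp
        obtain ⟨m, hm, hmm⟩ := Finset.exists_max_image A τ hA
        by_cases hpm : p m
        · have := i2 m hm hmm hpm
          have := Finset.card_insert_le (ℓ b) ((A.filter (fun v => ¬ p v)).image ℓ)
          omega
        · have : ℓ m = ℓ b := by
            refine h m (Finset.mem_insert_of_mem hm) b (Finset.mem_insert_self _ _) (hlt m hm) ?_ hpm hpb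
            intro x hx
            rcases Finset.mem_insert.1 hx with rfl | hx
            · simp
            · intro hh; exact absurd hh.1 (not_lt.2 (hmm x hx))
          rw [Finset.insert_eq_of_mem]
          · exact i1
          · rw [← this]; exact Finset.mem_image_of_mem _ (by simp [hm, hpm])
      · intro x hx hxm hpx
        exfalso
        rcases Finset.mem_insert.1 hx with rfl | hx
        · exact hpb hpx
        · exact absurd (hlt x hx) (not_lt.2 (hxm b (Finset.mem_insert_self _ _)))

end Gen

section Geo

theorem noK5_of_arcs (r : ℝ × ℝ → ℝ × ℝ → Prop) (hs : ∀ u v, r u v → r v u) (arc : ℝ × ℝ → ℝ × ℝ → Set (ℝ × ℝ))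
    (hj : ∀ u v, r u v → JoinedIn (arc u v) u v)
    (hdisj : ∀ u v u' v', r u v → r u' v' → u ≠ u' → u ≠ v' → v ≠ u' → v ≠ v' →
      Disjoint (arc u v) (arc u' v')) : NoK5Minor r := by
  intro B hB hBd hadj
  let D : Fin 5 → Fin 5 → Set (ℝ × ℝ) := fun i j =>
    {x | ∃ u v, (u ∈ B i ∨ u ∈ B j) ∧ (v ∈ B i ∨ v ∈ B j) ∧ r u v ∧ x ∈ arc u v}
  choose p hp using fun i => (hB i).1
  have hpne : ∀ i j, i ≠ j → p i ≠ p j := by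
    intro i j hij h
    exact Finset.disjoint_left.1 (hBd i j hij) (hp i) (h ▸ hp j)
  have hjoin : ∀ i j, i ≠ j → JoinedIn (D i j) (p i) (p j) := by
    intro i j hij
    obtain ⟨u, hu, v, hv, huv⟩ := hadj i j hij
    obtain ⟨R, hconn, hR⟩ := Conn.union_ex hs (hB i) (hB j) hu hv huv
    have key := hconn.prop (fun w => w = p i ∨ JoinedIn (D i j) (p i) w)
      ((hR _).2 (Or.inl (hp i))) (Or.inl rfl) (by
        intro w hw hww w' hw' hr
        right
        have h1 : JoinedIn (D i j) w w' := (hj w w' hr).mono (fun x hx => ⟨w, w', (hR _).1 hw, (hR _).1 hw', hr, hx⟩)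
        rcases hww with rfl | hww
        · exact h1
        · exact hww.trans h1)
    exact (key (p j) ((hR _).2 (Or.inr (hp j)))).resolve_left (hpne j i hij.symm)
  have hDd : ∀ a b c d, a ≠ c → a ≠ d → b ≠ c → b ≠ d → Disjoint (D a b) (D c d) := by
    intro a b c d h1 h2 h3 h4
    refine Set.disjoint_left.2 ?_
    rintro x ⟨u, v, hu, hv, huv, hx⟩ ⟨u', v', hu', hv', huv', hx'⟩
    have hne : ∀ w, (w ∈ B a ∨ w ∈ B b) → ∀ w', (w' ∈ B c ∨ w' ∈ B d) → w ≠ w' := by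
      rintro w hw w' hw' rfl
      rcases hw with h | h <;> rcases hw' with h' | h'
      · exact Finset.disjoint_left.1 (hBd a c h1) h h'
      · exact Finset.disjoint_left.1 (hBd a d h2) h h'
      · exact Finset.disjoint_left.1 (hBd b c h3) h h'
      · exact Finset.disjoint_left.1 (hBd b d h4) h h'
    exact Set.disjoint_left.1 (hdisj u v u' v' huv huv' (hne _ hu _ hu') (hne _ hu _ hv')
      (hne _ hv _ hu') (hne _ hv _ hv')) hx hx'
  have hpath : ∀ i j : Fin 5, ∃ q : ℝ → ℝ × ℝ, i < j → Continuous q ∧ q 0 = p i ∧ q 1 = p j ∧ ∀ t, q t ∈ D i j := by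
    intro i j
    by_cases hij : i < j
    · obtain ⟨γ, hγ⟩ := hjoin i j hij.ne
      refine ⟨γ.extend, fun _ => ⟨γ.continuous_extend, γ.extend_zero, γ.extend_one, fun t => ?_⟩⟩
      exact hγ _
    · exact ⟨fun _ => 0, fun h => absurd h hij⟩
  choose q hq using hpath
  let e := Complex.equivRealProdCLM.symm
  refine no_K5 (fun i => e (p i)) (fun i j t => e (q i j t)) ?_ ?_ ?_ ?_
  · intro i j hij
    exact e.continuous.comp (hq i j hij).1
  · intro i j hij
    simp only [(hq i j hij).2.1]
  · intro i j hij
    simp only [(hq i j hij).2.2.1]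
  · intro a b c d hab hcd h1 h2 h3 h4 s t h
    have h5 := e.injective h
    exact Set.disjoint_left.1 (hDd a b c d h1 h2 h3 h4) ((hq a b hab).2.2.2 s) (h5 ▸ (hq c d hcd).2.2.2 t)

/-- consecutive points of `W` on a curve of `C` -/
def adjW (W : Finset (ℝ × ℝ)) (C : Finset (Set (ℝ × ℝ))) (F : Set (ℝ × ℝ) → ℝ → ℝ × ℝ) (u v : ℝ × ℝ) : Prop :=
  ∃ γ ∈ C, ∃ a ∈ Set.Icc (0 : ℝ) 1, ∃ b ∈ Set.Icc (0 : ℝ) 1, a < b ∧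
    ((F γ a = u ∧ F γ b = v) ∨ (F γ a = v ∧ F γ b = u)) ∧ u ∈ W ∧ v ∈ W ∧ ∀ t ∈ Set.Ioo a b, F γ t ∉ W

theorem adjW_symm (W : Finset (ℝ × ℝ)) (C : Finset (Set (ℝ × ℝ))) (F : Set (ℝ × ℝ) → ℝ → ℝ × ℝ) (u v : ℝ × ℝ)
    (h : adjW W C F u v) : adjW W C F v u := by
  obtain ⟨γ, hγ, a, ha, b, hb, hab, h, hu, hv, hW⟩ := h
  exact ⟨γ, hγ, a, ha, b, hb, hab, h.symm, hv, hu, hW⟩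

theorem adjW_noK5 (W : Finset (ℝ × ℝ)) (C : Finset (Set (ℝ × ℝ))) (F : Set (ℝ × ℝ) → ℝ → ℝ × ℝ)
    (hFc : ∀ γ ∈ C, Continuous (F γ))
    (hW : ∀ γ ∈ C, ∀ γ' ∈ C, γ ≠ γ' → ∀ t ∈ Set.Icc (0 : ℝ) 1, ∀ t' ∈ Set.Icc (0 : ℝ) 1, F γ t = F γ' t' → F γ t ∈ W)
    (hFi : ∀ γ ∈ C, Set.InjOn (F γ) (Set.Icc 0 1)) : NoK5Minor (adjW W C F) := by
  have hch : ∀ u v : ℝ × ℝ, ∃ (γ : Set (ℝ × ℝ)) (a b : ℝ), adjW W C F u v → γ ∈ C ∧ a ∈ Set.Icc (0 : ℝ) 1 ∧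
      b ∈ Set.Icc (0 : ℝ) 1 ∧ a < b ∧
      ((F γ a = u ∧ F γ b = v) ∨ (F γ a = v ∧ F γ b = u)) ∧ u ∈ W ∧ v ∈ W ∧ ∀ t ∈ Set.Ioo a b, F γ t ∉ W := by
    intro u v
    by_cases h : adjW W C F u v
    · obtain ⟨γ, hγ, a, ha, b, hb, h'⟩ := h
      exact ⟨γ, a, b, fun _ => ⟨hγ, ha, hb, h'⟩⟩
    · exact ⟨∅, 0, 0, fun h' => absurd h' h⟩
  choose γ a b h using hch
  refine noK5_of_arcs _ (adjW_symm W C F) (fun u v => F (γ u v) '' Set.Icc (a u v) (b u v)) ?_ ?_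
  · intro u v huv
    obtain ⟨hγ, ha, hb, hab, hends, -, -, -⟩ := h u v huv
    have h1 : IsPathConnected (F (γ u v) '' Set.Icc (a u v) (b u v)) :=
      ((convex_Icc _ _).isPathConnected ⟨_, Set.left_mem_Icc.2 hab.le⟩).image (hFc _ hγ)
    have ma : F (γ u v) (a u v) ∈ F (γ u v) '' Set.Icc (a u v) (b u v) := ⟨_, Set.left_mem_Icc.2 hab.le, rfl⟩
    have mb : F (γ u v) (b u v) ∈ F (γ u v) '' Set.Icc (a u v) (b u v) := ⟨_, Set.right_mem_Icc.2 hab.le, rfl⟩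
    refine h1.joinedIn u ?_ v ?_
    · rcases hends with ⟨e1, e2⟩ | ⟨e1, e2⟩
      · rwa [e1] at ma
      · rwa [e2] at mb
    · rcases hends with ⟨e1, e2⟩ | ⟨e1, e2⟩
      · rwa [e2] at mb
      · rwa [e1] at ma
  · intro u v u' v' huv huv' n1 n2 n3 n4
    obtain ⟨hγ, ha, hb, hab, hends, hu, hv, hI⟩ := h u v huv
    obtain ⟨hγ', ha', hb', hab', hends', hu', hv', hI'⟩ := h u' v' huv'
    refine Set.disjoint_left.2 ?_
    rintro x ⟨t, ht, hx⟩ ⟨t', ht', hx'⟩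
    have hend : ∀ {γ a b u v t}, a < b → ((F γ a = u ∧ F γ b = v) ∨ (F γ a = v ∧ F γ b = u)) →
        (∀ t ∈ Set.Ioo a b, F γ t ∉ W) → t ∈ Set.Icc a b → F γ t ∈ W → F γ t = u ∨ F γ t = v := by
      intro γ a b u v t hab he hI ht hW
      rcases eq_or_lt_of_le ht.1 with h1 | h1
      · subst h1; tauto
      rcases eq_or_lt_of_le ht.2 with h2 | h2
      · subst h2; tauto
      exact absurd hW (hI t ⟨h1, h2⟩)
    have hxW : x ∉ W := by
      intro hxW
      have e1 := hend hab hends hI ht (hx ▸ hxW)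
      have e2 := hend hab' hends' hI' ht' (hx' ▸ hxW)
      rw [hx] at e1
      rw [hx'] at e2
      rcases e1 with rfl | rfl <;> rcases e2 with h | h <;> simp_all
    have it : t ∈ Set.Icc (0 : ℝ) 1 := ⟨ha.1.trans ht.1, ht.2.trans hb.2⟩
    have it' : t' ∈ Set.Icc (0 : ℝ) 1 := ⟨ha'.1.trans ht'.1, ht'.2.trans hb'.2⟩
    by_cases hγγ : γ u v = γ u' v'
    · have htt : t = t' := hFi _ hγ it it' (by rw [hx, hγγ, hx'])
      subst htt
      have hWa : F (γ u v) (a u v) ∈ W ∧ F (γ u v) (b u v) ∈ W := by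
        rcases hends with ⟨e1, e2⟩ | ⟨e1, e2⟩ <;> rw [e1, e2] <;> exact ⟨by assumption, by assumption⟩
      have hWa' : F (γ u' v') (a u' v') ∈ W ∧ F (γ u' v') (b u' v') ∈ W := by
        rcases hends' with ⟨e1, e2⟩ | ⟨e1, e2⟩ <;> rw [e1, e2] <;> exact ⟨by assumption, by assumption⟩
      have l1 : a u v < t := lt_of_le_of_ne ht.1 (fun h => hxW (by rw [← hx, ← h]; exact hWa.1))
      have l2 : t < b u v := lt_of_le_of_ne ht.2 (fun h => hxW (by rw [← hx, h]; exact hWa.2))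
      have l3 : a u' v' < t := lt_of_le_of_ne ht'.1 (fun h => hxW (by rw [← hx', ← h]; exact hWa'.1))
      have l4 : t < b u' v' := lt_of_le_of_ne ht'.2 (fun h => hxW (by rw [← hx', h]; exact hWa'.2))
      rcases lt_trichotomy (a u v) (a u' v') with hlt | heq | hlt
      · exact hI _ ⟨hlt, l3.trans l2⟩ (by rw [hγγ]; exact hWa'.1)
      · rw [← hγγ, ← heq] at hends'
        rcases hends with ⟨e1, e2⟩ | ⟨e1, e2⟩ <;> rcases hends' with ⟨e3, e4⟩ | ⟨e3, e4⟩ <;>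
          rw [e1] at e3 <;> contradiction
      · exact hI' _ ⟨hlt, l1.trans l4⟩ (by rw [← hγγ]; exact hWa.1)
    · exact hxW (hx ▸ hW _ hγ _ hγ' hγγ t it t' it' (by rw [hx, hx']))

end Geo

section Count

theorem mem_image_gen {V L : Type} (f : V → L) (s : Finset V) (v : V) (hv : v ∈ s) : f v ∈ s.image f :=
  Finset.mem_image_of_mem f hv

theorem W_exists (k : ℕ) (P : Finset (ℝ × ℝ)) (C : Finset (Set (ℝ × ℝ))) (h : KIntersecting C k) :
    ∃ W : Finset (ℝ × ℝ), ∀ x, x ∈ W ↔ x ∈ P ∨ ∃ γ ∈ C, ∃ γ' ∈ C, γ ≠ γ' ∧ x ∈ γ ∧ x ∈ γ' := by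
  have hfin : ({x | x ∈ P ∨ ∃ γ ∈ C, ∃ γ' ∈ C, γ ≠ γ' ∧ x ∈ γ ∧ x ∈ γ'} : Set (ℝ × ℝ)).Finite := by
    have h1 : (⋃ γ ∈ C, ⋃ γ' ∈ C, {x : ℝ × ℝ | γ ≠ γ' ∧ x ∈ γ ∧ x ∈ γ'}).Finite := by
      refine Set.Finite.biUnion C.finite_toSet (fun γ hγ => Set.Finite.biUnion C.finite_toSet (fun γ' hγ' => ?_))
      by_cases hne : γ = γ'
      · simp [hne]
      · exact (h.2 γ hγ γ' hγ' hne).1.subset (fun x hx => hx.2)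
    refine (P.finite_toSet.union h1).subset ?_
    rintro x (hx | ⟨γ, hγ, γ', hγ', hx⟩)
    · exact Or.inl hx
    · right
      simp only [Set.mem_iUnion]
      exact ⟨γ, hγ, γ', hγ', hx⟩
  exact ⟨hfin.toFinset, fun x => by simp⟩

theorem pair_le {k : ℕ} {C : Finset (Set (ℝ × ℝ))} (h : KIntersecting C k) (W : Finset (ℝ × ℝ))
    {γ γ' : Set (ℝ × ℝ)} (hγ : γ ∈ C) (hγ' : γ' ∈ C) (hne : γ ≠ γ') :
    (W.filter (fun p => p ∈ γ ∧ p ∈ γ')).card ≤ k := by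
  obtain ⟨h1, h2⟩ := h.2 γ hγ γ' hγ' hne
  refine le_trans ?_ h2
  rw [← Set.ncard_coe_finset]
  exact Set.ncard_le_ncard (fun x hx => by simpa using (Finset.mem_filter.1 (Finset.mem_coe.1 hx)).2) h1

theorem sumsq_le (k n : ℕ) (P : Finset (ℝ × ℝ)) (C : Finset (Set (ℝ × ℝ))) (h : KIntersecting C k)
    (hP : P.card = n) (hC : C.card = n) (W : Finset (ℝ × ℝ))
    (hW : ∀ x, x ∈ W ↔ x ∈ P ∨ ∃ γ ∈ C, ∃ γ' ∈ C, γ ≠ γ' ∧ x ∈ γ ∧ x ∈ γ') :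
    ∑ v ∈ W, (C.filter (fun γ => v ∈ γ)).card ^ 2 ≤ (2 * k + 1) * n ^ 2 := by
  have hdiag : ∀ γ ∈ C, (W.filter (fun p => p ∈ γ)).card ≤ n + n * k := by
    intro γ hγ
    have hsub : W.filter (fun p => p ∈ γ) ⊆ P ∪ (C.erase γ).biUnion (fun γ' => W.filter (fun p => p ∈ γ ∧ p ∈ γ')) := by
      intro x hx
      obtain ⟨hxW, hxγ⟩ := Finset.mem_filter.1 hx
      rw [Finset.mem_union, Finset.mem_biUnion]
      rcases (hW x).1 hxW with hx | ⟨γ1, h1, γ2, h2, hne, hx1, hx2⟩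
      · exact Or.inl hx
      · right
        by_cases e : γ1 = γ
        · exact ⟨γ2, Finset.mem_erase.2 ⟨fun e' => hne (e.trans e'.symm), h2⟩, Finset.mem_filter.2 ⟨hxW, hxγ, hx2⟩⟩
        · exact ⟨γ1, Finset.mem_erase.2 ⟨e, h1⟩, Finset.mem_filter.2 ⟨hxW, hxγ, hx1⟩⟩
    refine (Finset.card_le_card hsub).trans ((Finset.card_union_le _ _).trans ?_)
    rw [hP]
    refine Nat.add_le_add_left (Finset.card_biUnion_le.trans ?_) n
    refine (Finset.sum_le_card_nsmul _ _ k ?_).trans ?_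
    · intro γ' hγ'
      obtain ⟨e, hγ'⟩ := Finset.mem_erase.1 hγ'
      exact pair_le h W hγ hγ' (Ne.symm e)
    · rw [smul_eq_mul]
      exact Nat.mul_le_mul_right _ ((Finset.card_le_card (Finset.erase_subset _ _)).trans hC.le)
  have e1 : ∑ v ∈ W, (C.filter (fun γ => v ∈ γ)).card ^ 2 =
      ∑ γ ∈ C, ∑ γ' ∈ C, (W.filter (fun p => p ∈ γ ∧ p ∈ γ')).card := by
    simp only [Finset.card_filter, sq, Finset.sum_mul_sum]
    rw [Finset.sum_comm]
    refine Finset.sum_congr rfl (fun γ _ => ?_)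
    rw [Finset.sum_comm]
    refine Finset.sum_congr rfl (fun γ' _ => Finset.sum_congr rfl (fun v _ => ?_))
    by_cases a : v ∈ γ <;> by_cases b : v ∈ γ' <;> simp [a, b]
  rw [e1]
  have e2 : ∀ γ ∈ C, ∑ γ' ∈ C, (W.filter (fun p => p ∈ γ ∧ p ∈ γ')).card ≤ (2 * k + 1) * n := by
    intro γ hγ
    rw [← Finset.add_sum_erase _ _ hγ]
    have a1 : (W.filter (fun p => p ∈ γ ∧ p ∈ γ)).card ≤ n + n * k := by
      simpa using hdiag γ hγ
    have a2 : ∑ γ' ∈ C.erase γ, (W.filter (fun p => p ∈ γ ∧ p ∈ γ')).card ≤ n * k := by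
      refine (Finset.sum_le_card_nsmul _ _ k ?_).trans ?_
      · intro γ' hγ'
        obtain ⟨e, hγ'⟩ := Finset.mem_erase.1 hγ'
        exact pair_le h W hγ hγ' (Ne.symm e)
      · rw [smul_eq_mul]
        exact Nat.mul_le_mul_right _ ((Finset.card_le_card (Finset.erase_subset _ _)).trans hC.le)
    refine (Nat.add_le_add a1 a2).trans (le_of_eq (by ring))
  refine (Finset.sum_le_card_nsmul _ _ _ e2).trans (le_of_eq ?_)
  rw [hC, smul_eq_mul]; ring

theorem cutting (k n : ℕ) (P : Finset (ℝ × ℝ)) (C : Finset (Set (ℝ × ℝ))) (h : KIntersecting C k)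
    (hP : P.card = n) (hC : C.card = n) (i : ℕ) :
    ∃ (X : Finset (ℝ × ℝ)) (q : ℝ × ℝ → Finset (ℝ × ℝ)),
      ((∑ γ ∈ C, (X.filter (fun p => p ∈ γ)).card : ℕ) : ℝ) ≤ 80 * (√((2 * k + 1 : ℕ) : ℝ) * n) * √2 ^ i ∧
      (∀ γ ∈ C, (((P.filter (fun p => p ∈ γ ∧ p ∉ X))).image q).card ≤ (X.filter (fun p => p ∈ γ)).card + 1) ∧
      (∀ v ∈ P, v ∉ X → 2 ^ i * (P.filter (fun u => u ∉ X ∧ q u = q v)).card ≤ n) := by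
  obtain ⟨W, hW⟩ := W_exists k P C h
  have hPW : P ⊆ W := fun x hx => (hW x).2 (Or.inl hx)
  have hF : ∀ γ : Set (ℝ × ℝ), ∃ f : ℝ → ℝ × ℝ, γ ∈ C → Continuous f ∧ Set.InjOn f (Set.Icc 0 1) ∧
      f '' Set.Icc 0 1 = γ := by
    intro γ
    by_cases hγ : γ ∈ C
    · obtain ⟨f, hf, hi, hr⟩ := h.1 γ hγ
      refine ⟨Set.IccExtend zero_le_one f, fun _ => ⟨hf.Icc_extend', ?_, ?_⟩⟩
      · intro a ha b hb hab
        rw [Set.IccExtend_of_mem _ _ ha, Set.IccExtend_of_mem _ _ hb] at hab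
        exact congrArg Subtype.val (hi hab)
      · rw [hr]
        ext x
        constructor
        · rintro ⟨t, ht, rfl⟩
          exact ⟨⟨t, ht⟩, (Set.IccExtend_of_mem _ _ ht).symm⟩
        · rintro ⟨t, rfl⟩
          exact ⟨t, t.2, Set.IccExtend_val _ _ t⟩
    · exact ⟨fun _ => 0, fun h => absurd h hγ⟩
  choose F hF using hF
  have hK : NoK5Minor (adjW W C F) := by
    refine adjW_noK5 W C F (fun γ hγ => (hF γ hγ).1) ?_ (fun γ hγ => (hF γ hγ).2.1)
    intro γ hγ γ' hγ' hne t ht t' ht' e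
    refine (hW _).2 (Or.inr ⟨γ, hγ, γ', hγ', hne, ?_, ?_⟩)
    · exact (hF γ hγ).2.2.subset (Set.mem_image_of_mem _ ht)
    · rw [e]; exact (hF γ' hγ').2.2.subset (Set.mem_image_of_mem _ ht')
  obtain ⟨X, hXW, q, hcost, hq, hw⟩ := division_label (adjW_symm W C F) hK W
    (fun v => (C.filter (fun γ => v ∈ γ)).card) (fun v => if v ∈ P then 1 else 0) i
  refine ⟨X, q, ?_, ?_, ?_⟩
  · have e1 : ∑ γ ∈ C, (X.filter (fun p => p ∈ γ)).card = ∑ v ∈ X, (C.filter (fun γ => v ∈ γ)).card := by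
      simp only [Finset.card_filter]
      exact Finset.sum_comm
    rw [e1]
    refine hcost.trans ?_
    gcongr
    refine Real.sqrt_le_iff.2 ⟨by positivity, ?_⟩
    rw [mul_pow, Real.sq_sqrt (by positivity)]
    exact_mod_cast sumsq_le k n P C h hP hC W hW
  · intro γ hγ
    obtain ⟨f1, f2, f3⟩ := hF γ hγ
    have hτ : ∀ v : ℝ × ℝ, ∃ t : ℝ, v ∈ γ → t ∈ Set.Icc (0:ℝ) 1 ∧ F γ t = v := by
      intro v
      by_cases hv : v ∈ γ
      · rw [← f3] at hv
        obtain ⟨t, ht, e⟩ := hv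
        exact ⟨t, fun _ => ⟨ht, e⟩⟩
      · exact ⟨0, fun h => absurd h hv⟩
    choose τ hτ using hτ
    have key := labels_le q (fun v => v ∈ X) τ (W.filter (fun p => p ∈ γ)) (by
      intro u hu v hv e
      have hu' := (Finset.mem_filter.1 (Finset.mem_coe.1 hu)).2
      have hv' := (Finset.mem_filter.1 (Finset.mem_coe.1 hv)).2
      rw [← (hτ u hu').2, ← (hτ v hv').2, e]) (by
      intro u hu v hv huv hx hpu hpv
      obtain ⟨hu, hu'⟩ := Finset.mem_filter.1 hu
      obtain ⟨hv, hv'⟩ := Finset.mem_filter.1 hv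
      refine hq u hu hpu v hv hpv ⟨γ, hγ, τ u, (hτ u hu').1, τ v, (hτ v hv').1, huv,
        Or.inl ⟨(hτ u hu').2, (hτ v hv').2⟩, hu, hv, ?_⟩
      intro t ht htW
      have ht01 : t ∈ Set.Icc (0:ℝ) 1 := ⟨(hτ u hu').1.1.trans ht.1.le, ht.2.le.trans (hτ v hv').1.2⟩
      have hm : F γ t ∈ γ := by
        have : F γ t ∈ F γ '' Set.Icc 0 1 := Set.mem_image_of_mem _ ht01
        rwa [f3] at this
      have e : τ (F γ t) = t := f2 (hτ _ hm).1 ht01 (hτ _ hm).2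
      exact hx (F γ t) (Finset.mem_filter.2 ⟨htW, hm⟩) (by rw [e]; exact ht))
    refine le_trans (Finset.card_le_card ?_) (key.trans (Nat.add_le_add_right (Finset.card_le_card ?_) 1))
    · intro l hl
      obtain ⟨v, hv, rfl⟩ := Finset.mem_image.1 hl
      obtain ⟨hvP, hvγ, hvX⟩ := Finset.mem_filter.1 hv
      refine mem_image_gen q _ v ?_
      simp only [Finset.mem_filter]
      exact ⟨⟨hPW hvP, hvγ⟩, hvX⟩
    · intro v hv
      simp only [Finset.mem_filter] at hv ⊢
      exact ⟨hv.2, hv.1.2⟩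
  · intro v hv hvX
    have h1 := hw v (hPW hv) hvX (P.filter (fun u => u ∉ X ∧ q u = q v))
      ((Finset.filter_subset _ _).trans hPW) (fun u hu => (Finset.mem_filter.1 hu).2)
    have e1 : ∑ u ∈ P.filter (fun u => u ∉ X ∧ q u = q v), (if u ∈ P then 1 else 0) =
        (P.filter (fun u => u ∉ X ∧ q u = q v)).card := by
      rw [Finset.card_eq_sum_ones]
      exact Finset.sum_congr rfl (fun u hu => if_pos (Finset.mem_filter.1 hu).1)
    have e2 : ∑ u ∈ W, (if u ∈ P then 1 else 0) = n := by
      rw [← Finset.card_filter, ← hP]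
      congr 1
      ext x
      simp only [Finset.mem_filter]
      exact ⟨fun h => h.2, fun h => ⟨hPW h, h⟩⟩
    calc _ = _ := by rw [← e1]
      _ ≤ _ := by convert h1
      _ = n := by convert e2
end Count

section Bound

theorem inc_bound (k s n i : ℕ) (c K : ℝ) (hc : 0 ≤ c)
    (hloc : ∀ (P : Finset (ℝ × ℝ)) (C : Finset (Set (ℝ × ℝ))),
      (∀ γ ∈ C, ∀ γ' ∈ C, γ ≠ γ' → (P.filter (fun p => p ∈ γ ∧ p ∈ γ')).card ≤ k) →
      ¬ ContainsConfig P C s k →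
      ((∑ γ ∈ C.filter (fun γ => s ≤ tt P γ), tt P γ : ℕ) : ℝ) ≤ c * (P.card : ℝ) ^ (k + 1) + K * P.card)
    (hK : 0 ≤ K)
    (P : Finset (ℝ × ℝ)) (C : Finset (Set (ℝ × ℝ))) (hP : P.card = n) (hC : C.card = n)
    (h : KIntersecting C k) (hno : ¬ ContainsConfig P C s k) :
    (incidences P C : ℝ) ≤ (s + 1) * (80 * (√((2 * k + 1 : ℕ) : ℝ) * n) * √2 ^ i) + s * n +
      (c * n * (n / 2 ^ i) ^ k + K * n) := by
  obtain ⟨X, q, h1, h2, h3⟩ := cutting k n P C h hP hC i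
  set Q := (P.filter (fun p => p ∉ X)).image q with hQ
  set PP : Finset (ℝ × ℝ) → Finset (ℝ × ℝ) := fun l => P.filter (fun u => u ∉ X ∧ q u = l) with hPP
  have hγ : ∀ γ ∈ C, tt P γ ≤ (s + 1) * (X.filter (fun p => p ∈ γ)).card + s +
      ∑ l ∈ Q, if s ≤ tt (PP l) γ then tt (PP l) γ else 0 := by
    intro γ hγ
    have a1 : tt P γ ≤ (X.filter (fun p => p ∈ γ)).card + (P.filter (fun p => p ∈ γ ∧ p ∉ X)).card := by
      unfold tt
      refine le_trans (Finset.card_le_card ?_) (Finset.card_union_le _ _)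
      intro x hx
      simp only [Finset.mem_filter, Finset.mem_union] at hx ⊢
      by_cases hxX : x ∈ X <;> simp [hx, hxX]
    have a2 : (P.filter (fun p => p ∈ γ ∧ p ∉ X)).card =
        ∑ l ∈ (P.filter (fun p => p ∈ γ ∧ p ∉ X)).image q, tt (PP l) γ := by
      rw [Finset.card_eq_sum_card_image q]
      refine Finset.sum_congr rfl (fun l _ => ?_)
      unfold tt
      congr 1
      ext x
      simp only [hPP, Finset.mem_filter]
      tauto
    have a3 : ∑ l ∈ (P.filter (fun p => p ∈ γ ∧ p ∉ X)).image q, tt (PP l) γ ≤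
        ∑ l ∈ (P.filter (fun p => p ∈ γ ∧ p ∉ X)).image q, (s + if s ≤ tt (PP l) γ then tt (PP l) γ else 0) := by
      refine Finset.sum_le_sum (fun l _ => ?_)
      split_ifs <;> omega
    rw [Finset.sum_add_distrib, Finset.sum_const, smul_eq_mul] at a3
    have a4 : ∑ l ∈ (P.filter (fun p => p ∈ γ ∧ p ∉ X)).image q, (if s ≤ tt (PP l) γ then tt (PP l) γ else 0) ≤
        ∑ l ∈ Q, if s ≤ tt (PP l) γ then tt (PP l) γ else 0 := by
      refine Finset.sum_le_sum_of_subset (Finset.image_subset_image ?_)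
      intro x hx
      simp only [Finset.mem_filter] at hx ⊢
      tauto
    have a5 := Nat.mul_le_mul_right s (h2 γ hγ)
    have a6 : ((X.filter (fun p => p ∈ γ)).card + 1) * s + (X.filter (fun p => p ∈ γ)).card =
      (s + 1) * (X.filter (fun p => p ∈ γ)).card + s := by ring
    omega
  have hsum : incidences P C ≤ (s + 1) * ∑ γ ∈ C, (X.filter (fun p => p ∈ γ)).card + s * n +
      ∑ l ∈ Q, ∑ γ ∈ C.filter (fun γ => s ≤ tt (PP l) γ), tt (PP l) γ := by
    have b1 : incidences P C ≤ ∑ γ ∈ C, ((s + 1) * (X.filter (fun p => p ∈ γ)).card + s +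
      ∑ l ∈ Q, if s ≤ tt (PP l) γ then tt (PP l) γ else 0) := Finset.sum_le_sum hγ
    rw [Finset.sum_add_distrib, Finset.sum_add_distrib, ← Finset.mul_sum, Finset.sum_const, smul_eq_mul, hC,
      Finset.sum_comm, mul_comm n s] at b1
    simpa only [Finset.sum_filter] using b1
  have hl : ∀ l ∈ Q, ((∑ γ ∈ C.filter (fun γ => s ≤ tt (PP l) γ), tt (PP l) γ : ℕ) : ℝ) ≤
      (c * ((n : ℝ) / 2 ^ i) ^ k + K) * (PP l).card := by
    intro l hlQ
    obtain ⟨v, hv, rfl⟩ := Finset.mem_image.1 hlQ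
    obtain ⟨hvP, hvX⟩ := Finset.mem_filter.1 hv
    have hm := h3 v hvP hvX
    have hm' : ((PP (q v)).card : ℝ) ≤ n / 2 ^ i := by
      rw [le_div_iff₀ (by positivity), mul_comm]
      exact_mod_cast hm
    refine (hloc (PP (q v)) C (fun γ hγ γ' hγ' hne => pair_le h _ hγ hγ' hne)
      (fun hcon => hno (hcon.mono (Finset.filter_subset _ _) (Finset.Subset.refl _)))).trans ?_
    have : ((PP (q v)).card : ℝ) ^ k ≤ (n / 2 ^ i) ^ k := by gcongr
    rw [pow_succ, add_mul, ← mul_assoc]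
    gcongr
  have hQn : ((∑ l ∈ Q, (PP l).card : ℕ) : ℝ) ≤ n := by
    have : ∑ l ∈ Q, (PP l).card ≤ n := by
      have e := Finset.card_eq_sum_card_image q (P.filter (fun p => p ∉ X))
      rw [← hP]
      refine le_trans (le_of_eq ?_) (Finset.card_le_card (Finset.filter_subset (fun p => p ∉ X) P))
      rw [e]
      refine Finset.sum_congr rfl (fun l _ => ?_)
      simp only [hPP, Finset.filter_filter]
    exact_mod_cast this
  have hfin : ((∑ l ∈ Q, ∑ γ ∈ C.filter (fun γ => s ≤ tt (PP l) γ), tt (PP l) γ : ℕ) : ℝ) ≤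
      (c * ((n : ℝ) / 2 ^ i) ^ k + K) * n := by
    rw [Nat.cast_sum]
    refine (Finset.sum_le_sum hl).trans ?_
    rw [← Finset.mul_sum, ← Nat.cast_sum]
    gcongr
  have hsum' : (incidences P C : ℝ) ≤ (s + 1) * ((∑ γ ∈ C, (X.filter (fun p => p ∈ γ)).card : ℕ) : ℝ) + s * n +
      ((∑ l ∈ Q, ∑ γ ∈ C.filter (fun γ => s ≤ tt (PP l) γ), tt (PP l) γ : ℕ) : ℝ) := by
    exact_mod_cast hsum
  have hA : ((s : ℝ) + 1) * ((∑ γ ∈ C, (X.filter (fun p => p ∈ γ)).card : ℕ) : ℝ) ≤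
      (s + 1) * (80 * (√((2 * k + 1 : ℕ) : ℝ) * n) * √2 ^ i) := by gcongr
  have e3 : (c * ((n : ℝ) / 2 ^ i) ^ k + K) * n = c * n * (n / 2 ^ i) ^ k + K * n := by ring
  linarith

theorem exists_pow_two (z : ℝ) (hz : 1 ≤ z) : ∃ i : ℕ, (2:ℝ) ^ i ≤ z ∧ z < 2 ^ (i + 1) := by
  obtain ⟨i, h1, h2⟩ := exists_nat_pow_near hz (by norm_num : (1:ℝ) < 2)
  exact ⟨i, h1, h2⟩

end Bound

theorem solymosi_type_kintersecting (k s : ℕ) (hk : 1 ≤ k) (hs : k + 1 < s) :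
    ∀ ε : ℝ, 0 < ε → ∃ n₀ : ℕ, ∀ n : ℕ, n₀ ≤ n →
      ∀ P : Finset (ℝ × ℝ), ∀ C : Finset (Set (ℝ × ℝ)),
        P.card = n → C.card = n → KIntersecting C k →
        ¬ ContainsConfig P C s k →
        (incidences P C : ℝ) < ε * (n : ℝ) ^ ((3 * (k:ℝ) + 1) / (2 * (k:ℝ) + 1)) := by
  intro ε hε
  set A : ℝ := (s + 1) * (80 * √((2 * k + 1 : ℕ) : ℝ)) with hA
  have hApos : 0 < A := by positivity
  set η : ℝ := ε / (4 * A) with hη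
  have hηpos : 0 < η := by positivity
  set δ : ℝ := η ^ 2 with hδ
  have hδpos : 0 < δ := by positivity
  set c : ℝ := (ε / 4) * (δ / 2) ^ k with hcdef
  have hcpos : 0 < c := by positivity
  obtain ⟨K, hK0, hloc⟩ := local_lemma k s hk hs c hcpos
  have hkpos : (0:ℝ) < k := by exact_mod_cast hk
  set α : ℝ := (k : ℝ) / (2 * k + 1) with hα
  have hαpos : 0 < α := by positivity
  have hlim : Filter.Tendsto (fun n : ℕ => (n : ℝ) ^ α) Filter.atTop Filter.atTop :=
    (tendsto_rpow_atTop hαpos).comp tendsto_natCast_atTop_atTop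
  obtain ⟨n₀, hn₀⟩ := Filter.eventually_atTop.1 ((hlim.eventually_ge_atTop ((s + K) * 4 / ε)).and
    ((hlim.eventually_ge_atTop (1 / η)).and (Filter.eventually_ge_atTop 1)))
  refine ⟨n₀, fun n hn P C hP hC h hno => ?_⟩
  obtain ⟨g1, g2, g3⟩ := hn₀ n hn
  set y : ℝ := (n : ℝ) ^ α with hy
  have hnpos : (0:ℝ) < n := by exact_mod_cast g3
  have hypos : 0 < y := Real.rpow_pos_of_pos hnpos _
  have hny : (n : ℝ) ^ ((3 * (k:ℝ) + 1) / (2 * (k:ℝ) + 1)) = n * y := by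
    have : (3 * (k:ℝ) + 1) / (2 * (k:ℝ) + 1) = 1 + α := by
      rw [hα]; field_simp; ring
    rw [this, Real.rpow_add hnpos, Real.rpow_one]
  have hyy : (n / y ^ 2) ^ k = y := by
    have e1 : (n : ℝ) / y ^ 2 = (n : ℝ) ^ (1 / (2 * (k:ℝ) + 1)) := by
      rw [hy, ← Real.rpow_natCast, ← Real.rpow_mul hnpos.le]
      nth_rewrite 1 [← Real.rpow_one (n : ℝ)]
      rw [← Real.rpow_sub hnpos]
      congr 1
      rw [hα]; push_cast; field_simp; ring
    rw [e1, ← Real.rpow_natCast, ← Real.rpow_mul hnpos.le, hy]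
    congr 1
    rw [hα]; field_simp
  have hηy : 1 ≤ η * y := by
    rw [div_le_iff₀ hηpos] at g2; linarith
  have hz : 1 ≤ δ * y ^ 2 := by
    rw [hδ, ← mul_pow]; exact one_le_pow₀ hηy
  obtain ⟨i, hi1, hi2⟩ := exists_pow_two _ hz
  have hb := inc_bound k s n i c K hcpos.le hloc hK0 P C hP hC h hno
  have hs2 : √2 ^ i ≤ η * y := by
    refine (pow_le_pow_iff_left₀ (by positivity) (by positivity) two_ne_zero).1 ?_
    rw [← pow_mul, mul_comm i 2, pow_mul, Real.sq_sqrt (by norm_num), mul_pow]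
    exact hi1
  have hfrac : ((n : ℝ) / 2 ^ i) ^ k ≤ (2 / δ) ^ k * y := by
    suffices H : ((n : ℝ) / 2 ^ i) ^ k ≤ (2 / δ * (n / y ^ 2)) ^ k by
      rwa [mul_pow, hyy] at H
    refine pow_le_pow_left₀ (by positivity) ?_ k
    rw [div_mul_div_comm, div_le_div_iff₀ (by positivity) (by positivity)]
    have e2 : (2:ℝ) ^ (i + 1) = 2 ^ i * 2 := pow_succ _ _
    rw [e2] at hi2
    nlinarith
  have t1 : ((s:ℝ) + 1) * (80 * (√((2 * k + 1 : ℕ) : ℝ) * n) * √2 ^ i) ≤ ε / 4 * (n * y) := by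
    have : ((s:ℝ) + 1) * (80 * (√((2 * k + 1 : ℕ) : ℝ) * n) * √2 ^ i) = A * n * √2 ^ i := by rw [hA]; ring
    rw [this]
    have e : ε / 4 = A * η := by rw [hη]; field_simp
    calc A * n * √2 ^ i ≤ A * n * (η * y) := by gcongr
      _ = ε / 4 * (n * y) := by rw [e]; ring
  have t2 : c * n * ((n : ℝ) / 2 ^ i) ^ k ≤ ε / 4 * (n * y) := by
    have e : (δ / 2) ^ k * (2 / δ) ^ k = 1 := by
      rw [← mul_pow]; field_simp; simp
    calc c * n * ((n : ℝ) / 2 ^ i) ^ k ≤ c * n * ((2 / δ) ^ k * y) := by gcongr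
      _ = ε / 4 * (n * y) * ((δ / 2) ^ k * (2 / δ) ^ k) := by rw [hcdef]; ring
      _ = _ := by rw [e, mul_one]
  have t3 : (s : ℝ) * n + K * n ≤ ε / 4 * (n * y) := by
    rw [div_le_iff₀ hε] at g1
    nlinarith
  have t4 : 0 < ε * (n * y) := by positivity
  rw [hny]
  linarith
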